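/- Let T = S¹ × S¹ be the torus with its product smooth manifold structure, where S¹ is the unit circle in ℂ, and let f, g : T → ℝ be smooth functions each having exactly three critical points. Then f and g are topologically conjugate: there exist a homeomorphism h : T → T and a strictly increasing homeomorphism h' : ℝ → ℝ such that f ∘ h = h' ∘ g. (Up to topological conjugation there is a unique minimal function on the torus.) -/

import Mathlib

section Helpers

open Set Filter Topology
open scoped NNReal

section GlobalFlow

variable {E : Type*} [NormedAddCommGroup E] [NormedSpace ℝ E]

theorem exists_global_solution [CompleteSpace E] {v : E → E} {K L : ℝ≥0} (hK : LipschitzWith K v)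
    (hL : ∀ x, ‖v x‖ ≤ L) (x : E) :
    ∃ α : ℝ → E, α 0 = x ∧ ∀ t, HasDerivAt α (v (α t)) t := by
  have key : ∀ n : ℕ, ∃ α : ℝ → E, α 0 = x ∧
      ∀ t ∈ Ioo (-((n : ℝ) + 1)) (n + 1), HasDerivAt α (v (α t)) t := by
    intro n
    have hn : (0 : ℝ) ≤ (n : ℝ) + 1 := by positivity
    have h0 : (0 : ℝ) ∈ Icc (-((n : ℝ) + 1)) (n + 1) := ⟨by linarith, hn⟩
    have hPL : IsPicardLindelof (fun _ => v) ⟨0, h0⟩ x (L * ⟨(n : ℝ) + 1, hn⟩) 0 L K := by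
      refine IsPicardLindelof.of_time_independent (fun y _ => hL y) hK.lipschitzOnWith ?_
      have : (((L * ⟨(n : ℝ) + 1, hn⟩ : ℝ≥0)) : ℝ) = L * ((n : ℝ) + 1) := rfl
      rw [this]
      simp
    obtain ⟨α, h1, h2⟩ := hPL.exists_eq_forall_mem_Icc_hasDerivWithinAt₀
    exact ⟨α, h1, fun t ht => (h2 t (Ioo_subset_Icc_self ht)).hasDerivAt
      (Icc_mem_nhds ht.1 ht.2)⟩
  choose α h0 hα using key
  have agree : ∀ n m : ℕ, n ≤ m → EqOn (α n) (α m) (Ioo (-((n : ℝ) + 1)) (n + 1)) := by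
    intro n m hnm
    have hnm' : (n : ℝ) ≤ m := by exact_mod_cast hnm
    have hn : (0 : ℝ) < (n : ℝ) + 1 := by positivity
    refine ODE_solution_unique_of_mem_Ioo (v := fun _ => v) (s := fun _ => univ) (K := K)
      (t₀ := 0) (fun _ _ => hK.lipschitzOnWith) ⟨by linarith, hn⟩
      (fun t ht => ⟨hα n t ht, mem_univ _⟩) (fun t ht => ⟨hα m t ⟨?_, ?_⟩, mem_univ _⟩) ?_
    · linarith [ht.1]
    · linarith [ht.2]
    · rw [h0, h0]
  refine ⟨fun t => α ⌈|t|⌉₊ t, h0 _, fun t => ?_⟩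
  set m := ⌈|t|⌉₊ + 1 with hm
  have htm : |t| ≤ (⌈|t|⌉₊ : ℝ) := Nat.le_ceil _
  have hev : (fun s : ℝ => α ⌈|s|⌉₊ s) =ᶠ[𝓝 t] α m := by
    have hlt : |t| < (m : ℝ) := by rw [hm]; push_cast; linarith
    have : ∀ᶠ s : ℝ in 𝓝 t, |s| < (m : ℝ) := (continuous_abs.tendsto t).eventually (gt_mem_nhds hlt)
    filter_upwards [this] with s hs
    have hs' : |s| ≤ (⌈|s|⌉₊ : ℝ) := Nat.le_ceil _
    refine agree _ _ (Nat.ceil_le.2 hs.le) ?_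
    constructor <;> [linarith [neg_abs_le s]; linarith [le_abs_self s]]
  have hmem : t ∈ Ioo (-((m : ℝ) + 1)) (m + 1) := by
    rw [hm]; push_cast
    constructor <;> [linarith [neg_abs_le t]; linarith [le_abs_self t]]
  have := (hα m t hmem).congr_of_eventuallyEq hev
  rwa [← hev.eq_of_nhds] at this

theorem dist_solution_le {v : E → E} {K : ℝ≥0} (hK : LipschitzWith K v) {α β : ℝ → E}
    (hα : ∀ t, HasDerivAt α (v (α t)) t) (hβ : ∀ t, HasDerivAt β (v (β t)) t) (t : ℝ) :
    dist (α t) (β t) ≤ dist (α 0) (β 0) * Real.exp (K * |t|) := by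
  have fwd : ∀ {w : E → E}, LipschitzWith K w → ∀ {α β : ℝ → E},
      (∀ t, HasDerivAt α (w (α t)) t) → (∀ t, HasDerivAt β (w (β t)) t) → ∀ t, 0 ≤ t →
      dist (α t) (β t) ≤ dist (α 0) (β 0) * Real.exp (K * t) := by
    intro w hw α β hα hβ t ht
    have := dist_le_of_trajectories_ODE (v := fun _ => w) (a := 0) (b := t) (fun _ => hw)
      (fun s _ => (hα s).continuousAt.continuousWithinAt) (fun s _ => (hα s).hasDerivWithinAt)
      (fun s _ => (hβ s).continuousAt.continuousWithinAt) (fun s _ => (hβ s).hasDerivWithinAt)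
      le_rfl t ⟨ht, le_rfl⟩
    simpa using this
  rcases le_total 0 t with ht | ht
  · rw [abs_of_nonneg ht]; exact fwd hK hα hβ t ht
  · rw [abs_of_nonpos ht]
    have rev : ∀ {α : ℝ → E}, (∀ t, HasDerivAt α (v (α t)) t) →
        ∀ t, HasDerivAt (fun s => α (-s)) (-v (α (-t))) t := by
      intro α hα t
      simpa [Function.comp_def] using (hα (-t)).scomp t (hasDerivAt_neg t)
    have := fwd (w := fun x => -v x) hK.neg (rev hα) (rev hβ) (-t) (by linarith)
    simpa using this

theorem exists_global_flow [CompleteSpace E] {v : E → E} {K L : ℝ≥0} (hK : LipschitzWith K v)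
    (hL : ∀ x, ‖v x‖ ≤ L) :
    ∃ φ : ℝ → E → E, (∀ x, φ 0 x = x) ∧ (∀ x t, HasDerivAt (fun s => φ s x) (v (φ t x)) t) ∧
      (∀ s t x, φ (s + t) x = φ s (φ t x)) ∧ (Continuous fun q : ℝ × E => φ q.1 q.2) ∧
      ∀ w, (∀ x, v (x + w) = v x) → ∀ t x, φ t (x + w) = φ t x + w := by
  choose φ h0 hφ using exists_global_solution hK hL
  have uniq : ∀ {α β : ℝ → E}, (∀ t, HasDerivAt α (v (α t)) t) →
      (∀ t, HasDerivAt β (v (β t)) t) → α 0 = β 0 → α = β := fun hα hβ h =>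
    ODE_solution_unique_univ (v := fun _ => v) (s := fun _ => univ) (K := K) (t₀ := 0)
      (fun _ => hK.lipschitzOnWith) (fun t => ⟨hα t, mem_univ _⟩) (fun t => ⟨hβ t, mem_univ _⟩) h
  refine ⟨fun t x => φ x t, h0, hφ, ?_, ?_, ?_⟩
  · intro s t x
    have := uniq (α := fun s => φ x (s + t)) (β := φ (φ x t))
      (fun s => (hφ x (s + t)).comp_add_const s t) (hφ _) (by simp [h0])
    exact congrFun this s
  · rw [continuous_iff_continuousAt]
    rintro ⟨t, x⟩
    have h1 : Tendsto (fun q : ℝ × E => dist q.2 x * Real.exp (K * |q.1|) + dist (φ x q.1) (φ x t))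
        (𝓝 (t, x)) (𝓝 0) := by
      have hc : Continuous (φ x) := continuous_iff_continuousAt.2 fun s => (hφ x s).continuousAt
      have : Continuous (fun q : ℝ × E =>
          dist q.2 x * Real.exp (K * |q.1|) + dist (φ x q.1) (φ x t)) := by fun_prop
      simpa using this.tendsto (t, x)
    refine tendsto_iff_dist_tendsto_zero.2 (squeeze_zero (fun _ => dist_nonneg) (fun q => ?_) h1)
    refine (dist_triangle _ (φ x q.1) _).trans (add_le_add_left ?_ _)
    have := dist_solution_le hK (hφ q.2) (hφ x) q.1
    rwa [h0, h0] at this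
  · intro w hw t x
    have := uniq (α := φ (x + w)) (β := fun s => φ x s + w) (hφ _)
      (fun s => by rw [hw]; exact (hφ x s).add_const w) (by simp [h0])
    exact congrFun this t

end GlobalFlow

theorem exists_circleExp_lift {A : Type*} [TopologicalSpace A] [SimplyConnectedSpace A]
    [LocallyPathConnectedSpace A] {g : A → Circle} (hg : Continuous g) :
    ∃ q : A → ℝ, Continuous q ∧ ∀ a, Circle.exp (q a) = g a := by
  obtain ⟨a₀⟩ : Nonempty A := inferInstance
  obtain ⟨e₀, he⟩ : ∃ e, Circle.exp e = g a₀ := ⟨_, Circle.exp_arg _⟩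
  obtain ⟨F, ⟨_, hF⟩, _⟩ :=
    Circle.isCoveringMap_exp.existsUnique_continuousMap_lifts ⟨g, hg⟩ a₀ e₀ he
  exact ⟨F, F.continuous, fun a => congrFun hF a⟩

/-- A continuous function of Morse type on a space: a gradient-like flow `Y`, a flow `Z` along the
level sets, and their common fixed-point set `C`. -/
structure MorseSys (T : Type*) [TopologicalSpace T] where
  f : T → ℝ
  Y : ℝ → T → T
  Z : ℝ → T → T
  C : Set T
  f_cont : Continuous f
  Y_cont : Continuous fun q : ℝ × T => Y q.1 q.2
  Y_zero : ∀ x, Y 0 x = x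
  Y_add : ∀ s t x, Y (s + t) x = Y s (Y t x)
  Z_cont : Continuous fun q : ℝ × T => Z q.1 q.2
  Z_zero : ∀ x, Z 0 x = x
  Z_add : ∀ s t x, Z (s + t) x = Z s (Z t x)
  f_Z : ∀ s x, f (Z s x) = f x
  mono : ∀ x, x ∉ C → StrictMono fun s => f (Y s x)
  Y_crit : ∀ x ∈ C, ∀ s, Y s x = x
  Z_crit : ∀ x ∈ C, ∀ s, Z s x = x
  box : ∀ q, q ∉ C → ∀ ε > 0, ∀ᶠ z : T × T in 𝓝 (q, q), f z.1 = f z.2 →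
    ∃ s, |s| < ε ∧ Z s z.1 = z.2
  noper : ∀ q, q ∉ C → ∃ ε > 0, ∀ᶠ x in 𝓝 q, ∀ s, 0 < |s| → |s| < ε → Z s x ≠ x
  punct : ∀ c : T, ∀ U ∈ 𝓝 c, ∃ B ∈ 𝓝 c, B ⊆ U ∧ IsPreconnected (B \ {c})
  neBot : ∀ c : T, (𝓝[≠] c).NeBot

namespace MorseSys

variable {T : Type*} [TopologicalSpace T] (S : MorseSys T)

/-- The system of `-f`. -/
def neg : MorseSys T where
  f x := - S.f x
  Y s x := S.Y (-s) x
  Z := S.Z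
  C := S.C
  f_cont := S.f_cont.neg
  Y_cont := S.Y_cont.comp (f := fun q : ℝ × T => (-q.1, q.2)) (by fun_prop)
  Y_zero x := by simp [S.Y_zero]
  Y_add s t x := by rw [neg_add, S.Y_add]
  Z_cont := S.Z_cont
  Z_zero := S.Z_zero
  Z_add := S.Z_add
  f_Z s x := by rw [S.f_Z]
  mono x hx s t hst := by
    have := S.mono x hx (neg_lt_neg hst)
    simpa using this
  Y_crit x hx s := S.Y_crit x hx _
  Z_crit := S.Z_crit
  box q hq ε hε := by simpa using S.box q hq ε hε
  noper := S.noper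
  punct := S.punct
  neBot := S.neBot

/-- The system of `N ∘ f` for a strictly increasing homeomorphism `N`. -/
def comp (N : ℝ ≃ₜ ℝ) (hN : StrictMono N) : MorseSys T where
  f x := N (S.f x)
  Y := S.Y
  Z := S.Z
  C := S.C
  f_cont := N.continuous.comp S.f_cont
  Y_cont := S.Y_cont
  Y_zero := S.Y_zero
  Y_add := S.Y_add
  Z_cont := S.Z_cont
  Z_zero := S.Z_zero
  Z_add := S.Z_add
  f_Z s x := by rw [S.f_Z]
  mono x hx s t hst := hN (S.mono x hx hst)
  Y_crit := S.Y_crit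
  Z_crit := S.Z_crit
  box q hq ε hε := by simpa using S.box q hq ε hε
  noper := S.noper
  punct := S.punct
  neBot := S.neBot

theorem Y_neg_Y (s : ℝ) (x : T) : S.Y (-s) (S.Y s x) = x := by
  rw [← S.Y_add]; simp [S.Y_zero]

theorem Z_neg_Z (s : ℝ) (x : T) : S.Z (-s) (S.Z s x) = x := by
  rw [← S.Z_add]; simp [S.Z_zero]

theorem Y_not_crit {x : T} (hx : x ∉ S.C) (s : ℝ) : S.Y s x ∉ S.C := fun h => by
  have := S.Y_crit _ h (-s)
  rw [S.Y_neg_Y] at this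
  exact hx (this ▸ h)

theorem Z_not_crit {x : T} (hx : x ∉ S.C) (s : ℝ) : S.Z s x ∉ S.C := fun h => by
  have := S.Z_crit _ h (-s)
  rw [S.Z_neg_Z] at this
  exact hx (this ▸ h)

theorem Y_cont_left (x : T) : Continuous fun s => S.Y s x :=
  S.Y_cont.comp (f := fun s : ℝ => (s, x)) (by fun_prop)

theorem Y_cont_right (s : ℝ) : Continuous fun x => S.Y s x :=
  S.Y_cont.comp (f := fun x : T => (s, x)) (by fun_prop)

theorem Z_cont_left (x : T) : Continuous fun s => S.Z s x :=
  S.Z_cont.comp (f := fun s : ℝ => (s, x)) (by fun_prop)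

theorem Z_cont_right (s : ℝ) : Continuous fun x => S.Z s x :=
  S.Z_cont.comp (f := fun x : T => (s, x)) (by fun_prop)

/-- `z` flows along `Y` to level `t`. -/
def Reach (z : T) (t : ℝ) : Prop := z ∉ S.C ∧ ∃ s, S.f (S.Y s z) = t

theorem reach_up [CompactSpace T] {x : T} (hx : x ∉ S.C) {t : ℝ} (hxt : S.f x ≤ t)
    (hC : ∀ c ∈ S.C, S.f x < S.f c → t < S.f c) : S.Reach x t := by
  refine ⟨hx, ?_⟩
  by_contra hne
  push Not at hne
  have hcont : Continuous fun s => S.f (S.Y s x) := S.f_cont.comp (S.Y_cont_left x)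
  have hmono := S.mono x hx
  have hlt : ∀ s, S.f (S.Y s x) < t := by
    intro s
    by_contra! h
    have h0 : S.f (S.Y 0 x) ≤ t := by rwa [S.Y_zero]
    have := mem_range_of_exists_le_of_exists_ge hcont ⟨0, h0⟩ ⟨s, h⟩
    obtain ⟨r, hr⟩ := this
    exact hne r hr
  have hbdd : BddAbove (range fun s => S.f (S.Y s x)) := ⟨t, by rintro _ ⟨s, rfl⟩; exact (hlt s).le⟩
  have hlim := tendsto_atTop_ciSup hmono.monotone hbdd
  set a := ⨆ s, S.f (S.Y s x)
  obtain ⟨U, hU⟩ := Ultrafilter.exists_le (atTop : Filter ℝ)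
  obtain ⟨z, -, hz⟩ := isCompact_univ.ultrafilter_le_nhds (U.map fun s => S.Y s x) (by simp)
  have hz : Tendsto (fun s => S.Y s x) U (𝓝 z) := hz
  have hfz : ∀ h, S.f (S.Y h z) = a := by
    intro h
    have h1 : Tendsto (fun s => S.f (S.Y h (S.Y s x))) U (𝓝 (S.f (S.Y h z))) :=
      ((S.f_cont.comp (S.Y_cont_right h)).tendsto z).comp hz
    have h2 : Tendsto (fun s => S.f (S.Y (h + s) x)) U (𝓝 a) :=
      (hlim.comp (tendsto_atTop_add_const_left atTop h tendsto_id)).mono_left hU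
    simp only [S.Y_add] at h2
    exact tendsto_nhds_unique h1 h2
  have hzC : z ∈ S.C := by
    by_contra hzC
    have := S.mono z hzC (zero_lt_one)
    simp only [hfz, lt_irrefl] at this
  have ha : S.f z = a := by simpa [S.Y_zero] using hfz 0
  have h1 : S.f x < a := by
    have h3 := hmono (zero_lt_one)
    simp only [S.Y_zero] at h3
    exact h3.trans_le (le_ciSup hbdd 1)
  have h2 : a ≤ t := ciSup_le fun s => (hlt s).le
  have := hC z hzC (ha ▸ h1)
  linarith

theorem reach_neg {x : T} {t : ℝ} (h : S.neg.Reach x (-t)) : S.Reach x t := by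
  obtain ⟨hx, s, hs⟩ := h
  refine ⟨hx, -s, ?_⟩
  simpa [neg] using hs

theorem reach_down [CompactSpace T] {x : T} (hx : x ∉ S.C) {t : ℝ} (hxt : t ≤ S.f x)
    (hC : ∀ c ∈ S.C, S.f c < S.f x → S.f c < t) : S.Reach x t := by
  apply S.reach_neg
  apply S.neg.reach_up hx (by simpa [neg] using hxt)
  intro c hc h
  have := hC c hc (by simpa [neg] using h)
  simpa [neg] using this

open Classical in
/-- The time at which the `Y`-orbit of `z` crosses level `t`. -/
noncomputable def time (z : T) (t : ℝ) : ℝ := if h : ∃ s, S.f (S.Y s z) = t then h.choose else 0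

/-- The point at level `t` of the `Y`-orbit of `z`. -/
noncomputable def proj (z : T) (t : ℝ) : T := S.Y (S.time z t) z

variable {S}

theorem Reach.f_proj {z : T} {t : ℝ} (h : S.Reach z t) : S.f (S.proj z t) = t := by
  unfold proj time
  rw [dif_pos h.2]
  exact h.2.choose_spec

theorem Reach.not_crit {z : T} {t : ℝ} (h : S.Reach z t) : S.proj z t ∉ S.C :=
  S.Y_not_crit h.1 _

theorem time_eq {z : T} {t s : ℝ} (hz : z ∉ S.C) (hs : S.f (S.Y s z) = t) : S.time z t = s := by
  have h : S.Reach z t := ⟨hz, s, hs⟩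
  have := h.f_proj
  unfold proj at this
  exact (S.mono z hz).injective (this.trans hs.symm)

theorem proj_eq {z w : T} {t s : ℝ} (hz : z ∉ S.C) (hs : S.Y s z = w) (hw : S.f w = t) :
    S.proj z t = w := by
  unfold proj
  rw [time_eq hz (s := s) (by rw [hs, hw]), hs]

theorem proj_self {z : T} (hz : z ∉ S.C) : S.proj z (S.f z) = z :=
  proj_eq hz (s := 0) (S.Y_zero z) rfl

theorem Reach.trans {z : T} {t t' : ℝ} (h : S.Reach z t) (h' : S.Reach z t') :
    S.Reach (S.proj z t) t' := by
  refine ⟨h.not_crit, S.time z t' - S.time z t, ?_⟩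
  unfold proj
  rw [← S.Y_add, sub_add_cancel]
  exact h'.f_proj

theorem Reach.proj_proj {z : T} {t t' : ℝ} (h : S.Reach z t) (h' : S.Reach z t') :
    S.proj (S.proj z t) t' = S.proj z t' := by
  refine proj_eq h.not_crit (s := S.time z t' - S.time z t) ?_ h'.f_proj
  unfold proj
  rw [← S.Y_add]
  simp

theorem Reach.proj_back {z : T} {t : ℝ} (h : S.Reach z t) :
    S.proj (S.proj z t) (S.f z) = z := by
  have h0 : S.Reach z (S.f z) := ⟨h.1, 0, by rw [S.Y_zero]⟩
  rw [h.proj_proj h0, proj_self h.1]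

theorem reach_self {z : T} (hz : z ∉ S.C) : S.Reach z (S.f z) := ⟨hz, 0, by rw [S.Y_zero]⟩

theorem Reach.back {z : T} {t : ℝ} (h : S.Reach z t) : S.Reach (S.proj z t) (S.f z) :=
  h.trans (reach_self h.1)

theorem Reach.eventually {z : T} {t : ℝ} (h : S.Reach z t) {ε : ℝ} (hε : 0 < ε) :
    ∀ᶠ q : T × ℝ in 𝓝 (z, t), S.Reach q.1 q.2 ∧ |S.time q.1 q.2 - S.time z t| ≤ ε := by
  set s := S.time z t
  have hs : S.f (S.Y s z) = t := h.f_proj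
  have h1 : S.f (S.Y (s - ε) z) < t := hs ▸ S.mono z h.1 (by linarith)
  have h2 : t < S.f (S.Y (s + ε) z) := hs ▸ S.mono z h.1 (by linarith)
  have c1 : Continuous fun q : T × ℝ => S.f (S.Y (s - ε) q.1) :=
    S.f_cont.comp ((S.Y_cont_right _).comp continuous_fst)
  have c2 : Continuous fun q : T × ℝ => S.f (S.Y (s + ε) q.1) :=
    S.f_cont.comp ((S.Y_cont_right _).comp continuous_fst)
  filter_upwards [(isOpen_lt c1 continuous_snd).mem_nhds (x := (z, t)) h1,
    (isOpen_lt continuous_snd c2).mem_nhds (x := (z, t)) h2] with q hq1 hq2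
  have hq1 : S.f (S.Y (s - ε) q.1) < q.2 := hq1
  have hq2 : q.2 < S.f (S.Y (s + ε) q.1) := hq2
  have hqC : q.1 ∉ S.C := fun hc => by
    rw [S.Y_crit _ hc] at hq1 hq2
    linarith
  have hcont : Continuous fun s => S.f (S.Y s q.1) := S.f_cont.comp (S.Y_cont_left _)
  have hm := S.mono _ hqC
  obtain ⟨r, hr⟩ := mem_range_of_exists_le_of_exists_ge hcont ⟨_, hq1.le⟩ ⟨_, hq2.le⟩
  refine ⟨⟨hqC, r, hr⟩, ?_⟩
  rw [time_eq hqC hr]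
  simp only at hr
  have a1 : s - ε < r := hm.lt_iff_lt.1 (by simpa [hr] using hq1)
  have a2 : r < s + ε := hm.lt_iff_lt.1 (by simpa [hr] using hq2)
  rw [abs_le]; constructor <;> linarith

theorem Reach.continuousAt {z : T} {t : ℝ} (h : S.Reach z t) :
    ContinuousAt (fun q : T × ℝ => S.proj q.1 q.2) (z, t) := by
  have ht : ContinuousAt (fun q : T × ℝ => S.time q.1 q.2) (z, t) := by
    rw [Metric.continuousAt_iff']
    intro ε hε
    filter_upwards [h.eventually (half_pos hε)] with q hq
    rw [Real.dist_eq]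
    linarith [hq.2]
  exact S.Y_cont.continuousAt.comp (f := fun q : T × ℝ => (S.time q.1 q.2, q.1)) (x := (z, t))
    (ht.prodMk continuousAt_fst)

theorem isOpen_reach : IsOpen {q : T × ℝ | S.Reach q.1 q.2} := by
  rw [isOpen_iff_mem_nhds]
  rintro ⟨z, t⟩ h
  filter_upwards [Reach.eventually h one_pos] with q hq using hq.1

theorem continuousOn_proj (t : ℝ) : ContinuousOn (fun z => S.proj z t) {z | S.Reach z t} :=
  fun z hz => (ContinuousAt.comp (f := fun z : T => (z, t)) (x := z)
    (Reach.continuousAt hz) (by fun_prop)).continuousWithinAt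

/-- `M` is the unique critical point of `S` above level `a`, and `b = max f` its value. -/
structure Upper (S : MorseSys T) (a b : ℝ) (M : T) : Prop where
  fM : S.f M = b
  hM : M ∈ S.C
  lt : a < b
  le : ∀ x, S.f x ≤ b
  uniq : ∀ c ∈ S.C, a < S.f c → c = M

namespace Upper

variable {a b : ℝ} {M : T}

theorem eq_of_f (hu : Upper S a b M) {x : T} (hx : S.f x = b) : x = M := by
  by_contra hne
  have hxC : x ∉ S.C := fun h => hne (hu.uniq x h (hx ▸ hu.lt))
  have := S.mono x hxC zero_lt_one
  simp only [S.Y_zero, hx] at this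
  exact (hu.le _).not_gt this

theorem not_crit (hu : Upper S a b M) {x : T} (h1 : a < S.f x) (h2 : x ≠ M) : x ∉ S.C :=
  fun h => h2 (hu.uniq x h h1)

theorem f_lt (hu : Upper S a b M) {x : T} (h2 : x ≠ M) : S.f x < b :=
  (hu.le x).lt_of_ne fun h => h2 (hu.eq_of_f h)

theorem reach (hu : Upper S a b M) [CompactSpace T] {x : T} (hx : x ∉ S.C) (hxa : a ≤ S.f x)
    {t : ℝ} (h1 : a < t) (h2 : t < b) : S.Reach x t := by
  have hxM : x ≠ M := fun h => hx (h ▸ hu.hM)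
  rcases le_total (S.f x) t with h | h
  · apply S.reach_up hx h
    intro c hc hcx
    rw [hu.uniq c hc (by linarith), hu.fM]
    exact h2
  · apply S.reach_down hx h
    intro c hc hcx
    by_contra! hct
    have := hu.uniq c hc (by linarith)
    subst this
    rw [hu.fM] at hcx
    linarith [hu.le x]

theorem near (hu : Upper S a b M) [CompactSpace T] {U : Set T} (hU : U ∈ 𝓝 M) : ∃ t, a < t ∧ t < b ∧
    ∀ x, t ≤ S.f x → x ∈ U := by
  have hK : IsCompact (interior U)ᶜ := isOpen_interior.isClosed_compl.isCompact
  rcases (interior U)ᶜ.eq_empty_or_nonempty with he | hne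
  · refine ⟨(a + b) / 2, by linarith [hu.lt], by linarith [hu.lt], fun x _ => ?_⟩
    have : x ∈ interior U := by
      by_contra hx
      have : x ∈ (interior U)ᶜ := hx
      simp [he] at this
    exact interior_subset this
  obtain ⟨z, hz, hmax⟩ := hK.exists_isMaxOn hne S.f_cont.continuousOn
  have hzb : S.f z < b := hu.f_lt fun h => hz (h ▸ mem_interior_iff_mem_nhds.2 hU)
  obtain ⟨t, ht1, ht2⟩ := exists_between (max_lt hzb hu.lt)
  refine ⟨t, (le_max_right _ _).trans_lt ht1, ht2, fun x hx => ?_⟩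
  by_contra hxU
  have h1 := hmax (show x ∈ (interior U)ᶜ from fun h => hxU (interior_subset h))
  have h2 := (le_max_left (S.f z) a).trans_lt ht1
  have h3 : S.f x ≤ S.f z := h1
  linarith

theorem level (hu : Upper S a b M) [CompactSpace T] {t : ℝ} (h1 : a < t) (h2 : t < b) :
    IsConnected {x | S.f x = t} := by
  obtain ⟨B, hB, hBU, hBc⟩ := S.punct M {x | t < S.f x}
    ((isOpen_lt continuous_const S.f_cont).mem_nhds (by simpa [hu.fM] using h2))
  have hr : ∀ x ∈ B \ {M}, S.Reach x t := fun x hx => by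
    have : t < S.f x := hBU hx.1
    exact hu.reach (hu.not_crit (by linarith) hx.2) (by linarith) h1 h2
  have himg : (fun z => S.proj z t) '' (B \ {M}) = {x | S.f x = t} := by
    ext x
    constructor
    · rintro ⟨z, hz, rfl⟩
      exact (hr z hz).f_proj
    · intro hx
      have hx : S.f x = t := hx
      obtain ⟨t', ht1, ht2, ht⟩ := hu.near hB
      have hxM : x ≠ M := fun h => by rw [h, hu.fM] at hx; linarith
      have hrx : S.Reach x t' := hu.reach (hu.not_crit (by linarith) hxM) (by linarith) ht1 ht2
      refine ⟨S.proj x t', ⟨ht _ hrx.f_proj.ge, fun h => ?_⟩, ?_⟩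
      · exact hrx.not_crit (h ▸ hu.hM)
      · have := hrx.proj_back
        rwa [hx] at this
  rw [← himg]
  refine ⟨Nonempty.image _ ?_, hBc.image _ ((continuousOn_proj t).mono hr)⟩
  have := S.neBot M
  have : B \ {M} ∈ 𝓝[≠] M := sdiff_mem_nhdsWithin_compl hB _
  exact Filter.nonempty_of_mem this

end Upper

end MorseSys

namespace MorseSys

variable {T : Type*} [TopologicalSpace T] {S : MorseSys T}

theorem near_of_min [CompactSpace T] {a : ℝ} {U : Set T} (hU : IsOpen U)
    (h : ∀ x, S.f x ≤ a → x ∈ U) : ∃ t, a < t ∧ ∀ x, S.f x < t → x ∈ U := by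
  have hK : IsCompact Uᶜ := hU.isClosed_compl.isCompact
  rcases Uᶜ.eq_empty_or_nonempty with he | hne
  · refine ⟨a + 1, by linarith, fun x _ => ?_⟩
    rw [compl_empty_iff] at he
    simp [he]
  obtain ⟨z, hz, hmin⟩ := hK.exists_isMinOn hne S.f_cont.continuousOn
  refine ⟨S.f z, lt_of_not_ge fun hle => hz (h z hle), fun x hx => ?_⟩
  by_contra hxU
  exact (hmin (show x ∈ Uᶜ from hxU)).not_gt hx

theorem not_two_min [CompactSpace T] [T2Space T] {a b : ℝ} {M m p : T} (hu : Upper S a b M)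
    (hmp : m ≠ p) (hm : S.f m = a) (hp : S.f p = a) (hC : S.C ⊆ {m, p, M})
    (hlow : ∀ x, x ∉ S.C → a < S.f x) : False := by
  obtain ⟨U, V, hU, hV, hmU, hpV, hUV⟩ := t2_separation hmp
  have hle : ∀ x, S.f x ≤ a → x ∈ U ∪ V := fun x hx => by
    have hxC : x ∈ S.C := by
      by_contra h
      exact (hlow x h).not_ge hx
    rcases hC hxC with rfl | rfl | rfl
    · exact Or.inl hmU
    · exact Or.inr hpV
    · rw [hu.fM] at hx
      linarith [hu.lt]
  obtain ⟨t, hat, ht⟩ := near_of_min (hU.union hV) hle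
  obtain ⟨t', h1, h2⟩ := exists_between (lt_min hat hu.lt)
  have htb : t' < b := h2.trans_le (min_le_right _ _)
  have htt : t' < t := h2.trans_le (min_le_left _ _)
  have hcrit : ∀ x, a < S.f x → S.f x < b → x ∉ S.C := fun x h1 h2 =>
    hu.not_crit h1 fun h => by rw [h, hu.fM] at h2; exact lt_irrefl _ h2
  have hconn : IsPreconnected {x | a < S.f x ∧ S.f x < t'} := by
    have : {x | a < S.f x ∧ S.f x < t'} =
        (fun q : T × ℝ => S.proj q.1 q.2) '' ({x | S.f x = t'} ×ˢ Ioo a t') := by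
      ext x
      constructor
      · rintro ⟨hx1, hx2⟩
        have hr := hu.reach (hcrit x hx1 (by linarith)) hx1.le h1 htb
        exact ⟨(S.proj x t', S.f x), ⟨hr.f_proj, hx1, hx2⟩, hr.proj_back⟩
      · rintro ⟨⟨z, r⟩, ⟨hz, hr1, hr2⟩, rfl⟩
        have hz : S.f z = t' := hz
        have := hu.reach (hcrit z (by linarith) (by linarith)) (by linarith) hr1 (hr2.trans htb)
        simp only [mem_ofPred_eq, this.f_proj]
        exact ⟨hr1, hr2⟩
    rw [this]
    refine ((hu.level h1 htb).isPreconnected.prod isPreconnected_Ioo).image _ ?_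
    rintro ⟨z, r⟩ ⟨hz, hr1, hr2⟩
    have hz : S.f z = t' := hz
    exact (hu.reach (hcrit z (by linarith) (by linarith)) (by linarith) hr1
      (hr2.trans htb)).continuousAt.continuousWithinAt
  have hmeet : ∀ c, S.f c = a → ∀ W, IsOpen W → c ∈ W →
      ({x | a < S.f x ∧ S.f x < t'} ∩ W).Nonempty := by
    intro c hc W hW hcW
    have := S.neBot c
    have h4 : ∀ᶠ x in 𝓝[≠] c, x ∈ W ∧ S.f x < t' := nhdsWithin_le_nhds
      ((hW.eventually_mem hcW).and ((isOpen_lt S.f_cont continuous_const).eventually_mem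
        (by simpa [hc] using h1)))
    have h5 : ∀ᶠ x in 𝓝[≠] c, x ∉ ({m, p, M} \ {c} : Set T) :=
      nhdsWithin_le_nhds (((toFinite _).isClosed.isOpen_compl).mem_nhds (by simp))
    obtain ⟨x, ⟨⟨hxW, hxt⟩, hx5⟩, hxc⟩ :=
      ((h4.and h5).and self_mem_nhdsWithin).exists
    exact ⟨x, ⟨hlow x fun h => hx5 ⟨hC h, hxc⟩, hxt⟩, hxW⟩
  obtain ⟨x, -, hxU, hxV⟩ := hconn U V hU hV (fun x hx => ht x (by linarith [hx.2]))
    (hmeet m hm U hU hmU) (hmeet p hp V hV hpV)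
  exact disjoint_left.1 hUV hxU hxV

theorem exists_order [CompactSpace T] [T2Space T] (hC : S.C.encard = 3) :
    ∃ m p M, S.C = {m, p, M} ∧ S.f m < S.f p ∧ S.f p < S.f M := by
  have hne : S.C.Nonempty := by
    rw [nonempty_iff_ne_empty]
    rintro h
    simp [h] at hC
  obtain ⟨c, -⟩ := hne
  have : Nonempty T := ⟨c⟩
  have hfin : S.C.Finite := finite_of_encard_eq_coe (k := 3) hC
  obtain ⟨x, hx⟩ : ∃ x, x ∉ S.C := by
    have := S.neBot c
    by_contra! h
    have : S.C = univ := eq_univ_of_forall h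
    rw [this] at hfin
    have h2 : ({c}ᶜ : Set T) ∩ ({c}ᶜ : Set T)ᶜ ∈ 𝓝[≠] c :=
      inter_mem self_mem_nhdsWithin (nhdsWithin_le_nhds
        ((hfin.subset (subset_univ _)).isClosed.isOpen_compl.mem_nhds (by simp)))
    simp at h2
  obtain ⟨m, -, hm⟩ := isCompact_univ.exists_isMinOn univ_nonempty S.f_cont.continuousOn
  obtain ⟨M, -, hM⟩ := isCompact_univ.exists_isMaxOn univ_nonempty S.f_cont.continuousOn
  have hm : ∀ x, S.f m ≤ S.f x := fun x => hm (mem_univ x)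
  have hM : ∀ x, S.f x ≤ S.f M := fun x => hM (mem_univ x)
  have hlo : ∀ x, x ∉ S.C → S.f m < S.f x := fun x hx => by
    have := S.mono x hx (neg_one_lt_zero)
    simp only [S.Y_zero] at this
    exact (hm _).trans_lt this
  have hhi : ∀ x, x ∉ S.C → S.f x < S.f M := fun x hx => by
    have := S.mono x hx (zero_lt_one)
    simp only [S.Y_zero] at this
    exact this.trans_le (hM _)
  have hmC : m ∈ S.C := by
    by_contra h
    exact lt_irrefl _ (hlo m h)
  have hMC : M ∈ S.C := by
    by_contra h
    exact lt_irrefl _ (hhi M h)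
  have hmM : S.f m < S.f M := (hlo x hx).trans (hhi x hx)
  have hmM' : m ≠ M := fun h => by simp [h] at hmM
  obtain ⟨p, hpC, hpm, hpM⟩ : ∃ p ∈ S.C, p ≠ m ∧ p ≠ M := by
    by_contra! h
    have : S.C ⊆ {m, M} := fun c hc => by
      by_cases hcm : c = m
      · simp [hcm]
      · simp [h c hc hcm]
    have := encard_le_encard this
    rw [hC, encard_pair hmM'] at this
    exact absurd this (by decide)
  have hCeq : S.C = {m, p, M} := by
    symm
    apply (toFinite _).eq_of_subset_of_encard_le
    · rintro c (rfl | rfl | rfl) <;> assumption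
    · rw [hC, encard_insert_of_notMem (by simp [hpm.symm, hmM']), encard_pair hpM]
      norm_num
  refine ⟨m, p, M, hCeq, (hm p).lt_of_ne fun h => ?_, (hM p).lt_of_ne fun h => ?_⟩
  · refine not_two_min (S := S) (a := S.f m) (b := S.f M) (M := M) (m := m) (p := p)
      ⟨rfl, hMC, hmM, hM, ?_⟩ hpm.symm rfl h.symm hCeq.le hlo
    intro c hc hlt
    rw [hCeq] at hc
    rcases hc with rfl | rfl | rfl
    · exact absurd hlt (lt_irrefl _)
    · exact absurd h hlt.ne
    · rfl
  · refine not_two_min (S := S.neg) (a := -S.f M) (b := -S.f m) (M := m) (m := M) (p := p)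
      ⟨rfl, hmC, neg_lt_neg hmM, fun x => neg_le_neg (hm x), ?_⟩ hpM.symm rfl (by simp [neg, h]) ?_
      (fun x hx => neg_lt_neg (hhi x hx))
    · intro c hc hlt
      have hlt : S.f c < S.f M := neg_lt_neg_iff.1 hlt
      have hc : c ∈ S.C := hc
      rw [hCeq] at hc
      rcases hc with rfl | rfl | rfl
      · rfl
      · exact absurd h hlt.ne
      · exact absurd hlt (lt_irrefl _)
    · intro c hc
      have hc : c ∈ S.C := hc
      rw [hCeq] at hc
      rcases hc with rfl | rfl | rfl <;> simp

/-- A system with exactly three critical points, at levels `-1`, `0` and `1`. -/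
structure Normal (S : MorseSys T) (m p M : T) : Prop where
  C_eq : S.C = {m, p, M}
  fm : S.f m = -1
  fp : S.f p = 0
  fM : S.f M = 1

theorem exists_normalisation {a b c : ℝ} (hab : a < b) (hbc : b < c) :
    ∃ N : ℝ ≃ₜ ℝ, StrictMono N ∧ N a = -1 ∧ N b = 0 ∧ N c = 1 := by
  have h1 : 0 < b - a := by linarith
  have h2 : 0 < c - b := by linarith
  let g : ℝ → ℝ := fun x => if x ≤ b then (x - b) / (b - a) else (x - b) / (c - b)
  have hg : StrictMono g := by
    intro x y hxy
    simp only [g]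
    split_ifs with hx hy hy
    · gcongr
    · have : (x - b) / (b - a) ≤ 0 := div_nonpos_of_nonpos_of_nonneg (by linarith) h1.le
      have : 0 < (y - b) / (c - b) := div_pos (by linarith) h2
      linarith
    · linarith
    · gcongr
  have hs : Function.Surjective g := by
    intro y
    rcases le_or_gt y 0 with hy | hy
    · refine ⟨b + y * (b - a), ?_⟩
      have : b + y * (b - a) ≤ b := by nlinarith
      simp only [g, this, if_true]
      field_simp
      ring
    · refine ⟨b + y * (c - b), ?_⟩
      have : ¬ b + y * (c - b) ≤ b := by nlinarith
      simp only [g, this, if_false]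
      field_simp
      ring
  refine ⟨(hg.orderIsoOfSurjective g hs).toHomeomorph, hg, ?_, ?_, ?_⟩
  · show g a = -1
    simp only [g, hab.le, if_true]
    field_simp
    ring
  · show g b = 0
    simp [g]
  · show g c = 1
    simp only [g, hbc.not_ge, if_false]
    field_simp

theorem exists_normal [CompactSpace T] [T2Space T] (hC : S.C.encard = 3) :
    ∃ (N : ℝ ≃ₜ ℝ) (hN : StrictMono N) (m p M : T), Normal (S.comp N hN) m p M := by
  obtain ⟨m, p, M, h, h1, h2⟩ := exists_order hC
  obtain ⟨N, hN, ha, hb, hc⟩ := exists_normalisation h1 h2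
  exact ⟨N, hN, m, p, M, h, ha, hb, hc⟩

namespace Normal

variable {m p M : T}

theorem neg (h : Normal S m p M) : Normal S.neg M p m where
  C_eq := by
    show S.C = _
    rw [h.C_eq]
    ext x
    simp only [mem_insert_iff, mem_singleton_iff]
    tauto
  fm := by simp [MorseSys.neg, h.fM]
  fp := by simp [MorseSys.neg, h.fp]
  fM := by simp [MorseSys.neg, h.fm]

theorem upper [CompactSpace T] (h : Normal S m p M) : Upper S 0 1 M where
  fM := h.fM
  hM := by simp [h.C_eq]
  lt := zero_lt_one
  le x := by
    obtain ⟨z, -, hz⟩ := isCompact_univ.exists_isMaxOn ⟨x, mem_univ x⟩ S.f_cont.continuousOn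
    have hz : ∀ x, S.f x ≤ S.f z := fun x => hz (mem_univ x)
    have hzC : z ∈ S.C := by
      by_contra hzC
      have := S.mono z hzC (zero_lt_one)
      simp only [S.Y_zero] at this
      exact (hz _).not_gt this
    rw [h.C_eq] at hzC
    have hx := hz x
    rcases hzC with rfl | rfl | rfl
    · rw [h.fm] at hx; linarith
    · rw [h.fp] at hx; linarith
    · rw [h.fM] at hx; linarith
  uniq c hc hlt := by
    rw [h.C_eq] at hc
    rcases hc with rfl | rfl | rfl
    · rw [h.fm] at hlt; linarith
    · rw [h.fp] at hlt; linarith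
    · rfl

theorem eq_p (h : Normal S m p M) {x : T} (hx : x ∈ S.C) (h0 : S.f x = 0) : x = p := by
  rw [h.C_eq] at hx
  rcases hx with rfl | rfl | rfl
  · rw [h.fm] at h0; linarith
  · rfl
  · rw [h.fM] at h0; linarith

theorem p_mem (h : Normal S m p M) : p ∈ S.C := by simp [h.C_eq]

end Normal

end MorseSys

/-- A function on `S` is continuous if its pullback to a compact set mapping onto `S` is. -/
theorem continuousOn_of_comp_compact {A X W : Type*} [TopologicalSpace A] [TopologicalSpace X]
    [TopologicalSpace W] [T2Space X] {π : A → X} {K : Set A} {S : Set X} {g : X → W}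
    (hK : IsCompact K) (hπ : ContinuousOn π K) (hS : S ⊆ π '' K)
    (hg : ContinuousOn (fun a => g (π a)) K) : ContinuousOn g S := by
  intro x hx
  rw [ContinuousWithinAt, tendsto_iff_ultrafilter]
  intro U hU
  have hUS : S ∈ U := hU self_mem_nhdsWithin
  have : ∀ y, ∃ a, y ∈ S → a ∈ K ∧ π a = y := fun y => by
    by_cases hy : y ∈ S
    · obtain ⟨a, ha⟩ := hS hy
      exact ⟨a, fun _ => ha⟩
    · obtain ⟨a, ha⟩ := hS hx
      exact ⟨a, fun h => absurd h hy⟩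
  choose σ hσ using this
  have hUK : ∀ᶠ y in U, σ y ∈ K := by filter_upwards [hUS] with y hy using (hσ y hy).1
  obtain ⟨a, haK, ha⟩ := hK.ultrafilter_le_nhds (U.map σ) (by simpa using mem_map.2 hUK)
  have ha' : Tendsto σ U (𝓝[K] a) := tendsto_nhdsWithin_iff.2 ⟨ha, hUK⟩
  have h1 : Tendsto (fun y => π (σ y)) U (𝓝 (π a)) := (hπ a haK).tendsto.comp ha'
  have h2 : Tendsto (fun y => g (π (σ y))) U (𝓝 (g (π a))) := (hg a haK).tendsto.comp ha'
  have h3 : (fun y => π (σ y)) =ᶠ[U] id := by filter_upwards [hUS] with y hy using (hσ y hy).2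
  have h4 : π a = x :=
    tendsto_nhds_unique h1 (Tendsto.congr' h3.symm (hU.trans nhdsWithin_le_nhds))
  rw [h4] at h2
  exact h2.congr' (h3.mono fun y hy => congrArg g hy)

namespace MorseSys

variable {T : Type*} [TopologicalSpace T] {S : MorseSys T}

/-- A connected regular level set is a single periodic orbit of `Z`. -/
theorem exists_circle [CompactSpace T] [T2Space T] {t : ℝ} (hconn : IsConnected {x | S.f x = t})
    (hreg : ∀ x, S.f x = t → x ∉ S.C) :
    ∃ (P : ℝ) (e : ℝ → T), 0 < P ∧ Continuous e ∧ (∀ x, S.f (e x) = t) ∧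
      (∀ z, S.f z = t → ∃ x, e x = z) ∧ (∀ x y, e x = e y ↔ ∃ k : ℤ, y = x + k) ∧
      ∀ x s, e (x + s / P) = S.Z s (e x) := by
  obtain ⟨x₀, hx₀⟩ := hconn.1
  have hx₀ : S.f x₀ = t := hx₀
  have horb : ∀ z, S.f z = t → ∃ s, S.Z s x₀ = z := by
    intro z hz
    refine hconn.isPreconnected.induction₂ (fun x y => ∃ s, S.Z s x = y) ?_ ?_ ?_ hx₀ hz
    · intro x hx
      have hb := S.box x (hreg x hx) 1 one_pos
      have : ∀ᶠ y in 𝓝 x, S.f x = S.f y → ∃ s, |s| < 1 ∧ S.Z s x = y :=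
        (Continuous.tendsto (f := fun y : T => (x, y)) (by fun_prop) x).eventually hb
      filter_upwards [nhdsWithin_le_nhds this, self_mem_nhdsWithin] with y hy hyt
      obtain ⟨s, -, hs⟩ := hy (by rw [show S.f x = t from hx, show S.f y = t from hyt])
      exact ⟨s, hs⟩
    · rintro x y z - - - ⟨s, rfl⟩ ⟨s', rfl⟩
      exact ⟨s' + s, S.Z_add _ _ _⟩
    · rintro x y - - ⟨s, rfl⟩
      exact ⟨-s, S.Z_neg_Z _ _⟩
  let G : AddSubgroup ℝ :=
    { carrier := {s | S.Z s x₀ = x₀}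
      zero_mem' := S.Z_zero _
      add_mem' := fun {a b} ha hb => by
        have ha : S.Z a x₀ = x₀ := ha
        have hb : S.Z b x₀ = x₀ := hb
        show S.Z (a + b) x₀ = x₀
        rw [S.Z_add, hb, ha]
      neg_mem' := fun {a} ha => by
        have ha : S.Z a x₀ = x₀ := ha
        show S.Z (-a) x₀ = x₀
        conv_lhs => rw [← ha]
        exact S.Z_neg_Z _ _ }
  have hG : ∀ s, s ∈ G ↔ S.Z s x₀ = x₀ := fun s => Iff.rfl
  obtain ⟨s₁, hs₁, hs₁'⟩ : ∃ s ∈ G, 0 < s := by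
    obtain ⟨U, hU⟩ := Ultrafilter.exists_le (atTop : Filter ℝ)
    obtain ⟨z, -, hz⟩ := isCompact_univ.ultrafilter_le_nhds (U.map fun s => S.Z s x₀) (by simp)
    have hz : Tendsto (fun s => S.Z s x₀) U (𝓝 z) := hz
    have hfz : S.f z = t := by
      have h1 := (S.f_cont.tendsto z).comp hz
      have h2 : (S.f ∘ fun s => S.Z s x₀) = fun _ => t := by
        ext s
        simp [S.f_Z, hx₀]
      rw [h2] at h1
      exact tendsto_nhds_unique h1 tendsto_const_nhds
    have hb := S.box z (hreg z hfz) 1 one_pos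
    rw [nhds_prod_eq] at hb
    have := (hz.prodMap hz).eventually hb
    obtain ⟨s, hs⟩ := (this.curry).exists
    obtain ⟨s', hs', hgt⟩ := (hs.and (hU (eventually_gt_atTop (s + 1)))).exists
    obtain ⟨r, hr, hr'⟩ := hs' (by simp [S.f_Z])
    refine ⟨s' - s - r, ?_, ?_⟩
    · rw [hG]
      have h3 : S.Z (-(r + s)) (S.Z s' x₀) = x₀ := by
        have : S.Z s' x₀ = S.Z (r + s) x₀ := by rw [S.Z_add]; exact hr'.symm
        rw [this, S.Z_neg_Z]
      rw [← S.Z_add] at h3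
      convert h3 using 2
      ring
    · have := (abs_lt.1 hr).2
      have hgt : s + 1 < s' := hgt
      linarith
  obtain ⟨P, hP, hGP⟩ : ∃ P, 0 < P ∧ G = AddSubgroup.zmultiples P := by
    rcases AddSubgroup.dense_or_cyclic G with h | ⟨a, ha⟩
    · exfalso
      obtain ⟨ε, hε, hn⟩ := S.noper x₀ (hreg x₀ hx₀)
      obtain ⟨s, hs, hs2⟩ := h.exists_mem_open isOpen_Ioo (nonempty_Ioo.2 hε)
      exact hn.self_of_nhds s (abs_pos.2 hs2.1.ne') (by rw [abs_of_pos hs2.1]; exact hs2.2)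
        ((hG s).1 hs)
    · rw [← AddSubgroup.zmultiples_eq_closure] at ha
      rcases lt_trichotomy a 0 with h | h | h
      · exact ⟨-a, by linarith, by rw [ha, AddSubgroup.zmultiples_neg]⟩
      · rw [h] at ha
        rw [ha] at hs₁
        simp at hs₁
        linarith
      · exact ⟨a, h, ha⟩
  have hfix : ∀ s, S.Z s x₀ = x₀ ↔ ∃ k : ℤ, k * P = s := fun s => by
    rw [← hG, hGP, AddSubgroup.mem_zmultiples_iff]
    simp
  refine ⟨P, fun x => S.Z (x * P) x₀, hP, ?_, ?_, ?_, ?_, ?_⟩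
  · exact (S.Z_cont_left x₀).comp (by fun_prop)
  · intro x
    rw [S.f_Z, hx₀]
  · intro z hz
    obtain ⟨s, hs⟩ := horb z hz
    exact ⟨s / P, by simp only [div_mul_cancel₀ _ hP.ne', hs]⟩
  · intro x y
    have h1 : S.Z (x * P) x₀ = S.Z (y * P) x₀ ↔ S.Z ((y - x) * P) x₀ = x₀ := by
      have : S.Z ((y - x) * P) x₀ = S.Z (-(x * P)) (S.Z (y * P) x₀) := by
        rw [← S.Z_add]; congr 1; ring
      rw [this]
      constructor
      · intro h
        rw [← h, S.Z_neg_Z]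
      · intro h
        have := congrArg (S.Z (x * P)) h
        rw [← S.Z_add] at this
        simpa [S.Z_zero] using this.symm
    simp only [h1, hfix]
    refine exists_congr fun k => ?_
    rw [mul_left_inj' hP.ne']
    constructor <;> intro h <;> linarith
  · intro x s
    simp only
    rw [← S.Z_add]
    congr 1
    field_simp
    ring

/-- Curves in the image of a circle parametrisation lift. -/
theorem exists_lift_circle {T : Type*} [TopologicalSpace T] [T2Space T] {e : ℝ → T}
    (he : Continuous e) (hinj : ∀ x y, e x = e y ↔ ∃ k : ℤ, y = x + k) {c : ℝ → T}
    (hc : Continuous c) (hr : ∀ r, ∃ x, e x = c r) :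
    ∃ κ : ℝ → ℝ, Continuous κ ∧ ∀ r, e (κ r) = c r := by
  let θ : T → Circle := fun z => Circle.exp (2 * Real.pi * (Function.invFun e z))
  have hθ : ∀ x, θ (e x) = Circle.exp (2 * Real.pi * x) := by
    intro x
    obtain ⟨k, hk⟩ := (hinj _ _).1 (Function.invFun_eq ⟨x, rfl⟩ : e (Function.invFun e (e x)) = e x)
    simp only [θ]
    rw [Circle.exp_eq_exp]
    refine ⟨-k, ?_⟩
    push_cast
    linear_combination (-2 * Real.pi) * hk
  have hcont : ContinuousOn θ (range e) := by
    refine continuousOn_of_comp_compact (isCompact_Icc (a := (0 : ℝ)) (b := 1))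
      he.continuousOn ?_ ?_
    · rintro _ ⟨x, rfl⟩
      refine ⟨Int.fract x, ⟨Int.fract_nonneg _, (Int.fract_lt_one _).le⟩, ?_⟩
      rw [hinj]
      exact ⟨⌊x⌋, by rw [Int.fract_add_floor]⟩
    · simp only [hθ]
      fun_prop
  have hg : Continuous fun r => θ (c r) := hcont.comp_continuous hc hr
  obtain ⟨q, hq, hq2⟩ := exists_circleExp_lift hg
  refine ⟨fun r => q r / (2 * Real.pi), by fun_prop, fun r => ?_⟩
  obtain ⟨x, hx⟩ := hr r
  have h1 := hq2 r
  rw [← hx, hθ, Circle.exp_eq_exp] at h1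
  obtain ⟨k, hk⟩ := h1
  rw [← hx, hinj]
  refine ⟨-k, ?_⟩
  simp only [hk]
  push_cast
  field_simp
  ring

end MorseSys

/-- A parametrisation `Φ` of the closed half `{0 ≤ f'}` of a space by a collapsed annulus. -/
structure HalfDisc {T : Type*} [TopologicalSpace T] (f' : T → ℝ) (Z : ℝ → T → T) (p : T)
    (Φ : ℝ → ℝ → T) : Prop where
  cont : ContinuousOn (fun q : ℝ × ℝ => Φ q.1 q.2) (univ ×ˢ Icc 0 1)
  per : ∀ x τ, Φ (x + 1) τ = Φ x τ
  top : ∀ x, Φ x 1 = Φ 0 1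
  val : ∀ x, ∀ τ ∈ Icc (0 : ℝ) 1, f' (Φ x τ) = τ
  inj : ∀ x y, ∀ τ ∈ Ico (0 : ℝ) 1, Φ x τ ≠ p → Φ x τ = Φ y τ → ∃ k : ℤ, y = x + k
  surj : ∀ z, z ≠ p → 0 ≤ f' z → ∃ x, ∃ τ ∈ Icc (0 : ℝ) 1, Φ x τ = z
  arcs : ∀ y, y ≠ p → f' y = 0 → (∀ s, Z s y = y → s = 0) → ∃ κ : ℝ → ℝ, StrictMono κ ∧
    Continuous κ ∧ (∀ r, Φ (κ r) 0 = Z r y) ∧ ∃ a b, Tendsto κ atBot (𝓝 a) ∧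
    Tendsto κ atTop (𝓝 b) ∧ Φ a 0 = p ∧ Φ b 0 = p ∧ b ≤ a + 1

namespace MorseSys

variable {T : Type*} [TopologicalSpace T] {S : MorseSys T} {m p M : T}

/-- Moving along `Z` from a non-periodic point moves its `Y`-projections in the same direction. -/
theorem proj_Z_pos [CompactSpace T] [T2Space T] {y : T}
    (hper : ∀ s, S.Z s y = y → s = 0) {t₀ t₁ : ℝ} (h01 : t₀ ≤ t₁) (hy : S.f y = t₀)
    (hr : ∀ s, ∀ t ∈ Icc t₀ t₁, S.Reach (S.Z s y) t) {δ : ℝ} (hδ : 0 < δ) :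
    ∀ᶠ r in 𝓝[>] (0 : ℝ), ∃ s, 0 < s ∧ s < δ ∧ S.proj (S.Z r y) t₁ = S.Z s (S.proj y t₁) := by
  have hr0 : ∀ t ∈ Icc t₀ t₁, S.Reach y t := fun t ht => by
    have := hr 0 t ht
    rwa [S.Z_zero] at this
  have hK : IsCompact (Icc t₀ t₁) := isCompact_Icc
  -- uniform absence of short periods
  have h1 : ∀ᶠ ε in 𝓝 (0 : ℝ), ∀ t ∈ Icc t₀ t₁, ∀ s, 0 < |s| → |s| < ε →
      S.Z s (S.proj y t) ≠ S.proj y t := by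
    refine hK.eventually_forall_of_forall_eventually (fun t ht => ?_)
    obtain ⟨ε, hε, hev⟩ := S.noper _ (hr0 t ht).not_crit
    have hc : ContinuousAt (fun q : ℝ × ℝ => S.proj y q.2) (0, t) :=
      ContinuousAt.comp (f := fun q : ℝ × ℝ => (y, q.2)) (g := fun q : T × ℝ => S.proj q.1 q.2)
        (x := (0, t)) (hr0 t ht).continuousAt (by fun_prop)
    have hlt : ∀ᶠ q : ℝ × ℝ in 𝓝 (0, t), q.1 < ε :=
      (isOpen_lt continuous_fst continuous_const).eventually_mem hε
    filter_upwards [hc.eventually hev, hlt] with q hq hq2 s hs1 hs2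
    exact hq s hs1 (hs2.trans hq2)
  obtain ⟨ε₀, hε₀, hε₀p⟩ :=
    ((h1.filter_mono (nhdsWithin_le_nhds (s := Ioi (0 : ℝ)))).and self_mem_nhdsWithin).exists
  have hε₀p : 0 < ε₀ := hε₀p
  set ε := min (ε₀ / 3) (δ / 2)
  have hε : 0 < ε := by positivity
  have hεε : 3 * ε ≤ ε₀ := by have := min_le_left (ε₀ / 3) (δ / 2); linarith
  have hεδ : 2 * ε ≤ δ := by have := min_le_right (ε₀ / 3) (δ / 2); linarith
  have h2 : ∀ᶠ r in 𝓝 (0 : ℝ), ∀ t ∈ Icc t₀ t₁, ∃ s, |s| < ε ∧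
      S.Z s (S.proj y t) = S.proj (S.Z r y) t := by
    refine hK.eventually_forall_of_forall_eventually (fun t ht => ?_)
    have hb := S.box _ (hr0 t ht).not_crit ε hε
    have hc : ContinuousAt (fun q : ℝ × ℝ => S.proj y q.2) (0, t) :=
      ContinuousAt.comp (f := fun q : ℝ × ℝ => (y, q.2)) (g := fun q : T × ℝ => S.proj q.1 q.2)
        (x := (0, t)) (hr0 t ht).continuousAt (by fun_prop)
    have hZ : Continuous fun q : ℝ × ℝ => S.Z q.1 y := (S.Z_cont_left y).comp continuous_fst
    have hc2 : ContinuousAt (fun q : ℝ × ℝ => S.proj (S.Z q.1 y) q.2) (0, t) :=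
      ContinuousAt.comp (f := fun q : ℝ × ℝ => (S.Z q.1 y, q.2))
        (g := fun q : T × ℝ => S.proj q.1 q.2) (x := (0, t)) (hr 0 t ht).continuousAt (by fun_prop)
    have hc3 := hc.prodMk hc2
    simp only [ContinuousAt, S.Z_zero] at hc3
    have hopen : ∀ᶠ q : ℝ × ℝ in 𝓝 (0, t), S.Reach y q.2 ∧ S.Reach (S.Z q.1 y) q.2 := by
      refine ((isOpen_reach.preimage (f := fun q : ℝ × ℝ => (y, q.2))
        (by fun_prop)).eventually_mem (hr0 t ht)).and ((isOpen_reach.preimage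
          (f := fun q : ℝ × ℝ => (S.Z q.1 y, q.2)) (by fun_prop)).eventually_mem (hr 0 t ht))
    filter_upwards [hc3.eventually hb, hopen] with q hq ho
    exact hq (by rw [ho.1.f_proj, ho.2.f_proj])
  filter_upwards [nhdsWithin_le_nhds h2, Ioo_mem_nhdsGT hε] with r hr' ⟨hrp, hre⟩
  let A : Set ℝ := {t | ∃ s ∈ Icc 0 ε, S.Z s (S.proj y t) = S.proj (S.Z r y) t}
  let B : Set ℝ := {t | ∃ s ∈ Icc (-ε) 0, S.Z s (S.proj y t) = S.proj (S.Z r y) t}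
  have hclosed : ∀ l u : ℝ, IsClosed (Icc t₀ t₁ ∩
      {t | ∃ s ∈ Icc l u, S.Z s (S.proj y t) = S.proj (S.Z r y) t}) := by
    intro l u
    have c1 : ContinuousOn (fun t => S.proj y t) (Icc t₀ t₁) := fun t ht =>
      (ContinuousAt.comp (f := fun t : ℝ => (y, t)) (g := fun q : T × ℝ => S.proj q.1 q.2)
        (x := t) (hr0 t ht).continuousAt (by fun_prop)).continuousWithinAt
    have c2 : ContinuousOn (fun t => S.proj (S.Z r y) t) (Icc t₀ t₁) := fun t ht =>
      (ContinuousAt.comp (f := fun t : ℝ => (S.Z r y, t)) (g := fun q : T × ℝ => S.proj q.1 q.2)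
        (x := t) (hr r t ht).continuousAt (by fun_prop)).continuousWithinAt
    have hE : IsClosed {q : T × T | ∃ s ∈ Icc l u, S.Z s q.1 = q.2} := by
      have : {q : T × T | ∃ s ∈ Icc l u, S.Z s q.1 = q.2} =
          (fun v : ℝ × T => (v.2, S.Z v.1 v.2)) '' (Icc l u ×ˢ univ) := by
        ext q
        constructor
        · rintro ⟨s, hs, hq⟩
          exact ⟨(s, q.1), ⟨hs, mem_univ _⟩, Prod.ext rfl hq⟩
        · rintro ⟨v, hv, rfl⟩
          exact ⟨v.1, hv.1, rfl⟩
      rw [this]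
      exact ((isCompact_Icc.prod isCompact_univ).image
        (continuous_snd.prodMk S.Z_cont)).isClosed
    exact (c1.prodMk c2).preimage_isClosed_of_isClosed isClosed_Icc hE
  have hdisj : ∀ t ∈ Icc t₀ t₁, ∀ s ∈ Icc 0 ε, ∀ s' ∈ Icc (-ε) 0,
      S.Z s (S.proj y t) = S.proj (S.Z r y) t → S.Z s' (S.proj y t) = S.proj (S.Z r y) t →
      False := by
    intro t ht s hs s' hs' e1 e2
    have h3 : S.Z (-s' + s) (S.proj y t) = S.proj y t := by
      rw [S.Z_add, e1, ← e2, S.Z_neg_Z]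
    have h4 : -s' + s = 0 := by
      by_contra hne
      refine hε₀ t ht _ (abs_pos.2 hne) ?_ h3
      rw [abs_of_nonneg (by linarith [hs.1, hs'.2])]
      linarith [hs.2, hs'.1]
    have h5 : s = 0 := by linarith [hs.1, hs'.2]
    rw [h5, S.Z_zero] at e1
    have h6 := (hr0 t ht).proj_back
    have h7 := (hr r t ht).proj_back
    rw [← e1, S.f_Z, h6] at h7
    exact hrp.ne' (hper r h7.symm)
  obtain ⟨s, hs, hsZ⟩ := hr' t₁ (right_mem_Icc.2 h01)
  have hsle := abs_lt.1 hs
  refine ⟨s, ?_, by linarith, hsZ.symm⟩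
  by_contra! hs0
  have hyp : S.proj y t₀ = y := by rw [← hy]; exact proj_self (hr0 t₀ (left_mem_Icc.2 h01)).1
  have hyr : S.proj (S.Z r y) t₀ = S.Z r y := by
    have : t₀ = S.f (S.Z r y) := by rw [S.f_Z, hy]
    rw [this]
    exact proj_self (hr r t₀ (left_mem_Icc.2 h01)).1
  have := isPreconnected_closed_iff.1 (isPreconnected_Icc (a := t₀) (b := t₁)) _ _
    (hclosed 0 ε) (hclosed (-ε) 0) (fun t ht => by
      obtain ⟨s, hs, hsZ⟩ := hr' t ht
      have hsle := abs_lt.1 hs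
      rcases le_total 0 s with h | h
      · exact Or.inl ⟨ht, s, ⟨h, by linarith⟩, hsZ⟩
      · exact Or.inr ⟨ht, s, ⟨by linarith, h⟩, hsZ⟩)
    ⟨t₀, left_mem_Icc.2 h01, left_mem_Icc.2 h01, r, ⟨hrp.le, hre.le⟩, by rw [hyp, hyr]⟩
    ⟨t₁, right_mem_Icc.2 h01, right_mem_Icc.2 h01, s, ⟨by linarith, hs0⟩, hsZ⟩
  obtain ⟨t, ht, ⟨-, s, hs, e1⟩, ⟨-, s', hs', e2⟩⟩ := this
  exact hdisj t ht s hs s' hs' e1 e2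

end MorseSys

namespace MorseSys

variable {T : Type*} [TopologicalSpace T] {S : MorseSys T} {m p M : T}

theorem eq_of_Z_fixed {w : T} (hw : w ∉ S.C) (h : ∀ s, S.Z s w = w) : False := by
  obtain ⟨ε, hε, hn⟩ := S.noper w hw
  exact hn.self_of_nhds (ε / 2) (by positivity) (by rw [abs_of_pos (by linarith)]; linarith) (h _)

theorem Z_lim_fixed [T2Space T] {y w : T} {l : Filter ℝ} [l.NeBot]
    (hl : ∀ s : ℝ, Tendsto (fun r => s + r) l l)
    (h : Tendsto (fun r => S.Z r y) l (𝓝 w)) (s : ℝ) : S.Z s w = w := by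
  have h1 := ((S.Z_cont_right s).tendsto w).comp h
  have h2 := h.comp (hl s)
  have h3 : ((fun x => S.Z s x) ∘ fun r => S.Z r y) = (fun r => S.Z r y) ∘ fun r => s + r := by
    ext r
    simp [S.Z_add]
  rw [h3] at h1
  exact tendsto_nhds_unique h1 h2

theorem exists_halfDisc [CompactSpace T] [T2Space T] (h : Normal S m p M) :
    ∃ Φ, HalfDisc S.f S.Z p Φ := by
  classical
  have hu := h.upper
  have hhalf : ∀ x, S.f x = 1 / 2 → x ∉ S.C := fun x hx =>
    hu.not_crit (by rw [hx]; norm_num) fun hM => by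
      rw [hM, hu.fM] at hx; norm_num at hx
  obtain ⟨P, e, hP, he, hef, hes, hei, heZ⟩ :=
    exists_circle (hu.level (t := 1 / 2) (by norm_num) (by norm_num)) hhalf
  have hreach : ∀ z, z ∉ S.C → 0 ≤ S.f z → ∀ t, 0 < t → t < 1 → S.Reach z t :=
    fun z hz h0 t h1 h2 => hu.reach hz h0 h1 h2
  have heC : ∀ x, e x ∉ S.C := fun x => hhalf _ (hef x)
  have hCcl : IsClosed S.C := by
    rw [h.C_eq]
    exact (toFinite _).isClosed
  let Φ : ℝ → ℝ → T := fun x τ =>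
    if S.Reach (e x) τ then S.proj (e x) τ else if 1 / 2 ≤ τ then M else p
  have hpos : ∀ x τ, S.Reach (e x) τ → Φ x τ = S.proj (e x) τ := fun x τ hr => if_pos hr
  have hmid : ∀ x, ∀ τ, 0 < τ → τ < 1 → S.Reach (e x) τ := fun x τ h1 h2 =>
    hreach _ (heC x) (by rw [hef]; norm_num) _ h1 h2
  have hnot1 : ∀ x, ¬ S.Reach (e x) 1 := fun x hr =>
    hr.not_crit (hu.eq_of_f hr.f_proj ▸ hu.hM)
  have hΦ1 : ∀ x, Φ x 1 = M := fun x => by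
    simp only [Φ, if_neg (hnot1 x)]
    norm_num
  have hΦ0 : ∀ x, ¬ S.Reach (e x) 0 → Φ x 0 = p := fun x hr => by
    simp only [Φ, if_neg hr]
    norm_num
  have hval : ∀ x, ∀ τ ∈ Icc (0 : ℝ) 1, S.f (Φ x τ) = τ := by
    intro x τ hτ
    by_cases hr : S.Reach (e x) τ
    · rw [hpos x τ hr, hr.f_proj]
    · rcases hτ.1.eq_or_lt with h0 | h0
      · rw [← h0] at hr ⊢
        rw [hΦ0 x hr, h.fp]
      · rcases hτ.2.eq_or_lt with h1 | h1
        · rw [h1, hΦ1, h.fM]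
        · exact absurd (hmid x τ h0 h1) hr
  have hcrit : ∀ x, ∀ τ ∈ Icc (0 : ℝ) 1, Φ x τ ∈ S.C ∨ S.Reach (e x) τ := by
    intro x τ hτ
    by_cases hr : S.Reach (e x) τ
    · exact Or.inr hr
    · left
      simp only [Φ, if_neg hr]
      split_ifs
      · exact hu.hM
      · exact h.p_mem
  have hback : ∀ x, ∀ τ ∈ Icc (0 : ℝ) 1, Φ x τ ∉ S.C → S.proj (Φ x τ) (1 / 2) = e x := by
    intro x τ hτ hC
    have hr := (hcrit x τ hτ).resolve_left hC
    rw [hpos x τ hr, ← hef x, hr.proj_back]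
  have hcont : ContinuousOn (fun q : ℝ × ℝ => Φ q.1 q.2) (univ ×ˢ Icc 0 1) := by
    rintro ⟨x, τ⟩ ⟨-, hτ⟩
    have hτ : τ ∈ Icc (0 : ℝ) 1 := hτ
    by_cases hr : S.Reach (e x) τ
    · have hc : ContinuousAt (fun q : ℝ × ℝ => S.proj (e q.1) q.2) (x, τ) :=
        ContinuousAt.comp (f := fun q : ℝ × ℝ => (e q.1, q.2))
          (g := fun q : T × ℝ => S.proj q.1 q.2) (x := (x, τ)) hr.continuousAt (by fun_prop)
      have ho : ∀ᶠ q : ℝ × ℝ in 𝓝 (x, τ), S.Reach (e q.1) q.2 :=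
        (isOpen_reach.preimage (f := fun q : ℝ × ℝ => (e q.1, q.2)) (by fun_prop)).eventually_mem hr
      exact (hc.congr (ho.mono fun q hq => (hpos _ _ hq).symm)).continuousWithinAt
    · rw [ContinuousWithinAt, tendsto_iff_ultrafilter]
      intro U hU
      obtain ⟨z, -, hz⟩ := isCompact_univ.ultrafilter_le_nhds
        (U.map fun q : ℝ × ℝ => Φ q.1 q.2) (by simp)
      have hz : Tendsto (fun q : ℝ × ℝ => Φ q.1 q.2) U (𝓝 z) := hz
      have hUx : Tendsto (fun q : ℝ × ℝ => q.1) U (𝓝 x) :=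
        (continuous_fst.tendsto (x, τ)).mono_left (hU.trans nhdsWithin_le_nhds)
      have hUτ : Tendsto (fun q : ℝ × ℝ => q.2) U (𝓝 τ) :=
        (continuous_snd.tendsto (x, τ)).mono_left (hU.trans nhdsWithin_le_nhds)
      have hUI : ∀ᶠ q : ℝ × ℝ in U, q.2 ∈ Icc (0 : ℝ) 1 := by
        have : ∀ᶠ q : ℝ × ℝ in U, q ∈ univ ×ˢ Icc (0 : ℝ) 1 := hU self_mem_nhdsWithin
        exact this.mono fun q hq => hq.2
      have hfz : S.f z = τ := by
        refine tendsto_nhds_unique ((S.f_cont.tendsto z).comp hz) (hUτ.congr' ?_)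
        exact hUI.mono fun q hq => (hval _ _ hq).symm
      suffices z = Φ x τ by rwa [← this]
      by_cases hzC : z ∈ S.C
      · rcases hτ.1.eq_or_lt with h0 | h0
        · rw [← h0] at hr hfz ⊢
          rw [hΦ0 x hr, h.eq_p hzC hfz]
        · rcases hτ.2.eq_or_lt with h1 | h1
          · rw [h1] at hfz ⊢
            rw [hΦ1, hu.eq_of_f hfz]
          · exact absurd (hmid x τ h0 h1) hr
      · exfalso
        have hrz := hreach z hzC (by rw [hfz]; exact hτ.1) (1 / 2) (by norm_num) (by norm_num)
        have h1 : Tendsto (fun q : ℝ × ℝ => S.proj (Φ q.1 q.2) (1 / 2)) U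
            (𝓝 (S.proj z (1 / 2))) :=
          (ContinuousAt.comp (f := fun z : T => (z, (1 / 2 : ℝ)))
            (g := fun q : T × ℝ => S.proj q.1 q.2) (x := z) hrz.continuousAt
            (by fun_prop)).tendsto.comp hz
        have h2 : Tendsto (fun q : ℝ × ℝ => S.proj (Φ q.1 q.2) (1 / 2)) U (𝓝 (e x)) := by
          refine ((he.tendsto x).comp hUx).congr' ?_
          filter_upwards [hUI, hz.eventually (hCcl.isOpen_compl.eventually_mem hzC)] with q h1 h2
          exact (hback _ _ h1 h2).symm
        have h3 := tendsto_nhds_unique h1 h2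
        have h4 := hrz.back
        rw [h3, hfz] at h4
        exact hr h4
  refine ⟨Φ, hcont, ?_, ?_, hval, ?_, ?_, ?_⟩
  · intro x τ
    have : e (x + 1) = e x := ((hei x (x + 1)).2 ⟨1, by simp⟩).symm
    simp only [Φ, this]
  · intro x
    rw [hΦ1, hΦ1]
  · intro x y τ hτ hp hxy
    have hI : τ ∈ Icc (0 : ℝ) 1 := ⟨hτ.1, hτ.2.le⟩
    have hC : Φ x τ ∉ S.C := by
      intro hC
      have hv := hval x τ hI
      rcases hτ.1.eq_or_lt with h0 | h0
      · exact hp (h.eq_p hC (by rw [hv, ← h0]))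
      · rw [hpos x τ (hmid x τ h0 hτ.2)] at hC
        exact (hmid x τ h0 hτ.2).not_crit hC
    rw [← hei, ← hback x τ hI hC, hxy, hback y τ hI (hxy ▸ hC)]
  · intro z hzp hz0
    by_cases hzM : z = M
    · exact ⟨0, 1, by simp, by rw [hΦ1, hzM]⟩
    have hzC : z ∉ S.C := fun hC => by
      rw [h.C_eq] at hC
      rcases hC with rfl | rfl | rfl
      · rw [h.fm] at hz0; linarith
      · exact hzp rfl
      · exact hzM rfl
    have hrz := hreach z hzC hz0 (1 / 2) (by norm_num) (by norm_num)
    obtain ⟨x, hx⟩ := hes _ hrz.f_proj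
    refine ⟨x, S.f z, ⟨hz0, hu.le z⟩, ?_⟩
    rw [hpos, hx, hrz.proj_back]
    rw [hx]
    exact hrz.back
  · intro y hyp hy0 hper
    have hyC : y ∉ S.C := fun hC => hyp (h.eq_p hC hy0)
    have hZr : ∀ s, ∀ t ∈ Icc (0 : ℝ) (1 / 2), S.Reach (S.Z s y) t := by
      intro s t ht
      rcases ht.1.eq_or_lt with h0 | h0
      · have := reach_self (S.Z_not_crit hyC s)
        rwa [S.f_Z, hy0, h0] at this
      · exact hreach _ (S.Z_not_crit hyC s) (by rw [S.f_Z, hy0]) t h0 (by linarith [ht.2])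
    have hZh : ∀ s, S.Reach (S.Z s y) (1 / 2) := fun s => hZr s _ (by norm_num)
    let c : ℝ → T := fun r => S.proj (S.Z r y) (1 / 2)
    have hc : Continuous c :=
      (continuousOn_proj (1 / 2)).comp_continuous (S.Z_cont_left y) hZh
    obtain ⟨κ, hκ, hκe⟩ := exists_lift_circle he hei hc fun r => hes _ (hZh r).f_proj
    have hcb : ∀ r, S.Reach (c r) 0 ∧ S.proj (c r) 0 = S.Z r y := by
      intro r
      have h1 := (hZh r).back
      have h2 := (hZh r).proj_back
      rw [S.f_Z, hy0] at h1 h2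
      exact ⟨h1, h2⟩
    have hcinj : ∀ r r', c r = c r' → r = r' := by
      intro r r' hrr
      have h1 : S.Z r y = S.Z r' y := by rw [← (hcb r).2, hrr, (hcb r').2]
      have := hper (-r' + r) (by rw [S.Z_add, h1, S.Z_neg_Z])
      linarith
    have hκinj : Function.Injective κ := fun r r' hrr =>
      hcinj r r' (by rw [← hκe, ← hκe, hrr])
    have hκmono : StrictMono κ := by
      refine (hκ.strictMono_of_inj hκinj).resolve_right fun hanti => ?_
      have h1 := proj_Z_pos (S := S) hper (t₀ := 0) (t₁ := 1 / 2) (by norm_num) hy0 hZr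
        (δ := P / 3) (by positivity)
      have h2 : ∀ᶠ r in 𝓝[>] (0 : ℝ), |κ r - κ 0| < 1 / 3 :=
        nhdsWithin_le_nhds (Metric.continuousAt_iff'.1 hκ.continuousAt (1 / 3) (by norm_num))
      obtain ⟨r, ⟨⟨s, hs, hsP, hsZ⟩, hr2⟩, hr⟩ := ((h1.and h2).and self_mem_nhdsWithin).exists
      have hr : 0 < r := hr
      have hc0 : S.proj y (1 / 2) = e (κ 0) := by
        rw [hκe]
        simp only [c, S.Z_zero]
      have h3 : e (κ r) = e (κ 0 + s / P) := by
        rw [hκe, heZ, ← hc0]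
        exact hsZ
      obtain ⟨k, hk⟩ := (hei _ _).1 h3
      have h4 : 0 < s / P := by positivity
      have h5 : s / P < 1 / 3 := by
        rw [div_lt_iff₀ hP]
        linarith
      have h6 := abs_lt.1 hr2
      have h7 : (k : ℝ) < 1 := by linarith
      have h8 : (-1 : ℝ) < k := by linarith
      have h9 : k = 0 := by
        have : k < 1 := by exact_mod_cast h7
        have : -1 < k := by exact_mod_cast h8
        omega
      rw [h9] at hk
      have := hanti hr
      simp at hk
      linarith
    have hlt1 : ∀ r r', κ r ≤ κ r' + 1 := by
      intro r r'
      by_contra! hcon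
      obtain ⟨r'', hr''⟩ := mem_range_of_exists_le_of_exists_ge hκ (c := κ r' + 1)
        ⟨r', by linarith⟩ ⟨r, hcon.le⟩
      have h1 : c r' = c r'' := by
        rw [← hκe, ← hκe, hei]
        exact ⟨1, by simpa using hr''⟩
      rw [← hcinj _ _ h1] at hr''
      linarith
    have hta := tendsto_atBot_ciInf hκmono.monotone
      ⟨κ 0 - 1, by rintro _ ⟨r, rfl⟩; linarith [hlt1 0 r]⟩
    have htb := tendsto_atTop_ciSup hκmono.monotone
      ⟨κ 0 + 1, by rintro _ ⟨r, rfl⟩; linarith [hlt1 r 0]⟩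
    have hκZ : ∀ r, Φ (κ r) 0 = S.Z r y := fun r => by
      rw [hpos, hκe]
      · exact (hcb r).2
      · rw [hκe]
        exact (hcb r).1
    have hc0 : Continuous fun x => Φ x 0 :=
      hcont.comp_continuous (f := fun x : ℝ => (x, (0 : ℝ))) (by fun_prop) (by simp)
    have hend : ∀ (l : Filter ℝ) [l.NeBot] (a : ℝ), (∀ s : ℝ, Tendsto (fun r => s + r) l l) →
        Tendsto κ l (𝓝 a) → Φ a 0 = p := by
      intro l _ a hl ha
      have h1 : Tendsto (fun r => S.Z r y) l (𝓝 (Φ a 0)) := by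
        have := (hc0.tendsto a).comp ha
        exact this.congr hκZ
      have h2 := Z_lim_fixed hl h1
      by_contra hne
      exact eq_of_Z_fixed (fun hC => hne (h.eq_p hC (hval _ _ (by simp)))) h2
    refine ⟨κ, hκmono, hκ, hκZ, _, _, hta, htb, ?_, ?_, ?_⟩
    · exact hend atBot _ (fun s => tendsto_atBot_add_const_left atBot s tendsto_id) hta
    · exact hend atTop _ (fun s => tendsto_atTop_add_const_left atTop s tendsto_id) htb
    · exact ciSup_le fun r => by
        have := le_ciInf (f := κ) (c := κ r - 1) fun r' => by linarith [hlt1 r r']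
        linarith

end MorseSys

/-- The sign attached to each of the two halves of the space. -/
def sgn (b : Bool) : ℝ := if b then 1 else -1

/-- Two half discs filling the space and meeting along the level `f = 0`. -/
structure Discs {T : Type*} [TopologicalSpace T] (f : T → ℝ) (Z : ℝ → T → T) (p : T)
    (Φ : Bool → ℝ → ℝ → T) : Prop where
  disc : ∀ b, HalfDisc (fun z => sgn b * f z) Z p (Φ b)
  f_cont : Continuous f
  fp : f p = 0
  Z_zero : ∀ x, Z 0 x = x
  Z_add : ∀ s t x, Z (s + t) x = Z s (Z t x)
  Z_p : ∀ s, Z s p = p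
  nonper : ∀ y, y ≠ p → f y = 0 → ∀ s, Z s y = y → s = 0
  p_mem : ∃ b x, Φ b x 0 = p
  punct : ∀ U ∈ 𝓝 p, ∃ B ∈ 𝓝 p, B ⊆ U ∧ IsPreconnected (B \ {p})

namespace HalfDisc

variable {T : Type*} [TopologicalSpace T] {f' : T → ℝ} {Z : ℝ → T → T} {p : T} {Φ : ℝ → ℝ → T}

theorem per_int (h : HalfDisc f' Z p Φ) (x τ : ℝ) (k : ℤ) : Φ (x + k) τ = Φ x τ := by
  have : Function.Periodic (fun x => Φ x τ) 1 := fun x => h.per x τ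
  simpa using this.int_mul k x

theorem cont_left (h : HalfDisc f' Z p Φ) {τ : ℝ} (hτ : τ ∈ Icc (0 : ℝ) 1) :
    Continuous fun x => Φ x τ :=
  h.cont.comp_continuous (f := fun x : ℝ => (x, τ)) (by fun_prop) (fun _ => ⟨mem_univ _, hτ⟩)

theorem surj_Icc (h : HalfDisc f' Z p Φ) {z : T} (hz : z ≠ p) (h0 : 0 ≤ f' z) :
    z ∈ (fun q : ℝ × ℝ => Φ q.1 q.2) '' (Icc 0 1 ×ˢ Icc 0 1) := by
  obtain ⟨x, τ, hτ, rfl⟩ := h.surj z hz h0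
  refine ⟨(Int.fract x, τ), ⟨⟨Int.fract_nonneg _, (Int.fract_lt_one _).le⟩, hτ⟩, ?_⟩
  have := h.per_int (Int.fract x) τ ⌊x⌋
  rw [Int.fract_add_floor] at this
  exact this.symm

end HalfDisc

theorem exists_sgn_nonneg (r : ℝ) : ∃ b, 0 ≤ sgn b * r := by
  rcases le_total 0 r with h | h
  · exact ⟨true, by simpa [sgn] using h⟩
  · exact ⟨false, by simpa [sgn] using h⟩

theorem sgn_ne_zero (b : Bool) : sgn b ≠ 0 := by cases b <;> simp [sgn]

namespace MorseSys

variable {T : Type*} [TopologicalSpace T] {S : MorseSys T} {m p M : T}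

theorem exists_discs [CompactSpace T] [T2Space T] (h : Normal S m p M) :
    ∃ Φ, Discs S.f S.Z p Φ := by
  have hdisc : ∀ b, ∃ Φ, HalfDisc (fun z => sgn b * S.f z) S.Z p Φ := by
    rintro (b | b)
    · obtain ⟨Φ, hΦ⟩ := exists_halfDisc h.neg
      refine ⟨Φ, ?_⟩
      have : (fun z => sgn false * S.f z) = S.neg.f := by
        ext z
        simp [sgn, MorseSys.neg]
      rw [this]
      exact hΦ
    · obtain ⟨Φ, hΦ⟩ := exists_halfDisc h
      exact ⟨Φ, by simpa [sgn] using hΦ⟩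
  choose Φ hΦ using hdisc
  have hp : ∃ b x, Φ b x 0 = p := by
    by_contra! hne
    let I : Bool → Set T := fun b => (fun q : ℝ × ℝ => Φ b q.1 q.2) '' (Icc 0 1 ×ˢ Icc 0 1)
    have hI : ∀ b, IsClosed (I b) := fun b =>
      ((isCompact_Icc.prod isCompact_Icc).image_of_continuousOn
      ((hΦ b).cont.mono (prod_mono (subset_univ _) le_rfl))).isClosed
    have hpI : ∀ b, p ∉ I b := by
      rintro b ⟨⟨x, τ⟩, ⟨-, hτ⟩, hx⟩
      have hx : Φ b x τ = p := hx
      have := (hΦ b).val x τ hτ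
      rw [hx, h.fp, mul_zero] at this
      rw [← this] at hx
      exact hne b x hx
    have hcov : ∀ z, z ≠ p → ∃ b, z ∈ I b := fun z hz => by
      obtain ⟨b, hb⟩ := exists_sgn_nonneg (S.f z)
      exact ⟨b, (hΦ b).surj_Icc hz hb⟩
    have h1 : ∀ᶠ z in 𝓝 p, z ∉ I true ∧ z ∉ I false :=
      ((hI true).isOpen_compl.eventually_mem (hpI _)).and
        ((hI false).isOpen_compl.eventually_mem (hpI _))
    have := S.neBot p
    obtain ⟨z, ⟨hz1, hz2⟩, hzp⟩ :=
      ((h1.filter_mono (nhdsWithin_le_nhds (s := {p}ᶜ))).and self_mem_nhdsWithin).exists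
    obtain ⟨b, hb⟩ := hcov z hzp
    cases b
    · exact hz2 hb
    · exact hz1 hb
  refine ⟨Φ, hΦ, S.f_cont, h.fp, S.Z_zero, S.Z_add, S.Z_crit p h.p_mem, ?_, hp, S.punct p⟩
  intro y hyp hy0 s hs
  by_contra hs0
  have hyC : y ∉ S.C := fun hC => hyp (h.eq_p hC hy0)
  obtain ⟨b, x, hx⟩ := hp
  have hO : IsClosed (range fun r => S.Z r y) := by
    refine (Function.Periodic.compact_of_continuous (c := s) (fun r => ?_) hs0
      (S.Z_cont_left y)).isClosed
    simp only [S.Z_add, hs]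
  have hc := (hΦ b).cont_left (τ := 0) (by simp)
  have hclop : IsClopen {x | Φ b x 0 ∈ range fun r => S.Z r y} := by
    refine ⟨hO.preimage hc, isOpen_iff_mem_nhds.2 ?_⟩
    rintro x ⟨r, hr⟩
    have hr : S.Z r y = Φ b x 0 := hr
    have hq : Φ b x 0 ∉ S.C := hr ▸ S.Z_not_crit hyC r
    have hb := S.box _ hq 1 one_pos
    have h2 : Tendsto (fun x' => (Φ b x 0, Φ b x' 0)) (𝓝 x) (𝓝 (Φ b x 0, Φ b x 0)) :=
      (Continuous.prodMk continuous_const hc).tendsto x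
    filter_upwards [h2.eventually hb] with x' hx'
    have hv : ∀ x, S.f (Φ b x 0) = 0 := fun x => by
      simpa [sgn_ne_zero] using (hΦ b).val x 0 (by simp)
    obtain ⟨s, -, hs⟩ := hx' (by simp [hv])
    exact ⟨s + r, (S.Z_add s r y).trans (by rw [hr, hs])⟩
  have huniv : {x | Φ b x 0 ∈ range fun r => S.Z r y} = univ := by
    refine hclop.eq_univ ?_
    obtain ⟨x, τ, hτ, hx⟩ := (hΦ b).surj y hyp (by simp [hy0])
    have := (hΦ b).val x τ hτ
    rw [hx, hy0, mul_zero] at this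
    rw [← this] at hx
    exact ⟨x, 0, by rw [hx]; exact S.Z_zero y⟩
  have : x ∈ {x | Φ b x 0 ∈ range fun r => S.Z r y} := huniv ▸ mem_univ x
  obtain ⟨r, hr⟩ := this
  have hr : S.Z r y = Φ b x 0 := hr
  exact S.Z_not_crit hyC r (hr ▸ hx ▸ h.p_mem)

end MorseSys

/-- The monotone circle-equivariant function collapsing the complement of the translates of
`κ(ℝ)` and equal to the sigmoid along `κ`. -/
theorem exists_collapse {κ : ℝ → ℝ} (hκ : StrictMono κ) (hc : Continuous κ) {a b : ℝ}
    (ha : Tendsto κ atBot (𝓝 a)) (hb : Tendsto κ atTop (𝓝 b)) (hab : b ≤ a + 1) :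
    ∃ W : ℝ → ℝ, Continuous W ∧ Monotone W ∧ (∀ x, W (x + 1) = W x + 1) ∧
      (∀ r, W (κ r) = Real.sigmoid r) ∧
      ∀ x, (∀ r, ∀ k : ℤ, x ≠ κ r + k) → ∃ k : ℤ, W x = k := by
  have hκa : ∀ r, a < κ r := fun r =>
    (hκ.monotone.le_of_tendsto ha (r - 1)).trans_lt (hκ (by linarith))
  have hκb : ∀ r, κ r < b := fun r =>
    (hκ (show r < r + 1 by linarith)).trans_le (hκ.monotone.ge_of_tendsto hb (r + 1))
  let E : ℝ → Set ℝ := fun x => {v | ∃ r, ∃ k : ℤ, κ r + k ≤ x ∧ v = Real.sigmoid r + k}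
  have hne : ∀ x, (E x).Nonempty := fun x =>
    ⟨_, 0, ⌊x - κ 0⌋, by linarith [Int.floor_le (x - κ 0)], rfl⟩
  have hlt : ∀ (r r' : ℝ) (k k' : ℤ), κ r' + k' ≤ κ r + k →
      Real.sigmoid r' + k' ≤ Real.sigmoid r + k := by
    intro r r' k k' h
    have h1 : (k' : ℝ) < k + 1 := by linarith [hκa r', hκb r]
    have h2 : k' ≤ k := by
      have : k' < k + 1 := by exact_mod_cast h1
      omega
    rcases h2.eq_or_lt with rfl | h3
    · have : r' ≤ r := hκ.le_iff_le.1 (by linarith)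
      linarith [Real.sigmoid_monotone this]
    · have : (k' : ℝ) + 1 ≤ k := by exact_mod_cast h3
      linarith [Real.sigmoid_lt_one r', Real.sigmoid_pos r]
  have hbdd : ∀ x, BddAbove (E x) := by
    intro x
    refine ⟨1 + (x - a), ?_⟩
    rintro _ ⟨r, k, hk, rfl⟩
    linarith [Real.sigmoid_lt_one r, hκa r]
  let W : ℝ → ℝ := fun x => sSup (E x)
  have hmono : Monotone W := fun x y hxy =>
    csSup_le_csSup (hbdd y) (hne x) fun v ⟨r, k, hk, hv⟩ => ⟨r, k, hk.trans hxy, hv⟩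
  have hWκ : ∀ r, ∀ k : ℤ, W (κ r + k) = Real.sigmoid r + k := fun r k =>
    le_antisymm (csSup_le (hne _) fun v ⟨r', k', hk', hv⟩ => hv ▸ hlt r r' k k' hk')
      (le_csSup (hbdd _) ⟨r, k, le_rfl, rfl⟩)
  have hper : ∀ x, W (x + 1) = W x + 1 := by
    intro x
    apply le_antisymm
    · refine csSup_le (hne _) fun v ⟨r, k, hk, hv⟩ => ?_
      have : Real.sigmoid r + ((k - 1 : ℤ) : ℝ) ≤ W x :=
        le_csSup (hbdd x) ⟨r, k - 1, by push_cast; linarith, rfl⟩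
      push_cast at this
      linarith
    · have : W x ≤ W (x + 1) - 1 := csSup_le (hne _) fun v ⟨r, k, hk, hv⟩ => by
        have : Real.sigmoid r + ((k + 1 : ℤ) : ℝ) ≤ W (x + 1) :=
          le_csSup (hbdd (x + 1)) ⟨r, k + 1, by push_cast; linarith, rfl⟩
        push_cast at this
        linarith
      linarith
  have hint : ∀ x, ∀ k : ℤ, b + k ≤ x + 1 → x ≤ a + k → W x = k := by
    intro x k h1 h2
    apply le_antisymm
    · refine csSup_le (hne _) fun v ⟨r, k', hk, hv⟩ => ?_
      have : (k' : ℝ) < k := by linarith [hκa r]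
      have : k' + 1 ≤ k := by exact_mod_cast this
      have : (k' : ℝ) + 1 ≤ k := by exact_mod_cast this
      linarith [Real.sigmoid_lt_one r]
    · refine le_of_tendsto (f := fun r => Real.sigmoid r + ((k - 1 : ℤ) : ℝ)) (x := atTop) ?_
        (Eventually.of_forall fun r => le_csSup (hbdd x) ⟨r, k - 1, ?_, rfl⟩)
      · have := Real.tendsto_sigmoid_atTop.add_const (((k - 1 : ℤ) : ℝ))
        convert this using 2
        push_cast
        ring
      · push_cast
        linarith [hκb r]
  have hgap : ∀ x, (∀ r, ∀ k : ℤ, x ≠ κ r + k) → ∃ k : ℤ, W x = k := by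
    intro x hx
    set k := ⌊x - a⌋
    have h1 := Int.floor_le (x - a)
    have h2 := Int.lt_floor_add_one (x - a)
    rcases h1.eq_or_lt with h3 | h3
    · exact ⟨k, hint x k (by linarith) (by linarith)⟩
    · refine ⟨k + 1, hint x (k + 1) ?_ (by push_cast; linarith)⟩
      push_cast
      by_contra! h4
      obtain ⟨r₁, hr₁⟩ := (ha.eventually (gt_mem_nhds (show a < x - k by linarith))).exists
      obtain ⟨r₂, hr₂⟩ := (hb.eventually (lt_mem_nhds (show x - k < b by linarith))).exists
      obtain ⟨r, hr⟩ := mem_range_of_exists_le_of_exists_ge hc ⟨r₁, hr₁.le⟩ ⟨r₂, hr₂.le⟩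
      exact hx r k (by linarith)
  refine ⟨W, ?_, hmono, hper, fun r => by simpa using hWκ r 0, hgap⟩
  refine hmono.continuous_of_surjective fun v => ?_
  rcases eq_or_ne (Int.fract v) 0 with h | h
  · refine ⟨a + ⌊v⌋, ?_⟩
    rw [hint (a + ⌊v⌋) ⌊v⌋ (by linarith) (by linarith)]
    have := Int.fract_add_floor v
    linarith
  · have : Int.fract v ∈ range Real.sigmoid := by
      rw [Real.range_sigmoid]
      exact ⟨(Int.fract_nonneg v).lt_of_ne h.symm, Int.fract_lt_one v⟩
    obtain ⟨r, hr⟩ := this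
    exact ⟨κ r + ⌊v⌋, by rw [hWκ, hr, Int.fract_add_floor]⟩

/-- The arc swept by the orbit of `y` on the boundary of a half disc. -/
structure ArcData {T : Type*} [TopologicalSpace T] (Z : ℝ → T → T) (p : T) (Φ : ℝ → ℝ → T)
    (y : T) where
  κ : ℝ → ℝ
  W : ℝ → ℝ
  a : ℝ
  b : ℝ
  κ_cont : Continuous κ
  κ_eq : ∀ r, Φ (κ r) 0 = Z r y
  lim_a : Tendsto κ atBot (𝓝 a)
  lim_b : Tendsto κ atTop (𝓝 b)
  a_eq : Φ a 0 = p
  b_eq : Φ b 0 = p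
  W_cont : Continuous W
  W_mono : Monotone W
  W_add : ∀ x, W (x + 1) = W x + 1
  W_κ : ∀ r, W (κ r) = Real.sigmoid r
  eq_κ : ∀ x r, Φ x 0 = Z r y → ∃ k : ℤ, x = κ r + k
  W_int : ∀ x, (∀ r, Φ x 0 ≠ Z r y) → ∃ k : ℤ, W x = k

theorem apply_add_int {W : ℝ → ℝ} {n : ℝ} (hW : ∀ x, W (x + 1) = W x + n) (x : ℝ) (k : ℤ) :
    W (x + k) = W x + n * k := by
  have : Function.Periodic (fun x => W x - n * x) 1 := fun x => by simp only [hW]; ring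
  have := this.int_mul k x
  simp only [mul_one] at this
  linarith

theorem ArcData.W_eq {T : Type*} [TopologicalSpace T] {Z : ℝ → T → T} {p : T} {Φ : ℝ → ℝ → T}
    {y : T} (d : ArcData Z p Φ y) {x r : ℝ} (h : Φ x 0 = Z r y) :
    ∃ k : ℤ, W d x = Real.sigmoid r + k := by
  obtain ⟨k, rfl⟩ := d.eq_κ x r h
  exact ⟨k, by rw [apply_add_int d.W_add, d.W_κ]; ring⟩

namespace Discs

variable {T : Type*} [TopologicalSpace T] {f : T → ℝ} {Z : ℝ → T → T} {p : T}
  {Φ : Bool → ℝ → ℝ → T}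

theorem Z_ne_p (h : Discs f Z p Φ) {y : T} (hy : y ≠ p) (s : ℝ) : Z s y ≠ p := fun hs => by
  have h1 := h.Z_add (-s) s y
  rw [hs, h.Z_p, neg_add_cancel, h.Z_zero] at h1
  exact hy h1

theorem nonempty_arcData (h : Discs f Z p Φ) (b : Bool) {y : T} (hy : y ≠ p) (hy0 : f y = 0) :
    Nonempty (ArcData Z p (Φ b) y) := by
  obtain ⟨κ, hκ, hc, hκZ, a, b', ha, hb, hap, hbp, hab⟩ :=
    (h.disc b).arcs y hy (by simp [hy0]) (h.nonper y hy hy0)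
  obtain ⟨W, h1, h2, h3, h4, h5⟩ := exists_collapse hκ hc ha hb hab
  refine ⟨⟨κ, W, a, b', hc, hκZ, ha, hb, hap, hbp, h1, h2, h3, h4, ?_, ?_⟩⟩
  · intro x r hx
    rw [← hκZ] at hx
    obtain ⟨k, hk⟩ := (h.disc b).inj (κ r) x 0 (by simp)
      (by rw [hκZ]; exact h.Z_ne_p hy r) hx.symm
    exact ⟨k, hk⟩
  · intro x hx
    apply h5
    rintro r k rfl
    rw [(h.disc b).per_int, hκZ] at hx
    exact hx r rfl

theorem val_zero (h : Discs f Z p Φ) (b : Bool) (x : ℝ) : f (Φ b x 0) = 0 := by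
  simpa [sgn_ne_zero] using (h.disc b).val x 0 (by simp)

theorem val (h : Discs f Z p Φ) (b : Bool) (x : ℝ) {τ : ℝ} (hτ : τ ∈ Icc (0 : ℝ) 1) :
    f (Φ b x τ) = sgn b * τ := by
  have h1 := (h.disc b).val x τ hτ
  have h2 : sgn b * sgn b = 1 := by cases b <;> simp [sgn]
  linear_combination sgn b * h1 - f (Φ b x τ) * h2

theorem exists_rep (h : Discs f Z p Φ) (z : T) : ∃ b x, ∃ τ ∈ Icc (0 : ℝ) 1, Φ b x τ = z := by
  by_cases hz : z = p
  · obtain ⟨b, x, hx⟩ := h.p_mem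
    exact ⟨b, x, 0, by simp, hx.trans hz.symm⟩
  · obtain ⟨b, hb⟩ := exists_sgn_nonneg (f z)
    exact ⟨b, (h.disc b).surj z hz hb⟩

/-- Continuous maps out of a space divided into two half discs. -/
theorem glue [CompactSpace T] [T2Space T] (h : Discs f Z p Φ) {X : Type*} [TopologicalSpace X]
    (q : Bool → ℝ → ℝ → X)
    (hq : ∀ b, ContinuousOn (fun v : ℝ × ℝ => q b v.1 v.2) (univ ×ˢ Icc 0 1))
    (hper : ∀ b x, ∀ τ ∈ Icc (0 : ℝ) 1, q b (x + 1) τ = q b x τ)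
    (htop : ∀ b x, q b x 1 = q b 0 1)
    (hpt : ∀ b b' x x', Φ b x 0 = p → Φ b' x' 0 = p → q b x 0 = q b' x' 0)
    (harc : ∀ x x', Φ true x 0 ≠ p → Φ true x 0 = Φ false x' 0 → q true x 0 = q false x' 0) :
    ∃ ℓ : T → X, Continuous ℓ ∧ ∀ b x, ∀ τ ∈ Icc (0 : ℝ) 1, ℓ (Φ b x τ) = q b x τ := by
  have hperk : ∀ b x, ∀ τ ∈ Icc (0 : ℝ) 1, ∀ k : ℤ, q b (x + k) τ = q b x τ := by
    intro b x τ hτ k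
    have : Function.Periodic (fun x => q b x τ) 1 := fun x => hper b x τ hτ
    simpa using this.int_mul k x
  have hsame : ∀ b x x', ∀ τ ∈ Icc (0 : ℝ) 1, Φ b x τ = Φ b x' τ → q b x τ = q b x' τ := by
    intro b x x' τ hτ hxx
    rcases hτ.2.eq_or_lt with rfl | h1
    · rw [htop, htop b x']
    by_cases hp : Φ b x τ = p
    · have hv := h.val b x hτ
      rw [hp, h.fp] at hv
      have h0 : τ = 0 := by simpa [sgn_ne_zero] using hv.symm
      subst h0
      exact hpt b b x x' hp (hxx ▸ hp)
    · obtain ⟨k, rfl⟩ := (h.disc b).inj x x' τ ⟨hτ.1, h1⟩ hp hxx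
      rw [hperk b x τ hτ]
  have hcross : ∀ x x', Φ true x 0 = Φ false x' 0 → q true x 0 = q false x' 0 := by
    intro x x' hxx
    by_cases hp : Φ true x 0 = p
    · exact hpt _ _ _ _ hp (hxx ▸ hp)
    · exact harc x x' hp hxx
  have hall : ∀ b b' x x', ∀ τ ∈ Icc (0 : ℝ) 1, ∀ τ' ∈ Icc (0 : ℝ) 1,
      Φ b x τ = Φ b' x' τ' → q b x τ = q b' x' τ' := by
    intro b b' x x' τ hτ τ' hτ' hxx
    have h1 := h.val b x hτ
    have h2 := h.val b' x' hτ'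
    rw [hxx, h2] at h1
    have e0 := hτ.1
    have e1 := hτ'.1
    cases b <;> cases b' <;> simp only [sgn, if_true, Bool.false_eq_true, if_false] at h1
    · obtain rfl : τ' = τ := by linarith
      exact hsame _ _ _ _ hτ hxx
    · obtain rfl : τ' = 0 := by linarith
      obtain rfl : τ = 0 := by linarith
      exact (hcross _ _ hxx.symm).symm
    · obtain rfl : τ' = 0 := by linarith
      obtain rfl : τ = 0 := by linarith
      exact hcross _ _ hxx
    · obtain rfl : τ' = τ := by linarith
      exact hsame _ _ _ _ hτ hxx
  choose β ξ τ' hτ' hrep using h.exists_rep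
  let ℓ : T → X := fun z => q (β z) (ξ z) (τ' z)
  have hℓ : ∀ b x, ∀ τ ∈ Icc (0 : ℝ) 1, ℓ (Φ b x τ) = q b x τ := fun b x τ hτ =>
    hall _ _ _ _ _ (hτ' _) _ hτ (hrep _)
  refine ⟨ℓ, ?_, hℓ⟩
  have hsub : Icc (0 : ℝ) 1 ×ˢ Icc (0 : ℝ) 1 ⊆ univ ×ˢ Icc (0 : ℝ) 1 :=
    prod_mono (subset_univ _) le_rfl
  let I : Bool → Set T := fun b => (fun v : ℝ × ℝ => Φ b v.1 v.2) '' (Icc 0 1 ×ˢ Icc 0 1)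
  have hIcl : ∀ b, IsClosed (I b) := fun b =>
    ((isCompact_Icc.prod isCompact_Icc).image_of_continuousOn ((h.disc b).cont.mono hsub)).isClosed
  have hIc : ∀ b, ContinuousOn ℓ (I b) := fun b => by
    refine continuousOn_of_comp_compact (isCompact_Icc.prod isCompact_Icc)
      ((h.disc b).cont.mono hsub) subset_rfl (((hq b).mono hsub).congr ?_)
    rintro ⟨x, τ⟩ ⟨-, hτ⟩
    exact hℓ b x τ hτ
  have hU : I true ∪ I false = univ := by
    refine eq_univ_of_forall fun z => ?_
    obtain ⟨b, x, τ, hτ, rfl⟩ := h.exists_rep z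
    have : Φ b x τ ∈ I b := by
      refine ⟨(Int.fract x, τ), ⟨⟨Int.fract_nonneg _, (Int.fract_lt_one _).le⟩, hτ⟩, ?_⟩
      have := (h.disc b).per_int (Int.fract x) τ ⌊x⌋
      rw [Int.fract_add_floor] at this
      exact this.symm
    cases b
    · exact Or.inr this
    · exact Or.inl this
  rw [← continuousOn_univ, ← hU]
  exact (hIc true).union_of_isClosed (hIc false) (hIcl true) (hIcl false)

end Discs

/-- A continuous real function with countably many values on a preconnected set is constant. -/
theorem IsPreconnected.eq_of_countable {X : Type*} [TopologicalSpace X] {s : Set X}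
    (hs : IsPreconnected s) {g : X → ℝ} (hg : ContinuousOn g s) {V : Set ℝ} (hV : V.Countable)
    (hgV : ∀ x ∈ s, g x ∈ V) {x y : X} (hx : x ∈ s) (hy : y ∈ s) : g x = g y := by
  have key : ∀ x ∈ s, ∀ y ∈ s, ¬ g x < g y := by
    intro x hx y hy hlt
    have h1 : Icc (g x) (g y) ⊆ V := fun v hv => by
      obtain ⟨z, hz, rfl⟩ := hs.intermediate_value hx hy hg hv
      exact hgV z hz
    exact (Cardinal.Real.Icc_countable_iff.1 (hV.mono h1)).not_gt hlt
  exact le_antisymm (not_lt.1 (key y hy x hx)) (not_lt.1 (key x hx y hy))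

theorem countable_int_mul (c : ℝ) : (range fun k : ℤ => (k : ℝ) * c).Countable := countable_range _

theorem eq_of_int_valued {g : ℝ → ℝ} (hg : Continuous g) (h : ∀ x, ∃ k : ℤ, g x = k) (x y : ℝ) :
    g x = g y :=
  isPreconnected_univ.eq_of_countable hg.continuousOn (countable_int_mul 1)
    (fun x _ => by obtain ⟨k, hk⟩ := h x; exact ⟨k, by simp [hk]⟩) (mem_univ x) (mem_univ y)

/-- Representatives of distinct orbits on the level `f = 0`. -/
structure Indep {T : Type*} (f : T → ℝ) (Z : ℝ → T → T) (p : T) {n : ℕ} (y : Fin n → T) : Prop where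
  ne : ∀ i, y i ≠ p
  zero : ∀ i, f (y i) = 0
  indep : ∀ i j, i ≠ j → ∀ r s, Z r (y i) ≠ Z s (y j)

theorem Indep.comp {T : Type*} {f : T → ℝ} {Z : ℝ → T → T} {p : T} {n : ℕ} {y : Fin n → T}
    (h : Indep f Z p y) {m : ℕ} {e : Fin m → Fin n} (he : Function.Injective e) :
    Indep f Z p (y ∘ e) :=
  ⟨fun _ => h.ne _, fun _ => h.zero _, fun _ _ hij => h.indep _ _ (he.ne hij)⟩

/-- A monotone parametrisation of the boundary of a half disc placing the orbits of
`y 0, …, y (n - 1)` in this cyclic order. -/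
structure Marking {T : Type*} (Z : ℝ → T → T) (p : T) (Φ : ℝ → ℝ → T) {n : ℕ} (y : Fin n → T)
    (ψ : ℝ → ℝ) : Prop where
  cont : Continuous ψ
  mono : Monotone ψ
  add : ∀ x, ψ (x + 1) = ψ x + n
  arc : ∀ x i r, Φ x 0 = Z r (y i) → ∃ k : ℤ, ψ x = i + Real.sigmoid r + n * k
  int : ∀ x, Φ x 0 = p → ∃ k : ℤ, ψ x = k

theorem link_eq_one {W₀ W₁ : ℝ → ℝ} (m₀ : Monotone W₀) (m₁ : Monotone W₁)
    (p₀ : ∀ x, W₀ (x + 1) = W₀ x + 1) (p₁ : ∀ x, W₁ (x + 1) = W₁ x + 1) {x₀ x₁ : ℝ}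
    (h₀ : W₀ x₀ = 1 / 2) (h₁ : W₁ x₁ = 1 / 2) {c₀₁ c₁₀ : ℤ} (h₀₁ : W₁ x₀ = c₀₁)
    (h₁₀ : W₀ x₁ = c₁₀) : c₀₁ + c₁₀ = 1 ∧ x₀ ≤ x₁ + c₀₁ ∧ x₁ + c₀₁ ≤ x₀ + 1 := by
  have e₁ := apply_add_int (n := 1) p₁ x₁ c₀₁
  have e₀ := apply_add_int (n := 1) p₀ x₁ c₀₁
  have hl : x₀ ≤ x₁ + c₀₁ := by
    by_contra! hlt
    have := m₁ hlt.le
    linarith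
  have hr : x₁ + c₀₁ ≤ x₀ + 1 := by
    by_contra! hlt
    have := m₁ hlt.le
    rw [p₁] at this
    linarith
  refine ⟨?_, hl, hr⟩
  have a1 := m₀ hl
  have a2 := m₀ hr
  rw [p₀] at a2
  have a3 : (0 : ℝ) < (c₀₁ + c₁₀ : ℤ) := by push_cast; linarith
  have a4 : ((c₀₁ + c₁₀ : ℤ) : ℝ) < 2 := by push_cast; linarith
  have a3 : (0 : ℤ) < c₀₁ + c₁₀ := by exact_mod_cast a3
  have a4 : c₀₁ + c₁₀ < (2 : ℤ) := by exact_mod_cast a4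
  omega

theorem link_triple {W₀ W₁ W₂ : ℝ → ℝ} (m₀ : Monotone W₀) (m₁ : Monotone W₁) (m₂ : Monotone W₂)
    (p₀ : ∀ x, W₀ (x + 1) = W₀ x + 1) (p₁ : ∀ x, W₁ (x + 1) = W₁ x + 1)
    (p₂ : ∀ x, W₂ (x + 1) = W₂ x + 1) {x₀ x₁ x₂ : ℝ}
    (h₀ : W₀ x₀ = 1 / 2) (h₁ : W₁ x₁ = 1 / 2) (h₂ : W₂ x₂ = 1 / 2)
    {c₀₁ c₁₀ c₁₂ c₂₀ c₀₂ : ℤ} (h₀₁ : W₁ x₀ = c₀₁)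
    (h₁₀ : W₀ x₁ = c₁₀) (h₁₂ : W₂ x₁ = c₁₂) (h₂₀ : W₀ x₂ = c₂₀) (h₀₂ : W₂ x₀ = c₀₂) :
    c₀₁ + c₁₂ + c₂₀ = 1 ∨ c₀₁ + c₁₂ + c₂₀ = 2 := by
  obtain ⟨-, hl, hr⟩ := link_eq_one m₀ m₁ p₀ p₁ h₀ h₁ h₀₁ h₁₀
  obtain ⟨h02, -, -⟩ := link_eq_one m₀ m₂ p₀ p₂ h₀ h₂ h₀₂ h₂₀
  have a1 := m₂ hl
  have a2 := m₂ hr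
  rw [p₂] at a2
  rw [apply_add_int (n := 1) p₂] at a1 a2
  rw [h₁₂, h₀₂] at a1 a2
  have a1 : c₀₂ ≤ c₁₂ + 1 * c₀₁ := by exact_mod_cast a1
  have a2 : c₁₂ + 1 * c₀₁ ≤ c₀₂ + 1 := by exact_mod_cast a2
  omega

namespace Discs

variable {T : Type*} [TopologicalSpace T] {f : T → ℝ} {Z : ℝ → T → T} {p : T}
  {Φ : Bool → ℝ → ℝ → T} {n : ℕ} {y : Fin n → T}

theorem arc_int (h : Discs f Z p Φ) {b : Bool} (hy : Indep f Z p y)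
    (d : ∀ i, ArcData Z p (Φ b) (y i)) {x : ℝ} (hx : Φ b x 0 = p) (j : Fin n) :
    ∃ k : ℤ, (d j).W x = k :=
  (d j).W_int x fun r hr => h.Z_ne_p (hy.ne j) r (hr.symm.trans hx)

theorem exists_link {b : Bool} (hy : Indep f Z p y)
    (d : ∀ i, ArcData Z p (Φ b) (y i)) (i j : Fin n) (hij : i ≠ j) :
    ∃ c : ℤ, (∀ r, (d j).W ((d i).κ r) = c) ∧ (d j).W (d i).a = c ∧ (d j).W (d i).b = c := by
  have hint : ∀ r, ∃ k : ℤ, (d j).W ((d i).κ r) = k := fun r =>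
    (d j).W_int _ fun s => by
      rw [(d i).κ_eq]
      exact hy.indep i j hij r s
  obtain ⟨c, hc⟩ := hint 0
  have hconst : ∀ r, (d j).W ((d i).κ r) = c := fun r =>
    (eq_of_int_valued ((d j).W_cont.comp (d i).κ_cont) hint r 0).trans hc
  refine ⟨c, hconst, ?_, ?_⟩
  · exact tendsto_nhds_unique ((((d j).W_cont.tendsto _).comp (d i).lim_a).congr hconst)
      tendsto_const_nhds
  · exact tendsto_nhds_unique ((((d j).W_cont.tendsto _).comp (d i).lim_b).congr hconst)
      tendsto_const_nhds

theorem marking_of_links (h : Discs f Z p Φ) {b : Bool} (hy : Indep f Z p y)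
    (d : ∀ i, ArcData Z p (Φ b) (y i)) (c : Fin n → Fin n → ℤ) (hcc : ∀ i, c i i = 0)
    (hc : ∀ i j, i ≠ j → ∀ r, (d j).W ((d i).κ r) = c i j) (C : ℤ)
    (hC : ∀ i, ∃ k : ℤ, ∑ j, c i j + C = i + n * k) :
    Marking Z p (Φ b) y fun x => ∑ j, (d j).W x + C := by
  have hadd : ∀ x, ∑ j, (d j).W (x + 1) + C = ∑ j, (d j).W x + C + n := by
    intro x
    simp only [(d _).W_add, Finset.sum_add_distrib]
    simp
    ring
  refine ⟨?_, ?_, hadd, ?_, ?_⟩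
  · exact (continuous_finsetSum _ fun j _ => (d j).W_cont).add continuous_const
  · intro x x' hxx
    simp only
    gcongr with j
    exact (d j).W_mono hxx
  · intro x i r hx
    obtain ⟨k, rfl⟩ := (d i).eq_κ x r hx
    obtain ⟨k', hk'⟩ := hC i
    refine ⟨k + k', ?_⟩
    have h1 : ∑ j, (d j).W ((d i).κ r) = Real.sigmoid r + ∑ j, (c i j : ℝ) := by
      have : ∀ j, (d j).W ((d i).κ r) = (if j = i then Real.sigmoid r else 0) + (c i j : ℝ) := by
        intro j
        by_cases hj : j = i
        · subst hj
          simp [(d j).W_κ, hcc]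
        · simp [hj, hc i j (Ne.symm hj)]
      simp only [this, Finset.sum_add_distrib]
      simp
    have h2 := apply_add_int (W := fun x => ∑ j, (d j).W x + C) (n := n) hadd ((d i).κ r) k
    beta_reduce at h2
    rw [h2, h1]
    have hk' : ((∑ j, c i j + C : ℤ) : ℝ) = ((i : ℤ) + n * k' : ℤ) := by exact_mod_cast hk'
    push_cast at hk' ⊢
    linarith
  · intro x hx
    choose k hk using fun j => h.arc_int hy d hx j
    refine ⟨∑ j, k j + C, ?_⟩
    push_cast
    simp [hk]

theorem exists_links (h : Discs f Z p Φ) (b : Bool) (hy : Indep f Z p y) :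
    ∃ (d : ∀ i, ArcData Z p (Φ b) (y i)) (c : Fin n → Fin n → ℤ), (∀ i, c i i = 0) ∧
      ∀ i j, i ≠ j → (∀ r, (d j).W ((d i).κ r) = c i j) ∧ (d j).W (d i).a = c i j ∧
        (d j).W (d i).b = c i j := by
  let d : ∀ i, ArcData Z p (Φ b) (y i) := fun i =>
    (h.nonempty_arcData b (hy.ne i) (hy.zero i)).some
  have : ∀ i j, ∃ c : ℤ, (i = j → c = 0) ∧ (i ≠ j → (∀ r, (d j).W ((d i).κ r) = c) ∧
      (d j).W (d i).a = c ∧ (d j).W (d i).b = c) := by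
    intro i j
    by_cases hij : i = j
    · exact ⟨0, fun _ => rfl, fun h => absurd hij h⟩
    · obtain ⟨c, hc⟩ := exists_link hy d i j hij
      exact ⟨c, fun h => absurd h hij, fun _ => hc⟩
  choose c hc using this
  exact ⟨d, c, fun i => (hc i i).1 rfl, fun i j => (hc i j).2⟩

theorem exists_marking_two (h : Discs f Z p Φ) (b : Bool) {y : Fin 2 → T} (hy : Indep f Z p y) :
    ∃ ψ, Marking Z p (Φ b) y ψ := by
  obtain ⟨d, c, hcc, hc⟩ := h.exists_links b hy
  refine ⟨_, h.marking_of_links hy d c hcc (fun i j hij => (hc i j hij).1) (-c 0 1) ?_⟩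
  obtain ⟨h1, -, -⟩ := link_eq_one (d 0).W_mono (d 1).W_mono (d 0).W_add (d 1).W_add
    (x₀ := (d 0).κ 0) (x₁ := (d 1).κ 0) (by rw [(d 0).W_κ]; simp [Real.sigmoid_zero])
    (by rw [(d 1).W_κ]; simp [Real.sigmoid_zero]) ((hc 0 1 (by decide)).1 0)
    ((hc 1 0 (by decide)).1 0)
  intro i
  fin_cases i
  · exact ⟨0, by simp [Fin.sum_univ_two, hcc]⟩
  · refine ⟨-c 0 1, ?_⟩
    simp [Fin.sum_univ_two, hcc]
    linarith

theorem exists_marking_three (h : Discs f Z p Φ) (b : Bool) {y : Fin 3 → T}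
    (hy : Indep f Z p y) :
    (∃ ψ, Marking Z p (Φ b) y ψ) ∨ ∃ ψ, Marking Z p (Φ b) (y ∘ Equiv.swap 1 2) ψ := by
  obtain ⟨d, c, hcc, hc⟩ := h.exists_links b hy
  have hhalf : ∀ i, (d i).W ((d i).κ 0) = 1 / 2 := fun i => by
    rw [(d i).W_κ]; simp [Real.sigmoid_zero]
  have hl : ∀ i j, i ≠ j → c i j + c j i = 1 := fun i j hij =>
    (link_eq_one (d i).W_mono (d j).W_mono (d i).W_add (d j).W_add (hhalf i) (hhalf j)
      ((hc i j hij).1 0) ((hc j i hij.symm).1 0)).1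
  have h01 := hl 0 1 (by decide)
  have h12 := hl 1 2 (by decide)
  have h02 := hl 0 2 (by decide)
  rcases link_triple (d 0).W_mono (d 1).W_mono (d 2).W_mono (d 0).W_add (d 1).W_add (d 2).W_add
    (hhalf 0) (hhalf 1) (hhalf 2) ((hc 0 1 (by decide)).1 0) ((hc 1 0 (by decide)).1 0)
    ((hc 1 2 (by decide)).1 0) ((hc 2 0 (by decide)).1 0) ((hc 0 2 (by decide)).1 0) with hs | hs
  · left
    refine ⟨_, h.marking_of_links hy d c hcc (fun i j hij => (hc i j hij).1) (-c 0 1 - c 0 2) ?_⟩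
    intro i
    fin_cases i
    · exact ⟨0, by simp [Fin.sum_univ_three, hcc]⟩
    · refine ⟨-c 0 1, ?_⟩
      simp [Fin.sum_univ_three, hcc]
      linarith
    · refine ⟨c 2 0 - 1, ?_⟩
      simp [Fin.sum_univ_three, hcc]
      linarith
  · right
    have hσ : Function.Injective (Equiv.swap (1 : Fin 3) 2) := (Equiv.swap _ _).injective
    refine ⟨_, h.marking_of_links (hy.comp hσ) (fun i => d (Equiv.swap 1 2 i))
      (fun i j => c (Equiv.swap 1 2 i) (Equiv.swap 1 2 j)) (fun i => hcc _)
      (fun i j hij => (hc _ _ (hσ.ne hij)).1) (-c 0 1 - c 0 2) ?_⟩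
    have e0 : Equiv.swap (1 : Fin 3) 2 0 = 0 := by decide
    intro i
    fin_cases i
    · refine ⟨0, ?_⟩
      simp [Fin.sum_univ_three, hcc, e0]
      ring
    · refine ⟨-c 0 2, ?_⟩
      simp [Fin.sum_univ_three, hcc, e0]
      linarith
    · refine ⟨c 1 0 - 1, ?_⟩
      simp [Fin.sum_univ_three, hcc, e0]
      linarith

end Discs

theorem cos_eq_of_eq_add_int_mul {n : ℕ} (hn : n ≠ 0) {a c s : ℝ} {k k' : ℤ}
    (ha : a = s + n * k) (hc : c = s + n * k') :
    Real.cos (2 * Real.pi * a / n) = Real.cos (2 * Real.pi * c / n) := by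
  have hn' : (n : ℝ) ≠ 0 := by exact_mod_cast hn
  rw [ha, hc]
  have e : ∀ k : ℤ, 2 * Real.pi * (s + n * k) / n = 2 * Real.pi * s / n + k * (2 * Real.pi) := by
    intro k; field_simp
  rw [e, e, Real.cos_add_int_mul_two_pi, Real.cos_add_int_mul_two_pi]

theorem ArcData.tendsto_atBot {T : Type*} [TopologicalSpace T] {f' : T → ℝ} {Z : ℝ → T → T} {p : T}
    {Φ : ℝ → ℝ → T} {y : T} (d : ArcData Z p Φ y) (h : HalfDisc f' Z p Φ) :
    Tendsto (fun r => Z r y) atBot (𝓝 p) := by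
  have h1 := ((h.cont_left (τ := 0) (by simp)).tendsto d.a).comp d.lim_a
  rw [d.a_eq] at h1
  exact h1.congr d.κ_eq

theorem ArcData.tendsto_atTop {T : Type*} [TopologicalSpace T] {f' : T → ℝ} {Z : ℝ → T → T} {p : T}
    {Φ : ℝ → ℝ → T} {y : T} (d : ArcData Z p Φ y) (h : HalfDisc f' Z p Φ) :
    Tendsto (fun r => Z r y) atTop (𝓝 p) := by
  have h1 := ((h.cont_left (τ := 0) (by simp)).tendsto d.b).comp d.lim_b
  rw [d.b_eq] at h1
  exact h1.congr d.κ_eq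

namespace Discs

theorem false_of_same_marking {T : Type*} [MetricSpace T] [CompactSpace T] {f : T → ℝ}
    {Z : ℝ → T → T} {p : T} {Φ : Bool → ℝ → ℝ → T} {n : ℕ} {y : Fin n → T} (h : Discs f Z p Φ)
    (hy : Indep f Z p y) (hfull : ∀ z, z ≠ p → f z = 0 → ∃ i r, Z r (y i) = z)
    {ψ : Bool → ℝ → ℝ} (hψ : ∀ b, Marking Z p (Φ b) y (ψ b))
    (h0 : ∀ t : ℝ, Real.cos (2 * Real.pi * t / n) = 0 → Real.cos (2 * Real.pi * t) ≤ 0)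
    (h1 : Real.cos (2 * Real.pi / n) < 0) (i₀ : Fin n) (hi₀ : (i₀ : ℕ) = 0) : False := by
  have hn : n ≠ 0 := by rintro rfl; exact i₀.elim0
  have hn' : (n : ℝ) ≠ 0 := by exact_mod_cast hn
  have hΦc := fun b => (h.disc b).cont
  have hψc : ∀ b, Continuous fun v : ℝ × ℝ => ψ b v.1 := fun b => (hψ b).cont.comp continuous_fst
  have hval : ∀ x x', Φ true x 0 ≠ p → Φ true x 0 = Φ false x' 0 →
      ∃ s : ℝ, ∃ k k' : ℤ, ψ true x = s + n * k ∧ ψ false x' = s + n * k' := by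
    intro x x' hx hxx
    obtain ⟨i, r, hr⟩ := hfull _ hx (h.val_zero _ _)
    obtain ⟨k, hk⟩ := (hψ true).arc x i r hr.symm
    obtain ⟨k', hk'⟩ := (hψ false).arc x' i r (hr.trans hxx).symm
    exact ⟨_, k, k', hk, hk'⟩
  obtain ⟨g, hg, hgq⟩ := h.glue
    (fun b x τ => (1 - τ) * dist (Φ b x τ) p * Real.cos (2 * Real.pi * ψ b x / n))
    (fun b => by
      have h2 : Continuous fun v : ℝ × ℝ => Real.cos (2 * Real.pi * ψ b v.1 / n) :=
        Real.continuous_cos.comp ((continuous_const.mul (hψc b)).div_const _)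
      have h3 : Continuous fun v : ℝ × ℝ => 1 - v.2 := by fun_prop
      exact (h3.continuousOn.mul ((continuous_id.dist continuous_const).comp_continuousOn
        (hΦc b))).mul
        h2.continuousOn)
    (fun b x τ hτ => by
      rw [(h.disc b).per, cos_eq_of_eq_add_int_mul hn (s := ψ b x) (k := 1) (k' := 0)
        (c := ψ b x) (by rw [(hψ b).add]; simp) (by simp)])
    (fun b x => by simp) (fun b b' x x' hx hx' => by simp [hx, hx'])
    (fun x x' hx hxx => by
      obtain ⟨s, k, k', hk, hk'⟩ := hval x x' hx hxx
      rw [hxx, cos_eq_of_eq_add_int_mul hn hk hk'])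
  have hcos : ∀ (s : ℝ) (k : ℤ), Real.cos (2 * Real.pi * (s + n * k)) =
      Real.cos (2 * Real.pi * s) := fun s k => by
    rw [show 2 * Real.pi * (s + n * k) = 2 * Real.pi * s + ((n * k : ℤ) : ℝ) * (2 * Real.pi) by
      push_cast; ring, Real.cos_add_int_mul_two_pi]
  have hcosint : ∀ k : ℤ, Real.cos (2 * Real.pi * k) = 1 := fun k => by
    rw [mul_comm, Real.cos_int_mul_two_pi]
  obtain ⟨w, hw, hwq⟩ := h.glue
    (fun b x τ => (1 - τ) * (1 - Real.cos (2 * Real.pi * ψ b x)))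
    (fun b => by
      have h2 : Continuous fun v : ℝ × ℝ => (1 - v.2) * (1 - Real.cos (2 * Real.pi * ψ b v.1)) :=
        (continuous_const.sub continuous_snd).mul (continuous_const.sub
          (Real.continuous_cos.comp (continuous_const.mul (hψc b))))
      exact h2.continuousOn)
    (fun b x τ hτ => by
      rw [(hψ b).add]
      have := hcos (ψ b x) 1
      simp only [Int.cast_one, mul_one] at this
      rw [this])
    (fun b x => by simp) (fun b b' x x' hx hx' => by
      obtain ⟨k, hk⟩ := (hψ b).int x hx
      obtain ⟨k', hk'⟩ := (hψ b').int x' hx'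
      rw [hk, hk', hcosint, hcosint])
    (fun x x' hx hxx => by
      obtain ⟨s, k, k', hk, hk'⟩ := hval x x' hx hxx
      rw [hk, hk', hcos, hcos])
  have hwp : w p = 0 := by
    obtain ⟨b, x, hx⟩ := h.p_mem
    obtain ⟨k, hk⟩ := (hψ b).int x hx
    rw [← hx, hwq b x 0 (by simp), hk, hcosint]
    simp
  have hU : {z | |f z| < 1 / 2 ∧ w z < 1 / 2} ∈ 𝓝 p := by
    refine (IsOpen.inter (isOpen_lt h.f_cont.abs continuous_const)
      (isOpen_lt hw continuous_const)).mem_nhds ⟨?_, ?_⟩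
    · simp [h.fp]
    · simp [hwp]
  obtain ⟨B, hB, hBU, hBc⟩ := h.punct _ hU
  have hne : ∀ z ∈ B \ {p}, g z ≠ 0 := by
    rintro z ⟨hzB, hzp⟩ hgz
    obtain ⟨hf, hwz⟩ := hBU hzB
    obtain ⟨b, x, τ, hτ, rfl⟩ := h.exists_rep z
    rw [hwq b x τ hτ] at hwz
    rw [hgq b x τ hτ] at hgz
    rw [h.val b x hτ, abs_mul, show |sgn b| = 1 by cases b <;> simp [sgn], one_mul,
      abs_of_nonneg hτ.1] at hf
    have hd : 0 < dist (Φ b x τ) p := dist_pos.2 hzp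
    have h2 : Real.cos (2 * Real.pi * ψ b x / n) = 0 := by
      rcases mul_eq_zero.1 hgz with h2 | h2
      · rcases mul_eq_zero.1 h2 with h2 | h2
        · linarith
        · exact absurd h2 hd.ne'
      · exact h2
    have := h0 _ h2
    nlinarith
  obtain ⟨d⟩ := h.nonempty_arcData true (hy.ne i₀) (hy.zero i₀)
  have hgZ : ∀ r, g (Z r (y i₀)) = dist (Z r (y i₀)) p *
      Real.cos (2 * Real.pi * Real.sigmoid r / n) := by
    intro r
    obtain ⟨k, hk⟩ := (hψ true).arc _ i₀ r (d.κ_eq r)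
    rw [← d.κ_eq, hgq _ _ 0 (by simp), cos_eq_of_eq_add_int_mul hn (k' := 0) hk
      (by simp [hi₀] : Real.sigmoid r = _)]
    simp
  have hbot : ∀ᶠ r in atBot, 0 < Real.cos (2 * Real.pi * Real.sigmoid r / n) := by
    have : Tendsto (fun r => Real.cos (2 * Real.pi * Real.sigmoid r / n)) atBot
        (𝓝 (Real.cos (2 * Real.pi * 0 / n))) :=
      (Real.continuous_cos.tendsto _).comp
        ((Real.tendsto_sigmoid_atBot.const_mul _).div_const _)
    exact this.eventually (lt_mem_nhds (by simp))
  have htop : ∀ᶠ r in atTop, Real.cos (2 * Real.pi * Real.sigmoid r / n) < 0 := by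
    have : Tendsto (fun r => Real.cos (2 * Real.pi * Real.sigmoid r / n)) atTop
        (𝓝 (Real.cos (2 * Real.pi * 1 / n))) :=
      (Real.continuous_cos.tendsto _).comp
        ((Real.tendsto_sigmoid_atTop.const_mul _).div_const _)
    exact this.eventually (gt_mem_nhds (by simpa using h1))
  obtain ⟨r₁, hr₁, hB₁⟩ := (hbot.and (d.tendsto_atBot (h.disc true) hB)).exists
  obtain ⟨r₂, hr₂, hB₂⟩ := (htop.and (d.tendsto_atTop (h.disc true) hB)).exists
  have hp := h.Z_ne_p (hy.ne i₀)
  have hpos : 0 < g (Z r₁ (y i₀)) := by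
    rw [hgZ]; exact mul_pos (dist_pos.2 (hp _)) hr₁
  have hneg : g (Z r₂ (y i₀)) < 0 := by
    rw [hgZ]; exact mul_neg_of_pos_of_neg (dist_pos.2 (hp _)) hr₂
  obtain ⟨z, hz, hgz⟩ := hBc.intermediate_value (a := Z r₂ (y i₀)) (b := Z r₁ (y i₀))
    ⟨hB₂, hp _⟩ ⟨hB₁, hp _⟩ hg.continuousOn ⟨hneg.le, hpos.le⟩
  exact hne z hz hgz

theorem false_of_same_marking_two {T : Type*} [MetricSpace T] [CompactSpace T] {f : T → ℝ}
    {Z : ℝ → T → T} {p : T} {Φ : Bool → ℝ → ℝ → T} {y : Fin 2 → T} (h : Discs f Z p Φ)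
    (hy : Indep f Z p y) (hfull : ∀ z, z ≠ p → f z = 0 → ∃ i r, Z r (y i) = z) : False := by
  choose ψ hψ using fun b => h.exists_marking_two b hy
  refine h.false_of_same_marking hy hfull hψ ?_ ?_ 0 rfl
  · intro t ht
    have : 2 * Real.pi * t = 2 * (2 * Real.pi * t / (2 : ℕ)) := by push_cast; ring
    rw [this, Real.cos_two_mul, ht]
    norm_num
  · simp

theorem false_of_same_marking_three {T : Type*} [MetricSpace T] [CompactSpace T] {f : T → ℝ}
    {Z : ℝ → T → T} {p : T} {Φ : Bool → ℝ → ℝ → T} {y : Fin 3 → T} (h : Discs f Z p Φ)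
    (hy : Indep f Z p y) (hfull : ∀ z, z ≠ p → f z = 0 → ∃ i r, Z r (y i) = z)
    (hψ : ∀ b, ∃ ψ, Marking Z p (Φ b) y ψ) : False := by
  choose ψ hψ using hψ
  refine h.false_of_same_marking hy hfull hψ ?_ ?_ 0 rfl
  · intro t ht
    have : 2 * Real.pi * t = 3 * (2 * Real.pi * t / (3 : ℕ)) := by push_cast; ring
    rw [this, Real.cos_three_mul, ht]
    norm_num
  · have : 2 * Real.pi / (3 : ℕ) = Real.pi - Real.pi / 3 := by push_cast; ring
    rw [this, Real.cos_pi_sub, Real.cos_pi_div_three]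
    norm_num

/-- The two half discs of a full triple of orbits induce opposite cyclic orders. -/
theorem exists_opposite_markings {T : Type*} [MetricSpace T] [CompactSpace T] {f : T → ℝ}
    {Z : ℝ → T → T} {p : T} {Φ : Bool → ℝ → ℝ → T} {y : Fin 3 → T} (h : Discs f Z p Φ)
    (hy : Indep f Z p y) (hfull : ∀ z, z ≠ p → f z = 0 → ∃ i r, Z r (y i) = z) :
    ∃ y' : Fin 3 → T, Indep f Z p y' ∧ (∀ z, z ≠ p → f z = 0 → ∃ i r, Z r (y' i) = z) ∧
      (∃ ψ, Marking Z p (Φ false) y' ψ) ∧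
      ∃ ψ, Marking Z p (Φ true) (y' ∘ Equiv.swap 1 2) ψ := by
  have hσ : Function.Injective (Equiv.swap (1 : Fin 3) 2) := (Equiv.swap _ _).injective
  have hy' : Indep f Z p (y ∘ Equiv.swap (1 : Fin 3) 2) := hy.comp hσ
  have hfull' : ∀ z, z ≠ p → f z = 0 → ∃ i r, Z r ((y ∘ Equiv.swap (1 : Fin 3) 2) i) = z := by
    intro z hz h0
    obtain ⟨i, r, hr⟩ := hfull z hz h0
    exact ⟨Equiv.swap 1 2 i, r, by simpa using hr⟩
  have hyy : (y ∘ Equiv.swap (1 : Fin 3) 2) ∘ Equiv.swap (1 : Fin 3) 2 = y := by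
    ext i; simp
  rcases h.exists_marking_three true hy with ht | ht <;>
  rcases h.exists_marking_three false hy with hf | hf
  · exact (h.false_of_same_marking_three hy hfull (Bool.forall_bool.2 ⟨hf, ht⟩)).elim
  · exact ⟨_, hy', hfull', hf, hyy.symm ▸ ht⟩
  · exact ⟨_, hy, hfull, hf, ht⟩
  · exact (h.false_of_same_marking_three hy' hfull' (Bool.forall_bool.2 ⟨hf, ht⟩)).elim

end Discs

/-- A parametrisation of the two halves of a space in which all gluing data are standard. -/
structure Param {T : Type*} [TopologicalSpace T] (f : T → ℝ) (Z : ℝ → T → T) (p : T) {n : ℕ}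
    (y : Bool → Fin n → T) (Λ : Bool → ℝ → ℝ → T) : Prop where
  cont : ∀ b, ContinuousOn (fun v : ℝ × ℝ => Λ b v.1 v.2) (univ ×ˢ Icc 0 1)
  per : ∀ b θ, ∀ τ ∈ Icc (0 : ℝ) 1, Λ b (θ + n) τ = Λ b θ τ
  top : ∀ b θ θ', Λ b θ 1 = Λ b θ' 1
  int : ∀ b, ∀ k : ℤ, Λ b k 0 = p
  arc : ∀ b (i : Fin n) r, ∀ k : ℤ, Λ b (i + Real.sigmoid r + n * k) 0 = Z r (y b i)
  val : ∀ b θ, ∀ τ ∈ Icc (0 : ℝ) 1, f (Λ b θ τ) = sgn b * τ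
  surj : ∀ z, ∃ b θ, ∃ τ ∈ Icc (0 : ℝ) 1, Λ b θ τ = z

theorem abs_sub_mul_le {ψ : ℝ → ℝ} (hc : Continuous ψ) {n : ℝ} (hadd : ∀ x, ψ (x + 1) = ψ x + n) :
    ∃ D : ℝ, ∀ x, |ψ x - n * x| ≤ D := by
  have hper : Function.Periodic (fun x => ψ x - n * x) 1 := fun x => by simp only [hadd]; ring
  have hcomp : IsCompact (range fun x => ψ x - n * x) :=
    hper.compact_of_continuous one_ne_zero (by fun_prop)
  obtain ⟨D, hD⟩ := hcomp.isBounded.exists_norm_le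
  exact ⟨D, fun x => hD _ ⟨x, rfl⟩⟩

theorem natCast_add_sigmoid_add_ne_intCast (i n : ℕ) (r : ℝ) (k l : ℤ) :
    (i : ℝ) + Real.sigmoid r + n * k ≠ l := by
  intro h
  have h1 := Real.sigmoid_pos r
  have h2 := Real.sigmoid_lt_one r
  have h3 : ((i + n * k : ℤ) : ℝ) < l := by push_cast; linarith
  have h4 : (l : ℝ) < ((i + n * k + 1 : ℤ) : ℝ) := by push_cast; linarith
  have h3 : (i + n * k : ℤ) < l := by exact_mod_cast h3
  have h4 : l < (i + n * k + 1 : ℤ) := by exact_mod_cast h4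
  omega

theorem eq_of_natCast_add_sigmoid_eq {n : ℕ} {i j : Fin n} {r s : ℝ} {k l : ℤ}
    (h : (i : ℝ) + Real.sigmoid r + n * k = j + Real.sigmoid s + n * l) : i = j ∧ r = s := by
  have h1 := Real.sigmoid_pos r
  have h2 := Real.sigmoid_lt_one r
  have h1' := Real.sigmoid_pos s
  have h2' := Real.sigmoid_lt_one s
  have h3 : ((i + n * k : ℤ) : ℝ) < ((j + n * l + 1 : ℤ) : ℝ) := by push_cast; linarith
  have h4 : ((j + n * l : ℤ) : ℝ) < ((i + n * k + 1 : ℤ) : ℝ) := by push_cast; linarith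
  have h3 : (i + n * k : ℤ) < j + n * l + 1 := by exact_mod_cast h3
  have h4 : (j + n * l : ℤ) < i + n * k + 1 := by exact_mod_cast h4
  have h5 : (i + n * k : ℤ) = j + n * l := by omega
  have h6 : ((i : ℕ) : ℤ) = (j : ℕ) := by
    have := congrArg (· % (n : ℤ)) h5
    simp only [Int.add_mul_emod_self_left] at this
    rwa [Int.emod_eq_of_lt (by positivity) (by exact_mod_cast i.2),
      Int.emod_eq_of_lt (by positivity) (by exact_mod_cast j.2)] at this
  have h7 : i = j := by ext; exact_mod_cast h6
  refine ⟨h7, Real.sigmoid_strictMono.injective ?_⟩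
  have h8 : ((i + n * k : ℤ) : ℝ) = ((j + n * l : ℤ) : ℝ) := by rw [h5]
  push_cast at h8
  linarith

namespace Discs

variable {T : Type*} [TopologicalSpace T] {f : T → ℝ} {Z : ℝ → T → T} {p : T}
  {Φ : Bool → ℝ → ℝ → T} {n : ℕ} {y : Bool → Fin n → T} {ψ : Bool → ℝ → ℝ}

theorem eq_of_marking_eq (h : Discs f Z p Φ)
    (hfull : ∀ b z, z ≠ p → f z = 0 → ∃ i r, Z r (y b i) = z)
    (hψ : ∀ b, Marking Z p (Φ b) (y b) (ψ b)) {b : Bool} {x x' : ℝ} (hx : ψ b x = ψ b x') :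
    Φ b x 0 = Φ b x' 0 := by
  have aux : ∀ x x', ψ b x = ψ b x' → Φ b x 0 = p → Φ b x' 0 = p := by
    intro x x' hxx hx
    by_contra hne
    obtain ⟨i, r, hr⟩ := hfull b _ hne (h.val_zero b x')
    obtain ⟨k, hk⟩ := (hψ b).arc x' i r hr.symm
    obtain ⟨l, hl⟩ := (hψ b).int x hx
    exact natCast_add_sigmoid_add_ne_intCast i n r k l (by rw [← hk, ← hl, hxx])
  by_cases h1 : Φ b x 0 = p
  · rw [h1, aux x x' hx h1]
  by_cases h2 : Φ b x' 0 = p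
  · rw [h2, aux x' x hx.symm h2]
  obtain ⟨i, r, hr⟩ := hfull b _ h1 (h.val_zero b x)
  obtain ⟨k, hk⟩ := (hψ b).arc x i r hr.symm
  obtain ⟨j, s, hs⟩ := hfull b _ h2 (h.val_zero b x')
  obtain ⟨l, hl⟩ := (hψ b).arc x' j s hs.symm
  obtain ⟨rfl, rfl⟩ := eq_of_natCast_add_sigmoid_eq (hk.symm.trans (hx.trans hl))
  rw [← hr, ← hs]

theorem exists_param [T2Space T] (h : Discs f Z p Φ) (hn : n ≠ 0) (hy : ∀ b, Indep f Z p (y b))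
    (hfull : ∀ b z, z ≠ p → f z = 0 → ∃ i r, Z r (y b i) = z)
    (hψ : ∀ b, Marking Z p (Φ b) (y b) (ψ b)) :
    ∃ Λ, Param f Z p y Λ ∧ ∀ b x, ∀ τ ∈ Icc (0 : ℝ) 1,
      Λ b (n * τ * x + (1 - τ) * ψ b x) τ = Φ b x τ := by
  have hn' : (0 : ℝ) < n := by positivity
  choose D hD using fun b => abs_sub_mul_le (hψ b).cont (hψ b).add
  let H : Bool → ℝ → ℝ → ℝ := fun b x τ => n * τ * x + (1 - τ) * ψ b x
  have hHc : ∀ b, Continuous fun v : ℝ × ℝ => H b v.1 v.2 := fun b => by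
    have := (hψ b).cont
    exact (by fun_prop : Continuous fun v : ℝ × ℝ => (n : ℝ) * v.2 * v.1).add
      ((by fun_prop : Continuous fun v : ℝ × ℝ => 1 - v.2).mul (this.comp continuous_fst))
  have hHD : ∀ b x, ∀ τ ∈ Icc (0 : ℝ) 1, |H b x τ - n * x| ≤ D b := by
    intro b x τ hτ
    have : H b x τ - n * x = (1 - τ) * (ψ b x - n * x) := by simp only [H]; ring
    rw [this, abs_mul, abs_of_nonneg (by linarith [hτ.2])]
    nlinarith [hD b x, abs_nonneg (ψ b x - n * x), hτ.1]
  have hHs : ∀ b (θ : ℝ), ∀ τ ∈ Icc (0 : ℝ) 1, ∃ x : ℝ, |n * x - θ| ≤ D b ∧ H b x τ = θ := by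
    intro b θ τ hτ
    have hc : Continuous fun x => H b x τ := (hHc b).comp (by fun_prop : Continuous fun x => (x, τ))
    have e : ∀ c : ℝ, n * (c / n) = c := fun c => by field_simp
    obtain ⟨x, hx⟩ := mem_range_of_exists_le_of_exists_ge hc (c := θ)
      ⟨(θ - D b) / n, by
        have := (abs_le.1 (hHD b ((θ - D b) / n) τ hτ)).2
        rw [e] at this
        linarith⟩
      ⟨(θ + D b) / n, by
        have := (abs_le.1 (hHD b ((θ + D b) / n) τ hτ)).1
        rw [e] at this
        linarith⟩
    refine ⟨x, ?_, hx⟩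
    have := hHD b x τ hτ
    simp only at hx
    rwa [hx, abs_sub_comm] at this
  have hHadd : ∀ b x τ, H b (x + 1) τ = H b x τ + n := fun b x τ => by
    simp only [H, (hψ b).add]; ring
  have hinj : ∀ b x x', ∀ τ ∈ Icc (0 : ℝ) 1, H b x τ = H b x' τ → Φ b x τ = Φ b x' τ := by
    intro b x x' τ hτ hxx
    rcases hτ.1.eq_or_lt with rfl | h0
    · exact h.eq_of_marking_eq hfull hψ (by simpa [H] using hxx)
    · have key : ∀ x x', x < x' → H b x τ < H b x' τ := by
        intro x x' hlt
        have h1 := (hψ b).mono hlt.le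
        have h2 : (1 - τ) * ψ b x ≤ (1 - τ) * ψ b x' :=
          mul_le_mul_of_nonneg_left h1 (by linarith [hτ.2])
        have h3 : n * τ * x < n * τ * x' := mul_lt_mul_of_pos_left hlt (by positivity)
        simp only [H]
        linarith
      rcases lt_trichotomy x x' with h1 | rfl | h1
      · exact absurd hxx (key _ _ h1).ne
      · rfl
      · exact absurd hxx (key _ _ h1).ne'
  classical
  let ξ : Bool → ℝ → ℝ → ℝ := fun b θ τ =>
    if hτ : τ ∈ Icc (0 : ℝ) 1 then (hHs b θ τ hτ).choose else 0
  have hξ : ∀ b θ, ∀ τ ∈ Icc (0 : ℝ) 1, H b (ξ b θ τ) τ = θ := by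
    intro b θ τ hτ
    simp only [ξ, dif_pos hτ]
    exact (hHs b θ τ hτ).choose_spec.2
  let Λ : Bool → ℝ → ℝ → T := fun b θ τ => Φ b (ξ b θ τ) τ
  have hΛ : ∀ b x, ∀ τ ∈ Icc (0 : ℝ) 1, Λ b (H b x τ) τ = Φ b x τ := fun b x τ hτ =>
    hinj b _ _ τ hτ (hξ b _ τ hτ)
  have h01 : (0 : ℝ) ∈ Icc (0 : ℝ) 1 := by simp
  have hΛ0 : ∀ b x, Λ b (ψ b x) 0 = Φ b x 0 := fun b x => by
    simpa [H] using hΛ b x 0 h01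
  have hper : ∀ b θ, ∀ τ ∈ Icc (0 : ℝ) 1, Λ b (θ + n) τ = Λ b θ τ := by
    intro b θ τ hτ
    obtain ⟨x, -, rfl⟩ := hHs b θ τ hτ
    rw [← hHadd, hΛ b _ τ hτ, hΛ b _ τ hτ, (h.disc b).per]
  refine ⟨Λ, ⟨?_, hper, ?_, ?_, ?_, ?_, ?_⟩, hΛ⟩
  · intro b
    have hR : ∀ R : ℝ, ContinuousOn (fun v : ℝ × ℝ => Λ b v.1 v.2) (Icc (-R) R ×ˢ Icc 0 1) := by
      intro R
      have hsub : Icc (-((R + D b) / n)) ((R + D b) / n) ×ˢ Icc (0 : ℝ) 1 ⊆ univ ×ˢ Icc 0 1 :=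
        prod_mono (subset_univ _) le_rfl
      refine continuousOn_of_comp_compact (π := fun v : ℝ × ℝ => (H b v.1 v.2, v.2))
        (K := Icc (-((R + D b) / n)) ((R + D b) / n) ×ˢ Icc 0 1)
        (isCompact_Icc.prod isCompact_Icc) ((hHc b).prodMk continuous_snd).continuousOn ?_
        (((h.disc b).cont.mono hsub).congr ?_)
      · rintro ⟨θ, τ⟩ ⟨hθ, hτ⟩
        obtain ⟨x, hx, hxθ⟩ := hHs b θ τ hτ
        refine ⟨(x, τ), ⟨?_, hτ⟩, by simp [hxθ]⟩
        obtain ⟨h1, h2⟩ := abs_le.1 hx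
        have h3 := hθ.1
        have h4 := hθ.2
        simp only at h3 h4
        refine ⟨?_, ?_⟩
        · rw [← neg_div, div_le_iff₀ hn']; simp only; linarith
        · rw [le_div_iff₀ hn']; simp only; linarith
      · rintro ⟨x, τ⟩ ⟨-, hτ⟩
        exact hΛ b x τ hτ
    rintro ⟨θ, τ⟩ ⟨-, hτ⟩
    have := hR (|θ| + 1) (θ, τ) ⟨abs_le.1 (by linarith), hτ⟩
    refine this.mono_of_mem_nhdsWithin ?_
    have hm : Icc (-(|θ| + 1)) (|θ| + 1) ×ˢ (univ : Set ℝ) ∈ 𝓝 (θ, τ) := by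
      refine prod_mem_nhds (Icc_mem_nhds ?_ ?_) univ_mem
      · linarith [neg_abs_le θ]
      · linarith [le_abs_self θ]
    filter_upwards [mem_nhdsWithin_of_mem_nhds hm, self_mem_nhdsWithin] with v h1 h2
    exact ⟨h1.1, h2.2⟩
  · intro b θ θ'
    exact ((h.disc b).top _).trans ((h.disc b).top _).symm
  · intro b k
    obtain ⟨x, -, hx⟩ := hHs b k 0 h01
    replace hx : ψ b x = k := by simpa [H] using hx
    rw [← hx, hΛ0]
    by_contra hne
    obtain ⟨i, r, hr⟩ := hfull b _ hne (h.val_zero b x)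
    obtain ⟨l, hl⟩ := (hψ b).arc x i r hr.symm
    exact natCast_add_sigmoid_add_ne_intCast i n r l k (by rw [← hl, hx])
  · intro b i r k
    obtain ⟨d⟩ := h.nonempty_arcData b ((hy b).ne i) ((hy b).zero i)
    obtain ⟨l, hl⟩ := (hψ b).arc _ i r (d.κ_eq r)
    have hp : Function.Periodic (fun θ => Λ b θ 0) n := fun θ => hper b θ 0 h01
    have e : (i : ℝ) + Real.sigmoid r + n * k = ψ b (d.κ r) + (k - l : ℤ) * n := by
      rw [hl]; push_cast; ring
    have := hp.int_mul (k - l) (ψ b (d.κ r))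
    beta_reduce at this
    rw [e, this, hΛ0, d.κ_eq]
  · intro b θ τ hτ
    exact h.val b _ hτ
  · intro z
    obtain ⟨b, x, τ, hτ, rfl⟩ := h.exists_rep z
    exact ⟨b, _, τ, hτ, hΛ b x τ hτ⟩

end Discs

section

variable {T T' : Type*} [TopologicalSpace T] [TopologicalSpace T']
  {f : T → ℝ} {Z : ℝ → T → T} {p : T} {f' : T' → ℝ} {Z' : ℝ → T' → T'} {p' : T'}
  {n : ℕ} {y : Fin n → T} {y' : Fin n → T'} {π : Bool → Equiv.Perm (Fin n)}

theorem Discs.exists_map [CompactSpace T] [T2Space T] {Φ : Bool → ℝ → ℝ → T}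
    (h : Discs f Z p Φ) (hn : n ≠ 0)
    (hfull : ∀ z, z ≠ p → f z = 0 → ∃ i r, Z r (y i) = z) {ψ : Bool → ℝ → ℝ}
    (hψ : ∀ b, Marking Z p (Φ b) (y ∘ π b) (ψ b)) {Λ : Bool → ℝ → ℝ → T}
    (hΛH : ∀ b x, ∀ τ ∈ Icc (0 : ℝ) 1, Λ b (n * τ * x + (1 - τ) * ψ b x) τ = Φ b x τ)
    {Λ' : Bool → ℝ → ℝ → T'} (h' : Param f' Z' p' (fun b => y' ∘ π b) Λ') :
    ∃ g : T → T', Continuous g ∧ ∀ b θ, ∀ τ ∈ Icc (0 : ℝ) 1, g (Λ b θ τ) = Λ' b θ τ := by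
  have hn' : (0 : ℝ) < n := by positivity
  have hHc : ∀ b, Continuous fun v : ℝ × ℝ => (n * v.2 * v.1 + (1 - v.2) * ψ b v.1, v.2) :=
    fun b => ((by fun_prop : Continuous fun v : ℝ × ℝ => (n : ℝ) * v.2 * v.1).add
      ((by fun_prop : Continuous fun v : ℝ × ℝ => 1 - v.2).mul
        ((hψ b).cont.comp continuous_fst))).prodMk continuous_snd
  obtain ⟨g, hg, hgq⟩ := h.glue (fun b x τ => Λ' b (n * τ * x + (1 - τ) * ψ b x) τ)
    (fun b => (h'.cont b).comp (hHc b).continuousOn fun v hv => ⟨mem_univ _, hv.2⟩)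
    (fun b x τ hτ => by
      rw [(hψ b).add, ← h'.per b (n * τ * x + (1 - τ) * ψ b x) τ hτ]
      congr 1
      ring)
    (fun b x => h'.top b _ _)
    (fun b b' x x' hx hx' => by
      obtain ⟨k, hk⟩ := (hψ b).int x hx
      obtain ⟨k', hk'⟩ := (hψ b').int x' hx'
      simp [hk, hk', h'.int])
    (fun x x' hx hxx => by
      obtain ⟨i, r, hr⟩ := hfull _ hx (h.val_zero _ _)
      obtain ⟨k, hk⟩ := (hψ true).arc x ((π true).symm i) r (by simpa using hr.symm)
      obtain ⟨k', hk'⟩ := (hψ false).arc x' ((π false).symm i) r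
        (by simpa using (hr.trans hxx).symm)
      have e1 := h'.arc true ((π true).symm i) r k
      have e2 := h'.arc false ((π false).symm i) r k'
      rw [← hk] at e1
      rw [← hk'] at e2
      simp only [Function.comp, Equiv.apply_symm_apply] at e1 e2
      simp [e1, e2])
  refine ⟨g, hg, fun b θ τ hτ => ?_⟩
  obtain ⟨D, hD⟩ := abs_sub_mul_le (hψ b).cont (hψ b).add
  have hHD : ∀ x, |n * τ * x + (1 - τ) * ψ b x - n * x| ≤ D := by
    intro x
    have : n * τ * x + (1 - τ) * ψ b x - n * x = (1 - τ) * (ψ b x - n * x) := by ring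
    rw [this, abs_mul, abs_of_nonneg (by linarith [hτ.2])]
    nlinarith [hD x, abs_nonneg (ψ b x - n * x), hτ.1]
  have e : ∀ c : ℝ, n * (c / n) = c := fun c => by field_simp
  obtain ⟨x, rfl⟩ := mem_range_of_exists_le_of_exists_ge (c := θ)
    (f := fun x => n * τ * x + (1 - τ) * ψ b x)
    (by have := (hψ b).cont; fun_prop)
    ⟨(θ - D) / n, by have := (abs_le.1 (hHD ((θ - D) / n))).2; rw [e] at this; linarith⟩
    ⟨(θ + D) / n, by have := (abs_le.1 (hHD ((θ + D) / n))).1; rw [e] at this; linarith⟩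
  rw [hΛH b x τ hτ, hgq b x τ hτ]

theorem Discs.exists_homeomorph [CompactSpace T] [T2Space T] [CompactSpace T'] [T2Space T']
    {Φ : Bool → ℝ → ℝ → T} {Φ' : Bool → ℝ → ℝ → T'} (h : Discs f Z p Φ) (h' : Discs f' Z' p' Φ')
    (hn : n ≠ 0) (hy : Indep f Z p y) (hy' : Indep f' Z' p' y')
    (hfull : ∀ z, z ≠ p → f z = 0 → ∃ i r, Z r (y i) = z)
    (hfull' : ∀ z, z ≠ p' → f' z = 0 → ∃ i r, Z' r (y' i) = z) (π : Bool → Equiv.Perm (Fin n))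
    (hψ : ∀ b, ∃ ψ, Marking Z p (Φ b) (y ∘ π b) ψ)
    (hψ' : ∀ b, ∃ ψ, Marking Z' p' (Φ' b) (y' ∘ π b) ψ) :
    ∃ g : T ≃ₜ T', ∀ z, f' (g z) = f z := by
  choose ψ hψ using hψ
  choose ψ' hψ' using hψ'
  have full : ∀ b z, z ≠ p → f z = 0 → ∃ i r, Z r ((y ∘ π b) i) = z := by
    intro b z hz h0
    obtain ⟨i, r, hr⟩ := hfull z hz h0
    exact ⟨(π b).symm i, r, by simpa using hr⟩
  have full' : ∀ b z, z ≠ p' → f' z = 0 → ∃ i r, Z' r ((y' ∘ π b) i) = z := by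
    intro b z hz h0
    obtain ⟨i, r, hr⟩ := hfull' z hz h0
    exact ⟨(π b).symm i, r, by simpa using hr⟩
  obtain ⟨Λ, hΛ, hΛH⟩ := h.exists_param hn (y := fun b => y ∘ π b)
    (fun b => hy.comp (π b).injective) full hψ
  obtain ⟨Λ', hΛ', hΛH'⟩ := h'.exists_param hn (y := fun b => y' ∘ π b)
    (fun b => hy'.comp (π b).injective) full' hψ'
  obtain ⟨g, hg, hgΛ⟩ := h.exists_map hn hfull hψ hΛH hΛ'
  obtain ⟨g', hg', hgΛ'⟩ := h'.exists_map hn hfull' hψ' hΛH' hΛ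
  refine ⟨⟨⟨g, g', fun z => ?_, fun z => ?_⟩, hg, hg'⟩, fun z => ?_⟩
  · obtain ⟨b, θ, τ, hτ, rfl⟩ := hΛ.surj z
    rw [hgΛ b θ τ hτ, hgΛ' b θ τ hτ]
  · obtain ⟨b, θ, τ, hτ, rfl⟩ := hΛ'.surj z
    rw [hgΛ' b θ τ hτ, hgΛ b θ τ hτ]
  · obtain ⟨b, θ, τ, hτ, rfl⟩ := hΛ.surj z
    change f' (g _) = _
    rw [hgΛ b θ τ hτ, hΛ.val b θ τ hτ, hΛ'.val b θ τ hτ]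

end

/-- The universal cover of the torus. -/
noncomputable def torusMk (v : ℝ × ℝ) : Circle × Circle := (Circle.exp v.1, Circle.exp v.2)

theorem isOpenQuotientMap_circleExp : IsOpenQuotientMap Circle.exp :=
  ⟨Circle.exp_surjective, Circle.exp.continuous, isLocalHomeomorph_circleExp.isOpenMap⟩

theorem isOpenQuotientMap_torusMk : IsOpenQuotientMap torusMk :=
  isOpenQuotientMap_circleExp.prodMap isOpenQuotientMap_circleExp

theorem torusMk_add_fst (v : ℝ × ℝ) : torusMk (v + (2 * Real.pi, 0)) = torusMk v := by
  simp [torusMk, Circle.exp_add]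

theorem torusMk_add_snd (v : ℝ × ℝ) : torusMk (v + (0, 2 * Real.pi)) = torusMk v := by
  simp [torusMk, Circle.exp_add]

theorem torusMk_eq_iff {v w : ℝ × ℝ} : torusMk v = torusMk w ↔
    ∃ k l : ℤ, v = w + ((k : ℝ) • ((2 * Real.pi, 0) : ℝ × ℝ) +
      (l : ℝ) • ((0, 2 * Real.pi) : ℝ × ℝ)) := by
  simp only [torusMk, Circle.exp_eq_exp, Prod.ext_iff]
  simp

/-- A function on the plane that is invariant under two translations is invariant under the
lattice they generate. -/
theorem eq_of_torusMk_eq {X : Type*} {w : ℝ × ℝ → X} (h₁ : ∀ v, w (v + (2 * Real.pi, 0)) = w v)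
    (h₂ : ∀ v, w (v + (0, 2 * Real.pi)) = w v) {v v' : ℝ × ℝ} (h : torusMk v = torusMk v') :
    w v = w v' := by
  obtain ⟨k, l, rfl⟩ := torusMk_eq_iff.1 h
  have p₁ : Function.Periodic w (2 * Real.pi, 0) := h₁
  have p₂ : Function.Periodic w (0, 2 * Real.pi) := h₂
  have e₁ := p₁.zsmul k
  have e₂ := p₂.zsmul l
  rw [← add_assoc, Int.cast_smul_eq_zsmul, Int.cast_smul_eq_zsmul]
  rw [e₂, e₁]

theorem exists_descend {X : Type*} [TopologicalSpace X] {w : ℝ × ℝ → X} (hw : Continuous w)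
    (h₁ : ∀ v, w (v + (2 * Real.pi, 0)) = w v) (h₂ : ∀ v, w (v + (0, 2 * Real.pi)) = w v) :
    ∃ g : Circle × Circle → X, Continuous g ∧ ∀ v, g (torusMk v) = w v := by
  have hq := isOpenQuotientMap_torusMk
  have hg : ∀ v, w (Function.surjInv hq.surjective (torusMk v)) = w v := fun v =>
    eq_of_torusMk_eq h₁ h₂ (Function.surjInv_eq _ _)
  refine ⟨w ∘ Function.surjInv hq.surjective, ?_, hg⟩
  rw [hq.isQuotientMap.continuous_iff]
  exact hw.congr fun v => (hg v).symm

/-- A function whose values modulo `2π` are invariant under a translation changes by a constant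
multiple of `2π`. -/
theorem exists_deck_const {A : Type*} [TopologicalSpace A] [PreconnectedSpace A] [Nonempty A]
    {q : A → ℝ} (hq : Continuous q) {t : A → A} (ht : Continuous t)
    (h : ∀ v, Circle.exp (q (t v)) = Circle.exp (q v)) :
    ∃ c : ℤ, ∀ v, q (t v) = q v + c * (2 * Real.pi) := by
  choose m hm using fun v => Circle.exp_eq_exp.1 (h v)
  obtain ⟨v₀⟩ : Nonempty A := inferInstance
  refine ⟨m v₀, fun v => ?_⟩
  have := isPreconnected_univ.eq_of_countable (g := fun v => q (t v) - q v)
    ((hq.comp ht).sub hq).continuousOn (countable_int_mul (2 * Real.pi))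
    (fun v _ => ⟨m v, by simp only; rw [hm v]; ring⟩) (mem_univ v) (mem_univ v₀)
  linarith [hm v₀]

/-- Three circle-valued maps on the torus satisfy a relation up to real-valued maps. -/
theorem exists_torus_relation (u : Fin 3 → Circle × Circle → Circle) (hu : ∀ k, Continuous (u k)) :
    ∃ (n : Fin 3 → ℝ) (w : Circle × Circle → ℝ), (∃ k, n k ≠ 0) ∧ Continuous w ∧
      ∀ z, ∃ θ : Fin 3 → ℝ, (∀ k, Circle.exp (θ k) = u k z) ∧ w z = ∑ k, n k * θ k := by
  choose q hq hqu using fun k =>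
    exists_circleExp_lift ((hu k).comp isOpenQuotientMap_torusMk.continuous)
  choose c₁ hc₁ using fun k => exists_deck_const (hq k)
    (t := fun v => v + (2 * Real.pi, 0)) (by fun_prop)
    fun v => by rw [hqu, hqu, Function.comp, torusMk_add_fst]; rfl
  choose c₂ hc₂ using fun k => exists_deck_const (hq k)
    (t := fun v => v + (0, 2 * Real.pi)) (by fun_prop)
    fun v => by rw [hqu, hqu, Function.comp, torusMk_add_snd]; rfl
  have hdep : ¬ LinearIndependent ℝ (fun k : Fin 3 => ((c₁ k : ℝ), (c₂ k : ℝ))) := by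
    intro hli
    have := hli.fintype_card_le_finrank
    simp at this
  obtain ⟨n, hn, k₀, hk₀⟩ := Fintype.not_linearIndependent_iff.1 hdep
  have hn₁ : ∑ k, n k * c₁ k = 0 := by simpa [Prod.fst_sum] using congrArg Prod.fst hn
  have hn₂ : ∑ k, n k * c₂ k = 0 := by simpa [Prod.snd_sum] using congrArg Prod.snd hn
  obtain ⟨w, hw, hwq⟩ := exists_descend (w := fun v => ∑ k, n k * q k v)
    (continuous_finsetSum _ fun k _ => continuous_const.mul (hq k))
    (fun v => by
      simp only [hc₁, mul_add, Finset.sum_add_distrib, ← mul_assoc, ← Finset.sum_mul, hn₁]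
      simp)
    (fun v => by
      simp only [hc₂, mul_add, Finset.sum_add_distrib, ← mul_assoc, ← Finset.sum_mul, hn₂]
      simp)
  refine ⟨n, w, ⟨k₀, hk₀⟩, hw, fun z => ?_⟩
  obtain ⟨v, rfl⟩ := isOpenQuotientMap_torusMk.surjective z
  exact ⟨fun k => q k v, fun k => hqu k v, hwq v⟩

/-- The first coordinate of the torus has no continuous real lift. -/
theorem not_exists_lift_fst : ¬ ∃ ℓ : Circle × Circle → ℝ, Continuous ℓ ∧
    ∀ z, Circle.exp (ℓ z) = z.1 := by
  rintro ⟨ℓ, hℓ, h⟩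
  have hc : Continuous fun x : ℝ => ℓ (Circle.exp x, 1) :=
    hℓ.comp (Circle.exp.continuous.prodMk continuous_const)
  choose m hm using fun x : ℝ => Circle.exp_eq_exp.1 (h (Circle.exp x, 1))
  have := isPreconnected_univ.eq_of_countable (g := fun x : ℝ => ℓ (Circle.exp x, 1) - x)
    (hc.sub continuous_id).continuousOn (countable_int_mul (2 * Real.pi))
    (fun v _ => ⟨m v, by simp only; rw [hm v]; ring⟩) (mem_univ 0) (mem_univ (2 * Real.pi))
  simp only [Circle.exp_zero, Circle.exp_two_pi] at this
  linarith [Real.pi_pos]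

namespace Discs

variable {f : Circle × Circle → ℝ} {Z : ℝ → Circle × Circle → Circle × Circle}
  {p : Circle × Circle} {Φ : Bool → ℝ → ℝ → Circle × Circle} {n : ℕ}

theorem W_sub_int {y : Fin n → Circle × Circle}
    (d : ∀ b i, ArcData Z p (Φ b) (y i)) {b b' : Bool} {x x' : ℝ} (hxx : Φ b x 0 = Φ b' x' 0)
    (i : Fin n) : ∃ k : ℤ, (d b i).W x = (d b' i).W x' + k := by
  by_cases hr : ∃ r, Φ b x 0 = Z r (y i)
  · obtain ⟨r, hr⟩ := hr
    obtain ⟨k, hk⟩ := (d b i).W_eq hr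
    obtain ⟨k', hk'⟩ := (d b' i).W_eq (hxx.symm.trans hr)
    exact ⟨k - k', by rw [hk, hk']; push_cast; ring⟩
  · push Not at hr
    obtain ⟨k, hk⟩ := (d b i).W_int x hr
    obtain ⟨k', hk'⟩ := (d b' i).W_int x' fun r => by rw [← hxx]; exact hr r
    exact ⟨k - k', by rw [hk, hk']; push_cast; ring⟩

theorem exists_circle_map (h : Discs f Z p Φ) {y : Fin n → Circle × Circle}
    (d : ∀ b i, ArcData Z p (Φ b) (y i)) (i j : Fin n) :
    ∃ u : Circle × Circle → Circle, Continuous u ∧ ∀ b x, ∀ τ ∈ Icc (0 : ℝ) 1,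
      u (Φ b x τ) = Circle.exp (2 * Real.pi * ((1 - τ) * ((d b i).W x - (d b j).W x))) := by
  have key : ∀ b b' x x', Φ b x 0 = Φ b' x' 0 →
      Circle.exp (2 * Real.pi * ((1 - 0) * ((d b i).W x - (d b j).W x))) =
      Circle.exp (2 * Real.pi * ((1 - 0) * ((d b' i).W x' - (d b' j).W x'))) := by
    intro b b' x x' hxx
    obtain ⟨k, hk⟩ := W_sub_int d hxx i
    obtain ⟨l, hl⟩ := W_sub_int d hxx j
    exact Circle.exp_eq_exp.2 ⟨k - l, by rw [hk, hl]; push_cast; ring⟩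
  refine h.glue (fun b x τ =>
    Circle.exp (2 * Real.pi * ((1 - τ) * ((d b i).W x - (d b j).W x)))) ?_ ?_ ?_ ?_ ?_
  · intro b
    have h1 := (d b i).W_cont.comp (continuous_fst (X := ℝ) (Y := ℝ))
    have h2 := (d b j).W_cont.comp (continuous_fst (X := ℝ) (Y := ℝ))
    exact (Circle.exp.continuous.comp (continuous_const.mul
      ((continuous_const.sub continuous_snd).mul (h1.sub h2)))).continuousOn
  · intro b x τ _
    simp [(d b _).W_add]
  · intro b x
    simp
  · intro b b' x x' hx hx'
    exact key b b' x x' (hx.trans hx'.symm)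
  · intro x x' _ hxx
    exact key true false x x' hxx

theorem not_indep_four (h : Discs f Z p Φ) {y : Fin 4 → Circle × Circle} (hy : Indep f Z p y) :
    False := by
  choose d c _ hc using fun b => h.exists_links b hy
  choose u hu huΦ using fun k : Fin 3 => h.exists_circle_map d k.succ 0
  obtain ⟨n, w, ⟨k₀, hk₀⟩, hw, hwu⟩ := exists_torus_relation u hu
  let G : ℝ × ℝ → ℝ := fun v => ∑ k : Fin 3, n k *
    (2 * Real.pi * ((1 - v.2) * ((d true k.succ).W v.1 - (d true 0).W v.1)))
  have hG : Continuous G := by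
    refine continuous_finsetSum _ fun k _ => ?_
    have h1 := (d true k.succ).W_cont.comp (continuous_fst (X := ℝ) (Y := ℝ))
    have h2 := (d true 0).W_cont.comp (continuous_fst (X := ℝ) (Y := ℝ))
    exact continuous_const.mul (continuous_const.mul
      ((continuous_const.sub continuous_snd).mul (h1.sub h2)))
  have hconst : ∀ x x', w (Φ true x 0) - G (x, 0) = w (Φ true x' 0) - G (x', 0) := by
    intro x x'
    refine IsPreconnected.eq_of_countable (s := univ ×ˢ Icc (0 : ℝ) 1)
      (isPreconnected_univ.prod isPreconnected_Icc)
      (g := fun v => w (Φ true v.1 v.2) - G v)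
      ((hw.comp_continuousOn (h.disc true).cont).sub hG.continuousOn)
      (countable_range fun m : Fin 3 → ℤ => ∑ k, n k * (m k * (2 * Real.pi)))
      ?_ (x := (x, 0)) (y := (x', 0)) (by simp) (by simp)
    rintro ⟨x, τ⟩ ⟨-, hτ⟩
    obtain ⟨θ, hθ, hwθ⟩ := hwu (Φ true x τ)
    choose m hm using fun k => Circle.exp_eq_exp.1 ((hθ k).trans (huΦ k true x τ hτ))
    refine ⟨m, ?_⟩
    simp only [hwθ, G, ← Finset.sum_sub_distrib, hm]
    exact Finset.sum_congr rfl fun k _ => by ring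
  have hW : ∀ i j, i ≠ j → (d true j).W (d true i).b = (d true j).W (d true i).a := fun i j hij =>
    (hc true i j hij).2.2.trans (hc true i j hij).2.1.symm
  have hWi : ∀ i, (d true i).W (d true i).b = (d true i).W (d true i).a + 1 := by
    intro i
    have h1 : (d true i).W (d true i).a = 0 :=
      tendsto_nhds_unique ((((d true i).W_cont.tendsto _).comp (d true i).lim_a))
        (Real.tendsto_sigmoid_atBot.congr fun r => ((d true i).W_κ r).symm)
    have h2 : (d true i).W (d true i).b = 1 :=
      tendsto_nhds_unique ((((d true i).W_cont.tendsto _).comp (d true i).lim_b))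
        (Real.tendsto_sigmoid_atTop.congr fun r => ((d true i).W_κ r).symm)
    rw [h1, h2, zero_add]
  have h1 := hconst (d true k₀.succ).a (d true k₀.succ).b
  rw [(d true k₀.succ).a_eq, (d true k₀.succ).b_eq] at h1
  have h2 : G ((d true k₀.succ).b, 0) = G ((d true k₀.succ).a, 0) + n k₀ * (2 * Real.pi) := by
    have h0 := hW k₀.succ 0 (Fin.succ_ne_zero _)
    have : ∀ k : Fin 3, n k * (2 * Real.pi * ((1 - 0) *
        ((d true k.succ).W (d true k₀.succ).b - (d true 0).W (d true k₀.succ).b))) =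
        n k * (2 * Real.pi * ((1 - 0) *
        ((d true k.succ).W (d true k₀.succ).a - (d true 0).W (d true k₀.succ).a))) +
        if k = k₀ then n k * (2 * Real.pi) else 0 := by
      intro k
      by_cases hk : k = k₀
      · subst hk
        rw [if_pos rfl, hWi, h0]
        ring
      · rw [if_neg hk, hW _ _ ((Fin.succ_injective _).ne (Ne.symm hk)), h0]
        ring
    simp only [G, this, Finset.sum_add_distrib]
    simp
  have h3 : n k₀ * (2 * Real.pi) = 0 := by linarith
  have := Real.pi_pos
  exact hk₀ (by simpa [this.ne'] using h3)

end Discs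

namespace Discs

variable {f : Circle × Circle → ℝ} {Z : ℝ → Circle × Circle → Circle × Circle}
  {p : Circle × Circle} {Φ : Bool → ℝ → ℝ → Circle × Circle} {n : ℕ}
  {y : Fin n → Circle × Circle}

theorem exists_strip_lift (h : Discs f Z p Φ) (b : Bool) : ∃ q : ℝ × ℝ → ℝ, Continuous q ∧
    (∀ x, ∀ τ ∈ Icc (0 : ℝ) 1, Circle.exp (q (x, τ)) = (Φ b x τ).1) ∧
    (∀ x τ, q (x + 1, τ) = q (x, τ)) ∧ ∀ x, q (x, 1) = q (0, 1) := by
  have hcl : Continuous fun v : ℝ × ℝ => (v.1, max 0 (min 1 v.2)) := by fun_prop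
  have hc : Continuous fun v : ℝ × ℝ => (Φ b v.1 (max 0 (min 1 v.2))).1 :=
    continuous_fst.comp ((h.disc b).cont.comp_continuous hcl fun v =>
      ⟨mem_univ _, le_max_left _ _, max_le zero_le_one (min_le_left _ _)⟩)
  obtain ⟨q, hq, hqΦ⟩ := exists_circleExp_lift hc
  have h1 : ∀ x, ∀ τ ∈ Icc (0 : ℝ) 1, Circle.exp (q (x, τ)) = (Φ b x τ).1 := fun x τ hτ => by
    simpa [min_eq_right hτ.2, max_eq_right hτ.1] using hqΦ (x, τ)
  have htop : ∀ x, q (x, 1) = q (0, 1) := fun x => by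
    choose m hm using fun x : ℝ => Circle.exp_eq_exp.1
      (((h1 x 1 (by simp)).trans (by rw [(h.disc b).top x])).trans (h1 0 1 (by simp)).symm)
    refine isPreconnected_univ.eq_of_countable (g := fun x => q (x, 1))
      (hq.comp (by fun_prop : Continuous fun x : ℝ => (x, (1 : ℝ)))).continuousOn
      (countable_range fun m : ℤ => q (0, 1) + m * (2 * Real.pi))
      (fun x _ => ⟨m x, (hm x).symm⟩) (mem_univ x) (mem_univ 0)
  obtain ⟨c, hc⟩ := exists_deck_const hq (t := fun v => (v.1 + 1, v.2)) (by fun_prop) fun v => by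
    rw [hqΦ, hqΦ]
    simp only [(h.disc b).per]
  refine ⟨q, hq, h1, fun x τ => ?_, htop⟩
  have h2 := hc (0, 1)
  rw [htop (0 + 1)] at h2
  have h3 := hc (x, τ)
  simp only at h3
  linarith

theorem exists_eq_p (h : Discs f Z p Φ) (b : Bool) : ∃ x, Φ b x 0 = p := by
  by_cases hp : Φ b 0 0 = p
  · exact ⟨0, hp⟩
  · obtain ⟨d⟩ := h.nonempty_arcData b hp (h.val_zero b 0)
    exact ⟨d.a, d.a_eq⟩

theorem lift_const (h : Discs f Z p Φ) (hy : Indep f Z p y)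
    (hfull : ∀ z, z ≠ p → f z = 0 → ∃ i r, Z r (y i) = z) (hn : n ≤ 1) {b : Bool}
    {q : ℝ → ℝ} (hq : Continuous q) (hqΦ : ∀ x, Circle.exp (q x) = (Φ b x 0).1)
    (hper : ∀ x, q (x + 1) = q x) {x x' : ℝ} (hx : Φ b x 0 = p) (hx' : Φ b x' 0 = p) :
    q x = q x' := by
  have key : ∀ s : Set ℝ, IsPreconnected s → (∀ x ∈ s, Φ b x 0 = p) → ∀ x ∈ s, ∀ x' ∈ s,
      q x = q x' := by
    intro s hs hsp x hx x' hx'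
    choose m hm using fun w : s => Circle.exp_eq_exp.1
      (((hqΦ w).trans (by rw [hsp w w.2, ← hsp x hx])).trans (hqΦ x).symm)
    exact hs.eq_of_countable hq.continuousOn
      (countable_range fun m : ℤ => q x + m * (2 * Real.pi))
      (fun w hw => ⟨m ⟨w, hw⟩, (hm ⟨w, hw⟩).symm⟩) hx hx'
  by_cases hex : Nonempty (Fin n)
  · obtain ⟨i⟩ := hex
    obtain ⟨d⟩ := h.nonempty_arcData b (hy.ne i) (hy.zero i)
    have hWp : ∀ x, ∀ k : ℤ, d.W x = k → Φ b x 0 = p := by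
      intro x k hk
      by_contra hne
      obtain ⟨j, r, hr⟩ := hfull _ hne (h.val_zero b x)
      have : j = i := by ext; omega
      subst this
      obtain ⟨l, hl⟩ := d.W_eq hr.symm
      refine natCast_add_sigmoid_add_ne_intCast 0 1 r l k ?_
      rw [← hk, hl]
      push_cast
      ring
    have hpW : ∀ x, Φ b x 0 = p → ∃ k : ℤ, d.W x = k := fun x hx =>
      d.W_int x fun r hr => h.Z_ne_p (hy.ne i) r (hr.symm.trans hx)
    obtain ⟨k, hk⟩ := hpW x hx
    obtain ⟨l, hl⟩ := hpW x' hx'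
    have e : q (x' + (k - l : ℤ)) = q x' := by
      have : Function.Periodic q 1 := hper
      simpa using this.int_mul (k - l) x'
    rw [← e]
    have hoc : (d.W ⁻¹' {(k : ℝ)}).OrdConnected := ordConnected_singleton.preimage_mono d.W_mono
    refine key _ hoc.isPreconnected (fun x hx => hWp x k hx) x hk _ ?_
    rw [mem_preimage, mem_singleton_iff, apply_add_int d.W_add, hl]
    push_cast
    ring
  · refine key univ isPreconnected_univ (fun x _ => ?_) x (mem_univ _) x' (mem_univ _)
    by_contra hne
    obtain ⟨j, -⟩ := hfull _ hne (h.val_zero b x)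
    exact hex ⟨j⟩

theorem two_le_of_full (h : Discs f Z p Φ) (hy : Indep f Z p y)
    (hfull : ∀ z, z ≠ p → f z = 0 → ∃ i r, Z r (y i) = z) : 2 ≤ n := by
  by_contra! hn
  have hn : n ≤ 1 := by omega
  choose q hq hqΦ hper htop using h.exists_strip_lift
  choose ξ hξ using h.exists_eq_p
  have h01 : (0 : ℝ) ∈ Icc (0 : ℝ) 1 := by simp
  have hq0 : ∀ b, Continuous fun x => q b (x, 0) := fun b =>
    (hq b).comp (by fun_prop : Continuous fun x : ℝ => (x, (0 : ℝ)))
  have hconst : ∀ b x, Φ b x 0 = p → q b (x, 0) = q b (ξ b, 0) := fun b x hx =>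
    h.lift_const hy hfull hn (q := fun x => q b (x, 0)) (hq0 b) (fun x => hqΦ b x 0 h01)
      (fun x => hper b x 0) hx (hξ b)
  have hexp : ∀ b x, ∀ τ ∈ Icc (0 : ℝ) 1,
      Circle.exp (q b (x, τ) - q b (ξ b, 0) + Complex.arg (p.1 : ℂ)) = (Φ b x τ).1 := by
    intro b x τ hτ
    rw [Circle.exp_add, Circle.exp_sub, hqΦ b x τ hτ, hqΦ b _ 0 h01, hξ, Circle.exp_arg]
    simp
  obtain ⟨ℓ, hℓ, hℓq⟩ := h.glue
    (fun b x τ => q b (x, τ) - q b (ξ b, 0) + Complex.arg (p.1 : ℂ))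
    (fun b => (((hq b).sub continuous_const).add continuous_const).continuousOn)
    (fun b x τ _ => by rw [hper]) (fun b x => by rw [htop])
    (fun b b' x x' hx hx' => by rw [hconst b x hx, hconst b' x' hx', sub_self, sub_self])
    (fun x x' hx hxx => by
      obtain ⟨i, r, hr⟩ := hfull _ hx (h.val_zero _ _)
      have d : ∀ b, ArcData Z p (Φ b) (y i) := fun b =>
        (h.nonempty_arcData b (hy.ne i) (hy.zero i)).some
      obtain ⟨k, rfl⟩ := (d true).eq_κ x r hr.symm
      obtain ⟨k', rfl⟩ := (d false).eq_κ x' r (hr.trans hxx).symm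
      have e : ∀ b x, ∀ k : ℤ, q b (x + k, 0) = q b (x, 0) := by
        intro b x k
        have : Function.Periodic (fun x => q b (x, 0)) 1 := fun x => hper b x 0
        simpa using this.int_mul k x
      rw [e, e]
      let Q : Bool → ℝ → ℝ := fun b r => q b ((d b).κ r, 0) - q b (ξ b, 0)
      have hQ : ∀ b, Continuous (Q b) := fun b =>
        ((hq0 b).comp (d b).κ_cont).sub continuous_const
      have hlim : ∀ b, Tendsto (Q b) atTop (𝓝 0) := fun b => by
        have h1 := (((hq0 b).tendsto _).comp (d b).lim_b).sub_const (q b (ξ b, 0))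
        rwa [hconst b _ (d b).b_eq, sub_self] at h1
      choose m hm using fun r => Circle.exp_eq_exp.1
        ((hexp true ((d true).κ r) 0 h01).trans (((congrArg Prod.fst (((d true).κ_eq r).trans
          ((d false).κ_eq r).symm)).trans (hexp false ((d false).κ r) 0 h01).symm)))
      have hc : ∀ r', Q true r' - Q false r' = Q true r - Q false r := fun r' =>
        isPreconnected_univ.eq_of_countable (g := fun r => Q true r - Q false r)
          ((hQ true).sub (hQ false)).continuousOn (countable_int_mul (2 * Real.pi))
          (fun r _ => ⟨m r, by simp only [Q]; linarith [hm r]⟩) (mem_univ r') (mem_univ r)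
      have h0 : Q true r - Q false r = 0 := by
        have h1 := (hlim true).sub (hlim false)
        rw [sub_zero] at h1
        exact tendsto_nhds_unique (tendsto_const_nhds.congr fun r' => (hc r').symm) h1
      simp only [Q] at h0
      linarith)
  refine not_exists_lift_fst ⟨ℓ, hℓ, fun z => ?_⟩
  obtain ⟨b, x, τ, hτ, rfl⟩ := h.exists_rep z
  rw [hℓq b x τ hτ, hexp b x τ hτ]

/-- The level of the saddle consists of exactly three orbits. -/
theorem exists_three (h : Discs f Z p Φ) : ∃ y : Fin 3 → Circle × Circle, Indep f Z p y ∧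
    ∀ z, z ≠ p → f z = 0 → ∃ i r, Z r (y i) = z := by
  have hext : ∀ n (y : Fin n → Circle × Circle), Indep f Z p y →
      (¬ ∀ z, z ≠ p → f z = 0 → ∃ i r, Z r (y i) = z) →
      ∃ y' : Fin (n + 1) → Circle × Circle, Indep f Z p y' := by
    intro n y hy hfull
    push Not at hfull
    obtain ⟨z, hz, hz0, hzy⟩ := hfull
    have hne : ∀ i r s, Z r z ≠ Z s (y i) := by
      intro i r s hrs
      refine hzy i (-r + s) ?_
      rw [h.Z_add, ← hrs, ← h.Z_add, neg_add_cancel, h.Z_zero]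
    refine ⟨Fin.cons z y, ?_, ?_, ?_⟩
    · exact Fin.cases hz hy.ne
    · exact Fin.cases hz0 hy.zero
    · intro i j
      refine Fin.cases ?_ (fun i => ?_) i <;> refine Fin.cases ?_ (fun j => ?_) j
      · intro h; exact absurd rfl h
      · intro _ r s; exact hne j r s
      · intro _ r s; exact (hne i s r).symm
      · intro hij r s; exact hy.indep i j (fun h => hij (h ▸ rfl)) r s
  have hstep : ∀ n, n ≠ 3 → n < 4 → (∃ y : Fin n → Circle × Circle, Indep f Z p y) →
      ∃ y' : Fin (n + 1) → Circle × Circle, Indep f Z p y' := by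
    rintro n hn3 hn4 ⟨y, hy⟩
    refine hext n y hy fun hfull => ?_
    have := h.two_le_of_full hy hfull
    obtain rfl : n = 2 := by omega
    exact h.false_of_same_marking_two hy hfull
  have h0 : ∃ y : Fin 0 → Circle × Circle, Indep f Z p y :=
    ⟨Fin.elim0, fun i => i.elim0, fun i => i.elim0, fun i => i.elim0⟩
  obtain ⟨y, hy⟩ := hstep 2 (by omega) (by omega)
    (hstep 1 (by omega) (by omega) (hstep 0 (by omega) (by omega) h0))
  refine ⟨y, hy, ?_⟩
  by_contra hfull
  obtain ⟨y', hy'⟩ := hext 3 y hy hfull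
  exact h.not_indep_four hy'

/-- Any two functions on the torus divided into half discs are conjugate. -/
theorem exists_torus_homeomorph {f' : Circle × Circle → ℝ}
    {Z' : ℝ → Circle × Circle → Circle × Circle} {p' : Circle × Circle}
    {Φ' : Bool → ℝ → ℝ → Circle × Circle} (h : Discs f Z p Φ) (h' : Discs f' Z' p' Φ') :
    ∃ g : Circle × Circle ≃ₜ Circle × Circle, ∀ z, f' (g z) = f z := by
  obtain ⟨y₀, hy₀, hfull₀⟩ := h.exists_three
  obtain ⟨y₀', hy₀', hfull₀'⟩ := h'.exists_three
  obtain ⟨y, hy, hfull, hψ₀, hψ₁⟩ := h.exists_opposite_markings hy₀ hfull₀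
  obtain ⟨y', hy', hfull', hψ₀', hψ₁'⟩ := h'.exists_opposite_markings hy₀' hfull₀'
  exact h.exists_homeomorph h' (by norm_num) hy hy' hfull hfull'
    (fun b => if b then Equiv.swap 1 2 else Equiv.refl _)
    (Bool.forall_bool.2 ⟨hψ₀, hψ₁⟩) (Bool.forall_bool.2 ⟨hψ₀', hψ₁'⟩)

end Discs

/-- Two Morse-type systems on the torus with three critical points have conjugate functions. -/
theorem MorseSys.exists_conj (S S' : MorseSys (Circle × Circle)) (hS : S.C.encard = 3)
    (hS' : S'.C.encard = 3) : ∃ (h : Circle × Circle ≃ₜ Circle × Circle) (h' : ℝ ≃ₜ ℝ),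
      StrictMono h' ∧ ∀ x, S.f (h x) = h' (S'.f x) := by
  obtain ⟨N, hN, m, p, M, hn⟩ := exists_normal hS
  obtain ⟨N', hN', m', p', M', hn'⟩ := exists_normal hS'
  obtain ⟨Φ, hΦ⟩ := exists_discs hn
  obtain ⟨Φ', hΦ'⟩ := exists_discs hn'
  obtain ⟨g, hg⟩ := hΦ'.exists_torus_homeomorph hΦ
  refine ⟨g, N'.trans N.symm, fun a b hab => ?_, fun x => ?_⟩
  · have h1 : StrictMono N.symm := fun a b hab => by
      rw [← hN.lt_iff_lt]
      simpa using hab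
    exact h1 (hN' hab)
  · have : N (S.f (g x)) = N' (S'.f x) := hg x
    simp [← this]

section Smooth
open Manifold

theorem contMDiff_torusMk :
    ContMDiff 𝓘(ℝ, ℝ × ℝ) ((𝓡 1).prod (𝓡 1)) (⊤ : ℕ∞) torusMk :=
  ContMDiff.prodMk (contMDiff_circleExp.comp contDiff_fst.contMDiff)
    (contMDiff_circleExp.comp contDiff_snd.contMDiff)

theorem contDiff_comp_torusMk {f : Circle × Circle → ℝ}
    (hf : ContMDiff ((𝓡 1).prod (𝓡 1)) 𝓘(ℝ) (⊤ : ℕ∞) f) :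
    ContDiff ℝ (⊤ : ℕ∞) (f ∘ torusMk) :=
  contMDiff_iff_contDiff.1 (hf.comp contMDiff_torusMk)

theorem contMDiff_circle_coe : ContMDiff (𝓡 1) 𝓘(ℝ, ℂ) (⊤ : ℕ∞) (fun z : Circle => (z : ℂ)) :=
  haveI := finrank_real_complex_fact'
  contMDiff_coe_sphere

theorem mfderiv_torusMk_injective (v : ℝ × ℝ) :
    Function.Injective (mfderiv 𝓘(ℝ, ℝ × ℝ) ((𝓡 1).prod (𝓡 1)) torusMk v) := by
  have h1 : MDifferentiableAt 𝓘(ℝ, ℝ × ℝ) ((𝓡 1).prod (𝓡 1)) torusMk v :=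
    contMDiff_torusMk.mdifferentiable (by norm_num) v
  have h2 : MDifferentiableAt ((𝓡 1).prod (𝓡 1)) 𝓘(ℝ, ℂ × ℂ)
      (fun z : Circle × Circle => ((z.1 : ℂ), (z.2 : ℂ))) (torusMk v) :=
    ((contMDiff_circle_coe.comp contMDiff_fst).prodMk_space
      (contMDiff_circle_coe.comp contMDiff_snd)).mdifferentiable (by norm_num) _
  have h3 := mfderiv_comp v h2 h1
  have h4 : HasFDerivAt ((fun z : Circle × Circle => ((z.1 : ℂ), (z.2 : ℂ))) ∘ torusMk)
      (((ContinuousLinearMap.fst ℝ ℝ ℝ).smulRight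
        (Complex.exp (v.1 * Complex.I) * Complex.I)).prod
      ((ContinuousLinearMap.snd ℝ ℝ ℝ).smulRight
        (Complex.exp (v.2 * Complex.I) * Complex.I))) v := by
    have key : ∀ t : ℝ, HasDerivAt (fun t : ℝ => Complex.exp (t * Complex.I))
        (Complex.exp (t * Complex.I) * Complex.I) t := fun t => by
      have := ((hasDerivAt_id t).ofReal_comp.mul_const Complex.I).cexp
      simpa using this
    have a := (key v.1).hasFDerivAt.comp (f := Prod.fst) v
      (hasFDerivAt_fst (𝕜 := ℝ) (E := ℝ) (F := ℝ) (p := v))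
    have b := (key v.2).hasFDerivAt.comp (f := Prod.snd) v
      (hasFDerivAt_snd (𝕜 := ℝ) (E := ℝ) (F := ℝ) (p := v))
    refine (a.prodMk b).congr_of_eventuallyEq ?_ |>.congr_fderiv ?_
    · exact Eventually.of_forall fun w => by simp [torusMk]
    · ext <;> simp
  rw [mfderiv_eq_fderiv, h4.fderiv] at h3
  intro x y hxy
  have h5 := congrArg (mfderiv ((𝓡 1).prod (𝓡 1)) 𝓘(ℝ, ℂ × ℂ)
      (fun z : Circle × Circle => ((z.1 : ℂ), (z.2 : ℂ))) (torusMk v)) hxy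
  have h6 : ∀ x, mfderiv ((𝓡 1).prod (𝓡 1)) 𝓘(ℝ, ℂ × ℂ)
      (fun z : Circle × Circle => ((z.1 : ℂ), (z.2 : ℂ))) (torusMk v)
      (mfderiv 𝓘(ℝ, ℝ × ℝ) ((𝓡 1).prod (𝓡 1)) torusMk v x) = _ := fun x =>
    (DFunLike.congr_fun h3 x).symm
  rw [h6, h6] at h5
  change ℝ × ℝ at x y
  have h7 : (x.1 • (Complex.exp (v.1 * Complex.I) * Complex.I),
      x.2 • (Complex.exp (v.2 * Complex.I) * Complex.I)) =
      (y.1 • (Complex.exp (v.1 * Complex.I) * Complex.I),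
      y.2 • (Complex.exp (v.2 * Complex.I) * Complex.I)) := h5
  have h8 : x.1 = y.1 ∧ x.2 = y.2 := by simpa [Prod.ext_iff, Complex.exp_ne_zero] using h7
  exact Prod.ext h8.1 h8.2

theorem mfderiv_torusMk_surjective (v : ℝ × ℝ) :
    Function.Surjective (mfderiv 𝓘(ℝ, ℝ × ℝ) ((𝓡 1).prod (𝓡 1)) torusMk v) := by
  have h : Module.finrank ℝ (ℝ × ℝ) =
      Module.finrank ℝ (EuclideanSpace ℝ (Fin 1) × EuclideanSpace ℝ (Fin 1)) := by simp
  exact (LinearMap.injective_iff_surjective_of_finrank_eq_finrank h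
    (f := (mfderiv 𝓘(ℝ, ℝ × ℝ) ((𝓡 1).prod (𝓡 1)) torusMk v :
      (ℝ × ℝ) →L[ℝ] (EuclideanSpace ℝ (Fin 1) × EuclideanSpace ℝ (Fin 1))).toLinearMap)).1
    (mfderiv_torusMk_injective v)

theorem mfderiv_torus_eq_zero_iff {f : Circle × Circle → ℝ}
    (hf : ContMDiff ((𝓡 1).prod (𝓡 1)) 𝓘(ℝ) (⊤ : ℕ∞) f) (v : ℝ × ℝ) :
    mfderiv ((𝓡 1).prod (𝓡 1)) 𝓘(ℝ) f (torusMk v) = 0 ↔ fderiv ℝ (f ∘ torusMk) v = 0 := by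
  have h := mfderiv_comp v (hf.mdifferentiable (by norm_num) _)
    (contMDiff_torusMk.mdifferentiable (by norm_num) v)
  rw [mfderiv_eq_fderiv] at h
  rw [h]
  constructor
  · intro h0
    rw [h0]
    rfl
  · intro h0
    ext w
    obtain ⟨u, rfl⟩ := mfderiv_torusMk_surjective v w
    exact DFunLike.congr_fun h0 u

end Smooth

theorem bounded_of_periodic {w : ℝ × ℝ → ℝ} (hw : Continuous w)
    (h₁ : ∀ v, w (v + (2 * Real.pi, 0)) = w v) (h₂ : ∀ v, w (v + (0, 2 * Real.pi)) = w v) :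
    ∃ C : NNReal, ∀ v, w v ≤ C := by
  obtain ⟨g, hg, hgw⟩ := exists_descend hw h₁ h₂
  obtain ⟨C, hC⟩ := (isCompact_range hg).bddAbove
  exact ⟨C.toNNReal, fun v => (hgw v ▸ hC ⟨_, rfl⟩ : w v ≤ C).trans (Real.le_coe_toNNReal C)⟩

/-- A doubly periodic `C¹` vector field on the plane has a global flow, which descends to the
torus. -/
theorem exists_torus_flow {v : ℝ × ℝ → ℝ × ℝ} (hv : ContDiff ℝ 1 v)
    (h₁ : ∀ x, v (x + (2 * Real.pi, 0)) = v x) (h₂ : ∀ x, v (x + (0, 2 * Real.pi)) = v x) :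
    ∃ (φ : ℝ → ℝ × ℝ → ℝ × ℝ) (Y : ℝ → Circle × Circle → Circle × Circle),
      (∀ x, φ 0 x = x) ∧ (∀ x t, HasDerivAt (fun s => φ s x) (v (φ t x)) t) ∧
      (∀ s t x, φ (s + t) x = φ s (φ t x)) ∧ (Continuous fun q : ℝ × ℝ × ℝ => φ q.1 q.2) ∧
      (∀ x, v x = 0 → ∀ t, φ t x = x) ∧ (∀ t x, Y t (torusMk x) = torusMk (φ t x)) ∧
      Continuous fun q : ℝ × Circle × Circle => Y q.1 q.2 := by
  obtain ⟨L, hL⟩ := bounded_of_periodic (w := fun x => ‖v x‖) hv.continuous.norm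
    (fun x => by simp only [h₁]) (fun x => by simp only [h₂])
  have hd : ∀ c : ℝ × ℝ, (∀ x, v (x + c) = v x) → ∀ x, fderiv ℝ v (x + c) = fderiv ℝ v x :=
    fun c hc x => by
      rw [← fderiv_comp_add_right]
      simp only [hc]
  obtain ⟨K, hK⟩ := bounded_of_periodic (w := fun x => ‖fderiv ℝ v x‖)
    (hv.continuous_fderiv one_ne_zero).norm
    (fun x => by simp only [hd _ h₁]) (fun x => by simp only [hd _ h₂])
  have hKv : LipschitzWith K v :=
    lipschitzWith_of_nnnorm_fderiv_le (𝕜 := ℝ) (hv.differentiable one_ne_zero) fun x => hK x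
  obtain ⟨φ, h0, hφ, hadd, hc, hper⟩ := exists_global_flow hKv hL
  have hq := isOpenQuotientMap_torusMk
  have hY : ∀ t x, torusMk (φ t (Function.surjInv hq.surjective (torusMk x))) =
      torusMk (φ t x) := fun t x =>
    eq_of_torusMk_eq (w := fun x => torusMk (φ t x))
      (fun x => by rw [hper _ h₁, torusMk_add_fst])
      (fun x => by rw [hper _ h₂, torusMk_add_snd]) (Function.surjInv_eq _ _)
  refine ⟨φ, fun t z => torusMk (φ t (Function.surjInv hq.surjective z)), h0, hφ, hadd, hc, ?_,
    hY, ?_⟩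
  · intro x hx t
    have := ODE_solution_unique_univ (v := fun _ => v) (s := fun _ => univ) (K := K)
      (f := fun s => φ s x) (g := fun _ => x) (t₀ := 0) (fun _ => hKv.lipschitzOnWith)
      (fun t => ⟨hφ x t, mem_univ _⟩)
      (fun t => ⟨by simpa [hx] using hasDerivAt_const t x, mem_univ _⟩) (h0 x)
    exact congrFun this t
  · rw [((IsOpenQuotientMap.id (X := ℝ)).prodMap hq).isQuotientMap.continuous_iff]
    exact (hq.continuous.comp hc).congr fun q => (hY q.1 q.2).symm

theorem isPreconnected_ball_diff_singleton (v₀ : ℝ × ℝ) (r : ℝ) :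
    IsPreconnected (Metric.ball v₀ r \ {v₀}) := by
  have hrank : 1 < Module.rank ℝ (ℝ × ℝ) := by
    rw [← Module.finrank_eq_rank]
    simp
  have h := (isPreconnected_Ioo (a := (0 : ℝ)) (b := r)).prod
    (isPreconnected_sphere hrank (0 : ℝ × ℝ) 1)
  convert h.image (fun q : ℝ × ℝ × ℝ => v₀ + q.1 • q.2) (by fun_prop) using 1
  ext w
  constructor
  · rintro ⟨hw, hne⟩
    have h0 : 0 < ‖w - v₀‖ := norm_pos_iff.2 (sub_ne_zero.2 hne)
    refine ⟨(‖w - v₀‖, ‖w - v₀‖⁻¹ • (w - v₀)), ⟨⟨h0, by simpa [dist_eq_norm] using hw⟩, ?_⟩, ?_⟩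
    · simp only [mem_sphere_zero_iff_norm]
      rw [norm_smul, norm_inv, norm_norm, inv_mul_cancel₀ h0.ne']
    · simp [smul_smul, mul_inv_cancel₀ h0.ne']
  · rintro ⟨⟨t, u⟩, ⟨ht, hu⟩, rfl⟩
    have hu' : ‖u‖ = 1 := by simpa using hu
    have hn : ‖t • u‖ = t := by rw [norm_smul, hu', mul_one, Real.norm_of_nonneg ht.1.le]
    refine ⟨by simp only [Metric.mem_ball, dist_self_add_left, hn]; exact ht.2, fun h => ?_⟩
    have : t • u = 0 := by simpa using h
    rw [this, norm_zero] at hn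
    exact ht.1.ne hn

theorem torusMk_injOn {v w : ℝ × ℝ} (h : torusMk v = torusMk w) (hd : dist v w < 2) : v = w := by
  obtain ⟨h1, h2⟩ := max_lt_iff.1 (show max (dist v.1 w.1) (dist v.2 w.2) < 2 from hd)
  have key : ∀ x y : ℝ, Circle.exp x = Circle.exp y → dist x y < 2 → x = y := by
    intro x y hxy hd
    obtain ⟨m, rfl⟩ := Circle.exp_eq_exp.1 hxy
    have h3 : |(m : ℝ)| * (2 * Real.pi) < 2 := by
      rw [Real.dist_eq, add_sub_cancel_left, abs_mul, abs_of_pos Real.two_pi_pos] at hd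
      exact hd
    have hm : |(m : ℝ)| < 1 := by nlinarith [Real.pi_gt_three, abs_nonneg (m : ℝ)]
    have : m = 0 := Int.abs_lt_one_iff.1 (by exact_mod_cast hm)
    simp [this]
  exact Prod.ext (key _ _ (congrArg Prod.fst h) h1) (key _ _ (congrArg Prod.snd h) h2)

theorem torus_punct (c : Circle × Circle) (U : Set (Circle × Circle)) (hU : U ∈ 𝓝 c) :
    ∃ B ∈ 𝓝 c, B ⊆ U ∧ IsPreconnected (B \ {c}) := by
  obtain ⟨v₀, rfl⟩ := isOpenQuotientMap_torusMk.surjective c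
  have hcont := isOpenQuotientMap_torusMk.continuous
  obtain ⟨r, hr, hrU⟩ := Metric.mem_nhds_iff.1 (hcont.continuousAt (x := v₀) hU)
  refine ⟨torusMk '' Metric.ball v₀ (min r 1),
    isOpenQuotientMap_torusMk.isOpenMap.image_mem_nhds (Metric.ball_mem_nhds _ (by positivity)),
    ?_, ?_⟩
  · rintro _ ⟨v, hv, rfl⟩
    exact hrU (Metric.ball_subset_ball (min_le_left _ _) hv)
  · have h : torusMk '' Metric.ball v₀ (min r 1) \ {torusMk v₀} =
        torusMk '' (Metric.ball v₀ (min r 1) \ {v₀}) := by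
      ext z
      constructor
      · rintro ⟨⟨v, hv, rfl⟩, hne⟩
        exact ⟨v, ⟨hv, fun h => hne (congrArg torusMk h)⟩, rfl⟩
      · rintro ⟨v, ⟨hv, hne⟩, rfl⟩
        refine ⟨⟨v, hv, rfl⟩, fun h => hne (torusMk_injOn h ?_)⟩
        have := (Metric.mem_ball.1 hv).trans_le (min_le_right _ _)
        linarith
    rw [h]
    exact (isPreconnected_ball_diff_singleton v₀ _).image _ hcont.continuousOn

theorem torus_neBot (c : Circle × Circle) : (𝓝[≠] c).NeBot := by
  have : ConnectedSpace (Circle × Circle) :=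
    isOpenQuotientMap_torusMk.surjective.connectedSpace isOpenQuotientMap_torusMk.continuous
  have : Nontrivial (Circle × Circle) := ⟨(1, 1), (-1, 1), fun h => by
    have h1 : (1 : Circle) = -1 := congrArg Prod.fst h
    have h2 : (1 : ℂ) = -1 := by simpa using congrArg (fun z : Circle => (z : ℂ)) h1
    norm_num at h2⟩
  exact ConnectedSpace.neBot_nhdsWithin_compl_of_nontrivial_of_t1space c

section Plane

variable {F : ℝ × ℝ → ℝ}

theorem hasDerivAt_along (hF : Differentiable ℝ F) {γ : ℝ → ℝ × ℝ} {u : ℝ × ℝ} {t : ℝ}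
    (hγ : HasDerivAt γ u t) :
    HasDerivAt (fun s => F (γ s)) (fderiv ℝ F (γ t) (1, 0) * u.1 + fderiv ℝ F (γ t) (0, 1) * u.2)
      t := by
  have h := (hF (γ t)).hasFDerivAt.comp_hasDerivAt t hγ
  have hu : u = u.1 • ((1, 0) : ℝ × ℝ) + u.2 • ((0, 1) : ℝ × ℝ) := by ext <;> simp
  have h1 := congrArg (fderiv ℝ F (γ t)) hu
  rw [map_add, map_smul, map_smul, smul_eq_mul, smul_eq_mul] at h1
  rw [mul_comm _ u.1, mul_comm _ u.2, ← h1]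
  exact h

theorem fderiv_eq_zero_iff_pair {v : ℝ × ℝ} :
    fderiv ℝ F v = 0 ↔ fderiv ℝ F v (1, 0) = 0 ∧ fderiv ℝ F v (0, 1) = 0 := by
  constructor
  · intro h
    simp [h]
  · rintro ⟨h1, h2⟩
    ext <;> simpa

theorem eq_of_level_of_transversal (hF : Differentiable ℝ F) {U : Set (ℝ × ℝ)} (hU : Convex ℝ U)
    {a₀ b₀ : ℝ}
    (hpos : ∀ v ∈ U, 0 < fderiv ℝ F v (1, 0) * a₀ + fderiv ℝ F v (0, 1) * b₀)
    {x y : ℝ × ℝ} (hx : x ∈ U) (hy : y ∈ U) (hxy : F x = F y)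
    (hℓ : -b₀ * x.1 + a₀ * x.2 = -b₀ * y.1 + a₀ * y.2) : x = y := by
  have hN : 0 < a₀ ^ 2 + b₀ ^ 2 := by
    rcases eq_or_ne a₀ 0 with rfl | ha
    · rcases eq_or_ne b₀ 0 with rfl | hb
      · simpa using hpos x hx
      · positivity
    · positivity
  have hγ : ∀ t : ℝ, HasDerivAt (fun s : ℝ => x + s • (y - x)) (y - x) t := fun t => by
    simpa using ((hasDerivAt_id t).smul_const (y - x)).const_add x
  have hd := fun t => hasDerivAt_along hF (hγ t)
  obtain ⟨t, ht, h0⟩ := exists_hasDerivAt_eq_zero (f := fun s : ℝ => F (x + s • (y - x)))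
    one_pos (fun t _ => (hd t).continuousAt.continuousWithinAt) (by simp [hxy]) fun t _ => hd t
  have hp : x + t • (y - x) ∈ U :=
    hU.add_smul_sub_mem hx hy ⟨ht.1.le, ht.2.le⟩
  have hD := hpos _ hp
  set p := fderiv ℝ F (x + t • (y - x)) (1, 0)
  set q := fderiv ℝ F (x + t • (y - x)) (0, 1)
  simp only [Prod.fst_sub, Prod.snd_sub] at h0
  have hc : a₀ * (y.1 - x.1) + b₀ * (y.2 - x.2) = 0 := by
    have : (a₀ * (y.1 - x.1) + b₀ * (y.2 - x.2)) * (p * a₀ + q * b₀) = 0 := by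
      linear_combination (a₀ ^ 2 + b₀ ^ 2) * h0 - (p * b₀ - q * a₀) * hℓ
    exact (mul_eq_zero.1 this).resolve_right hD.ne'
  have h1 : y.1 - x.1 = 0 := by
    have : (a₀ ^ 2 + b₀ ^ 2) * (y.1 - x.1) = 0 := by linear_combination a₀ * hc + b₀ * hℓ
    exact (mul_eq_zero.1 this).resolve_left hN.ne'
  have h2 : y.2 - x.2 = 0 := by
    have : (a₀ ^ 2 + b₀ ^ 2) * (y.2 - x.2) = 0 := by linear_combination b₀ * hc - a₀ * hℓ
    exact (mul_eq_zero.1 this).resolve_left hN.ne'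
  exact Prod.ext (by linarith) (by linarith)

variable {ψ : ℝ → ℝ × ℝ → ℝ × ℝ}

theorem level_flow_const (hF : Differentiable ℝ F)
    (hψ : ∀ x t, HasDerivAt (fun s => ψ s x)
      (-fderiv ℝ F (ψ t x) (0, 1), fderiv ℝ F (ψ t x) (1, 0)) t)
    (h0 : ∀ x, ψ 0 x = x) (s : ℝ) (x : ℝ × ℝ) : F (ψ s x) = F x := by
  have hd := fun t => hasDerivAt_along hF (hψ x t)
  have := is_const_of_deriv_eq_zero (f := fun s => F (ψ s x))
    (fun t => (hd t).differentiableAt) (fun t => by rw [(hd t).deriv]; ring) s 0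
  simpa [h0] using this

/-- Near a regular point the level flow is transversal to a linear function. -/
theorem exists_transversal (hF : ContDiff ℝ 1 F)
    (hψ : ∀ x t, HasDerivAt (fun s => ψ s x)
      (-fderiv ℝ F (ψ t x) (0, 1), fderiv ℝ F (ψ t x) (1, 0)) t)
    (h0 : ∀ x, ψ 0 x = x) (hc : Continuous fun q : ℝ × ℝ × ℝ => ψ q.1 q.2)
    {v₀ : ℝ × ℝ} (hv₀ : fderiv ℝ F v₀ ≠ 0) {ε : ℝ} (hε : 0 < ε) :
    ∃ (a₀ b₀ δ : ℝ) (U : Set (ℝ × ℝ)), 0 < δ ∧ δ < ε ∧ Convex ℝ U ∧ U ∈ 𝓝 v₀ ∧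
      U ⊆ Metric.ball v₀ 1 ∧
      (∀ v ∈ U, 0 < fderiv ℝ F v (1, 0) * a₀ + fderiv ℝ F v (0, 1) * b₀) ∧
      ∀ᶠ x in 𝓝 v₀, (∀ s ∈ Icc (-δ) δ, ψ s x ∈ U) ∧
        StrictMonoOn (fun s => -b₀ * (ψ s x).1 + a₀ * (ψ s x).2) (Icc (-δ) δ) := by
  set a₀ := fderiv ℝ F v₀ (1, 0) with ha₀
  set b₀ := fderiv ℝ F v₀ (0, 1) with hb₀
  have hN : 0 < a₀ * a₀ + b₀ * b₀ := by
    by_contra! h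
    refine hv₀ (fderiv_eq_zero_iff_pair.2 ⟨?_, ?_⟩)
    · nlinarith
    · nlinarith
  have hcf := hF.continuous_fderiv one_ne_zero
  have hcD : Continuous fun v => fderiv ℝ F v (1, 0) * a₀ + fderiv ℝ F v (0, 1) * b₀ := by
    fun_prop
  obtain ⟨r, hr, hrU⟩ := Metric.eventually_nhds_iff_ball.1
    (hcD.continuousAt.eventually_const_lt hN)
  have hUn : Metric.ball v₀ (min r 1) ∈ 𝓝 v₀ := Metric.ball_mem_nhds _ (by positivity)
  have hU : ∀ v ∈ Metric.ball v₀ (min r 1),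
      0 < fderiv ℝ F v (1, 0) * a₀ + fderiv ℝ F v (0, 1) * b₀ := fun v hv =>
    hrU v (Metric.ball_subset_ball (min_le_left _ _) hv)
  have hev : ∀ᶠ q : ℝ × ℝ × ℝ in 𝓝 (0 : ℝ) ×ˢ 𝓝 v₀, ψ q.1 q.2 ∈ Metric.ball v₀ (min r 1) := by
    rw [← nhds_prod_eq]
    refine hc.continuousAt.eventually_mem ?_
    simpa [h0] using hUn
  obtain ⟨P, hP, Q, hQ, hPQ⟩ := eventually_prod_iff.1 hev
  obtain ⟨d, hd, hdP⟩ := Metric.eventually_nhds_iff.1 hP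
  have hmin : 0 < min d ε := lt_min hd hε
  refine ⟨a₀, b₀, min d ε / 2, _, by linarith, ?_, convex_ball _ _, hUn,
    Metric.ball_subset_ball (min_le_right _ _), hU, ?_⟩
  · linarith [min_le_right d ε]
  · filter_upwards [hQ] with x hx
    have hm : ∀ s ∈ Icc (-(min d ε / 2)) (min d ε / 2), ψ s x ∈ Metric.ball v₀ (min r 1) := by
      refine fun s hs => hPQ (hdP ?_) hx
      rw [dist_zero_right, Real.norm_eq_abs]
      have := abs_le.2 hs
      linarith [min_le_left d ε]
    refine ⟨hm, ?_⟩
    have hder : ∀ s, HasDerivAt (fun s => -b₀ * (ψ s x).1 + a₀ * (ψ s x).2)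
        (-b₀ * -fderiv ℝ F (ψ s x) (0, 1) + a₀ * fderiv ℝ F (ψ s x) (1, 0)) s := fun s => by
      have d₁ : HasDerivAt (fun s => (ψ s x).1) (-fderiv ℝ F (ψ s x) (0, 1)) s :=
        (ContinuousLinearMap.fst ℝ ℝ ℝ).hasFDerivAt.comp_hasDerivAt s (hψ x s)
      have d₂ : HasDerivAt (fun s => (ψ s x).2) (fderiv ℝ F (ψ s x) (1, 0)) s :=
        (ContinuousLinearMap.snd ℝ ℝ ℝ).hasFDerivAt.comp_hasDerivAt s (hψ x s)
      exact (d₁.const_mul (-b₀)).add (d₂.const_mul a₀)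
    refine strictMonoOn_of_deriv_pos (convex_Icc _ _)
      (fun s _ => (hder s).continuousAt.continuousWithinAt) fun s hs => ?_
    rw [(hder s).deriv]
    linarith [hU _ (hm s (interior_subset hs))]

theorem eventually_exists_level_flow (hF : ContDiff ℝ 1 F)
    (hψ : ∀ x t, HasDerivAt (fun s => ψ s x)
      (-fderiv ℝ F (ψ t x) (0, 1), fderiv ℝ F (ψ t x) (1, 0)) t)
    (h0 : ∀ x, ψ 0 x = x) (hc : Continuous fun q : ℝ × ℝ × ℝ => ψ q.1 q.2)
    {v₀ : ℝ × ℝ} (hv₀ : fderiv ℝ F v₀ ≠ 0) {ε : ℝ} (hε : 0 < ε) :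
    ∀ᶠ z : (ℝ × ℝ) × (ℝ × ℝ) in 𝓝 (v₀, v₀), F z.1 = F z.2 → ∃ s, |s| < ε ∧ ψ s z.1 = z.2 := by
  obtain ⟨a₀, b₀, δ, U, hδ, hδε, hconv, hUn, -, hpos, hev⟩ :=
    exists_transversal hF hψ h0 hc hv₀ hε
  have hcs : ∀ s, Continuous (ψ s) := fun s => hc.comp (continuous_const.prodMk continuous_id)
  have hmono := hev.self_of_nhds.2
  have m1 : (-δ) ∈ Icc (-δ) δ := ⟨le_rfl, by linarith⟩
  have m2 : (0 : ℝ) ∈ Icc (-δ) δ := ⟨by linarith, hδ.le⟩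
  have m3 : δ ∈ Icc (-δ) δ := ⟨by linarith, le_rfl⟩
  have l1 := hmono m1 m2 (by linarith)
  have l2 := hmono m2 m3 hδ
  simp only [h0] at l1 l2
  have e1 : ∀ᶠ z : (ℝ × ℝ) × (ℝ × ℝ) in 𝓝 (v₀, v₀),
      -b₀ * (ψ (-δ) z.1).1 + a₀ * (ψ (-δ) z.1).2 < -b₀ * z.2.1 + a₀ * z.2.2 := by
    have := hcs (-δ)
    exact ContinuousAt.eventually_lt (by fun_prop) (by fun_prop) l1
  have e2 : ∀ᶠ z : (ℝ × ℝ) × (ℝ × ℝ) in 𝓝 (v₀, v₀),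
      -b₀ * z.2.1 + a₀ * z.2.2 < -b₀ * (ψ δ z.1).1 + a₀ * (ψ δ z.1).2 := by
    have := hcs δ
    exact ContinuousAt.eventually_lt (by fun_prop) (by fun_prop) l2
  have e3 := (continuous_fst.tendsto (v₀, v₀)).eventually hev
  have e4 : ∀ᶠ z : (ℝ × ℝ) × (ℝ × ℝ) in 𝓝 (v₀, v₀), z.2 ∈ U :=
    continuous_snd.continuousAt.eventually_mem hUn
  filter_upwards [e1, e2, e3, e4] with z h1 h2 h3 h4 hz
  have hcz : Continuous fun s => ψ s z.1 := hc.comp (continuous_id.prodMk continuous_const)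
  obtain ⟨s, hs, hsz⟩ := intermediate_value_Icc (by linarith : -δ ≤ δ)
    (f := fun s => -b₀ * (ψ s z.1).1 + a₀ * (ψ s z.1).2) (by fun_prop) ⟨h1.le, h2.le⟩
  refine ⟨s, (abs_le.2 hs).trans_lt hδε, ?_⟩
  have hd := hF.differentiable one_ne_zero
  exact eq_of_level_of_transversal hd hconv hpos (h3.1 s hs) h4
    ((level_flow_const hd hψ h0 s _).trans hz) hsz

theorem exists_eventually_level_flow_ne (hF : ContDiff ℝ 1 F)
    (hψ : ∀ x t, HasDerivAt (fun s => ψ s x)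
      (-fderiv ℝ F (ψ t x) (0, 1), fderiv ℝ F (ψ t x) (1, 0)) t)
    (h0 : ∀ x, ψ 0 x = x) (hc : Continuous fun q : ℝ × ℝ × ℝ => ψ q.1 q.2)
    {v₀ : ℝ × ℝ} (hv₀ : fderiv ℝ F v₀ ≠ 0) :
    ∃ ε > 0, ∀ᶠ x in 𝓝 v₀, ∀ s, 0 < |s| → |s| < ε → ψ s x ≠ x ∧ dist (ψ s x) x < 2 := by
  obtain ⟨a₀, b₀, δ, U, hδ, -, -, hUn, hU1, -, hev⟩ :=
    exists_transversal hF hψ h0 hc hv₀ one_pos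
  refine ⟨δ, hδ, ?_⟩
  filter_upwards [hev, hUn] with x hx hxU s hs hsδ
  have hs' := abs_le.1 hsδ.le
  refine ⟨fun h => ?_, ?_⟩
  · have := hx.2.injOn hs' (⟨by linarith, hδ.le⟩ : (0 : ℝ) ∈ Icc (-δ) δ)
      (by simp only [h, h0])
    simp [this] at hs
  · have h1 := Metric.mem_ball.1 (hU1 (hx.1 s hs'))
    have h2 := Metric.mem_ball'.1 (hU1 hxU)
    linarith [dist_triangle (ψ s x) v₀ x]

end Plane

theorem gradient_flow_strictMono {F : ℝ × ℝ → ℝ} (hF : Differentiable ℝ F)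
    {φ : ℝ → ℝ × ℝ → ℝ × ℝ}
    (hφ : ∀ x t, HasDerivAt (fun s => φ s x)
      (fderiv ℝ F (φ t x) (1, 0), fderiv ℝ F (φ t x) (0, 1)) t)
    (h0 : ∀ x, φ 0 x = x) (hadd : ∀ s t x, φ (s + t) x = φ s (φ t x))
    (hfix : ∀ x, fderiv ℝ F x = 0 → ∀ t, φ t x = x) {x : ℝ × ℝ} (hx : fderiv ℝ F x ≠ 0) :
    StrictMono fun s => F (φ s x) := by
  have hd := fun t => hasDerivAt_along hF (hφ x t)
  refine strictMono_of_deriv_pos fun t => ?_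
  rw [(hd t).deriv]
  have hne : fderiv ℝ F (φ t x) ≠ 0 := fun h => by
    have h1 := hfix _ h (-t)
    rw [← hadd, neg_add_cancel, h0] at h1
    exact hx (h1 ▸ h)
  by_contra! h
  refine hne (fderiv_eq_zero_iff_pair.2 ⟨?_, ?_⟩) <;> simp only at h ⊢ <;> nlinarith

open Manifold in
/-- The Morse-type system of a smooth function on the torus. -/
theorem exists_morseSys {f : Circle × Circle → ℝ}
    (hf : ContMDiff ((𝓡 1).prod (𝓡 1)) 𝓘(ℝ) (⊤ : ℕ∞) f) :
    ∃ S : MorseSys (Circle × Circle),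
      S.f = f ∧ S.C = {x | mfderiv ((𝓡 1).prod (𝓡 1)) 𝓘(ℝ) f x = 0} := by
  have hcrit := mfderiv_torus_eq_zero_iff hf
  have hF := contDiff_comp_torusMk hf
  have hFf : ∀ v, f (torusMk v) = (f ∘ torusMk) v := fun _ => rfl
  have p₁ : ∀ v, (f ∘ torusMk) (v + (2 * Real.pi, 0)) = (f ∘ torusMk) v := fun v =>
    congrArg f (torusMk_add_fst v)
  have p₂ : ∀ v, (f ∘ torusMk) (v + (0, 2 * Real.pi)) = (f ∘ torusMk) v := fun v =>
    congrArg f (torusMk_add_snd v)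
  generalize f ∘ torusMk = F at hcrit hF hFf p₁ p₂
  have hF1 : ContDiff ℝ 1 F := hF.of_le (by exact_mod_cast le_top)
  have hFd := hF1.differentiable one_ne_zero
  have hd : ∀ c : ℝ × ℝ, (∀ x, F (x + c) = F x) → ∀ x, fderiv ℝ F (x + c) = fderiv ℝ F x :=
    fun c hc x => by
      rw [← fderiv_comp_add_right]
      simp only [hc]
  have hF' : ContDiff ℝ 1 (fderiv ℝ F) := (contDiff_infty.1 hF 2).fderiv_right (by norm_num)
  have ha : ContDiff ℝ 1 fun v => fderiv ℝ F v (1, 0) := hF'.clm_apply contDiff_const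
  have hb : ContDiff ℝ 1 fun v => fderiv ℝ F v (0, 1) := hF'.clm_apply contDiff_const
  obtain ⟨φ, Y, φ0, hφ, φadd, φc, φfix, hY, Yc⟩ := exists_torus_flow (ha.prodMk hb)
    (fun x => by simp only [hd _ p₁]) (fun x => by simp only [hd _ p₂])
  obtain ⟨ψ, Z, ψ0, hψ, ψadd, ψc, ψfix, hZ, Zc⟩ := exists_torus_flow (hb.neg.prodMk ha)
    (fun x => by simp only [hd _ p₁]) (fun x => by simp only [hd _ p₂])
  have hq := isOpenQuotientMap_torusMk
  have hs := hq.surjective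
  exact ⟨{
    f := f
    Y := Y
    Z := Z
    C := {x | mfderiv ((𝓡 1).prod (𝓡 1)) 𝓘(ℝ) f x = 0}
    f_cont := hf.continuous
    Y_cont := Yc
    Y_zero := hs.forall.2 fun v => by rw [hY, φ0]
    Y_add := fun s t => hs.forall.2 fun v => by rw [hY, hY, hY, φadd]
    Z_cont := Zc
    Z_zero := hs.forall.2 fun v => by rw [hZ, ψ0]
    Z_add := fun s t => hs.forall.2 fun v => by rw [hZ, hZ, hZ, ψadd]
    f_Z := fun s => hs.forall.2 fun v => by
      rw [hZ, hFf, hFf, level_flow_const hFd hψ ψ0]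
    mono := hs.forall.2 fun v hv => by
      simp only [hY, hFf]
      exact gradient_flow_strictMono hFd hφ φ0 φadd
        (fun x hx => φfix x (by simp [hx])) fun h => hv ((hcrit v).2 h)
    Y_crit := hs.forall.2 fun v hv s => by
      rw [hY, φfix v (by simp [(hcrit v).1 hv])]
    Z_crit := hs.forall.2 fun v hv s => by
      rw [hZ, ψfix v (by simp [(hcrit v).1 hv])]
    box := hs.forall.2 fun v hv ε hε => by
      have h := eventually_exists_level_flow hF1 hψ ψ0 ψc (fun h => hv ((hcrit v).2 h)) hε
      rw [show (torusMk v, torusMk v) = Prod.map torusMk torusMk (v, v) from rfl,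
        ← (hq.prodMap hq).map_nhds_eq, eventually_map]
      filter_upwards [h] with z hz hfz
      have hfz' : F z.1 = F z.2 := by simpa only [Prod.map_fst, Prod.map_snd, hFf] using hfz
      obtain ⟨s, hs, hsz⟩ := hz hfz'
      exact ⟨s, hs, by rw [Prod.map_fst, hZ, hsz, Prod.map_snd]⟩
    noper := hs.forall.2 fun v hv => by
      obtain ⟨ε, hε, h⟩ := exists_eventually_level_flow_ne hF1 hψ ψ0 ψc
        fun h => hv ((hcrit v).2 h)
      refine ⟨ε, hε, ?_⟩
      rw [← hq.map_nhds_eq, eventually_map]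
      filter_upwards [h] with x hx s hs hsε he
      rw [hZ] at he
      exact (hx s hs hsε).1 (torusMk_injOn he (hx s hs hsε).2)
    punct := torus_punct
    neBot := torus_neBot }, rfl, rfl⟩

end Helpers

open Manifold

/-- **Section 3 (torus).** Any two smooth functions on the torus `S¹ × S¹` having
exactly three critical points are topologically conjugate: up to topological
conjugation there is a unique minimal function on the torus. -/
theorem minimal_functions_on_torus_conjugate
    (f g : Circle × Circle → ℝ)
    (hf : ContMDiff ((𝓡 1).prod (𝓡 1)) 𝓘(ℝ) (⊤ : ℕ∞) f)
    (hg : ContMDiff ((𝓡 1).prod (𝓡 1)) 𝓘(ℝ) (⊤ : ℕ∞) g)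
    (hfc : {x | mfderiv ((𝓡 1).prod (𝓡 1)) 𝓘(ℝ) f x = 0}.encard = 3)
    (hgc : {x | mfderiv ((𝓡 1).prod (𝓡 1)) 𝓘(ℝ) g x = 0}.encard = 3) :
    ∃ (h : Circle × Circle ≃ₜ Circle × Circle) (h' : ℝ ≃ₜ ℝ),
      StrictMono h' ∧ ∀ x, f (h x) = h' (g x) := by
  obtain ⟨S, rfl, hS⟩ := exists_morseSys hf
  obtain ⟨S', rfl, hS'⟩ := exists_morseSys hg
  exact S.exists_conj S' (by rw [hS]; exact hfc) (by rw [hS']; exact hgc)
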